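/- Let η ∈ [0, 1/4] and let (ε_k) and (λ_k) be sequences of real numbers with 0 < λ_k < ε_k < 1/4 for all k and ε_k → η, λ_k → η. Then there exists a sequence (τ_k) in [1,∞) with τ_k → ∞ such that for every function g on the closed unit disc that is continuous, non-vanishing on the closed unit disc, and analytic on the open unit disc, there is a strictly increasing sequence (k_j) of indices such that the functions z ↦ ζ(1/2 + ε_{k_j} + λ_{k_j}·z + i·τ_{k_j}) converge uniformly on the closed unit disc to g as j → ∞. -/

import Mathlib

open Complex Filter Set Metric Topology

namespace Vor

/-- primes in the block between exp (4 * m) and exp (4 * m + 2) -/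
noncomputable def blk (m : ℕ) : Finset ℕ :=
  (Finset.Ioc ⌊Real.exp (4 * m)⌋₊ ⌊Real.exp (4 * m + 2)⌋₊).filter Nat.Prime

lemma mem_blk {m p : ℕ} (hp : p ∈ blk m) :
    p.Prime ∧ Real.exp (4 * m) < p ∧ (p : ℝ) ≤ Real.exp (4 * m + 2) := by
  simp only [blk, Finset.mem_filter, Finset.mem_Ioc] at hp
  obtain ⟨⟨h1, h2⟩, h3⟩ := hp
  refine ⟨h3, (Nat.floor_lt (Real.exp_pos _).le).1 h1, (Nat.le_floor_iff (Real.exp_pos _).le).1 h2⟩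

lemma blk_theta (m : ℕ) : ∑ p ∈ blk m, Real.log p =
    Chebyshev.theta (Real.exp (4 * m + 2)) - Chebyshev.theta (Real.exp (4 * m)) := by
  have hle : ⌊Real.exp (4 * m)⌋₊ ≤ ⌊Real.exp (4 * m + 2)⌋₊ :=
    Nat.floor_le_floor (Real.exp_le_exp.2 (by linarith))
  simp only [Chebyshev.theta, blk]
  rw [← Finset.Ioc_union_Ioc_eq_Ioc (Nat.zero_le _) hle, Finset.filter_union,
    Finset.sum_union]
  · ring
  · apply Finset.disjoint_filter_filter
    exact Finset.disjoint_left.2 (fun a ha hb => by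
      simp only [Finset.mem_Ioc] at ha hb; omega)

lemma blk_card : ∀ᶠ m : ℕ in atTop, Real.exp (4 * m) / (4 * m + 2) ≤ (blk m).card := by
  have hE : (7:ℝ) ≤ Real.exp 2 := by
    have := Real.exp_one_gt_d9
    have h2 : Real.exp 2 = Real.exp 1 * Real.exp 1 := by rw [← Real.exp_add]; norm_num
    rw [h2]; nlinarith
  have key : ∀ᶠ x : ℝ in atTop, x / 2 ≤ Chebyshev.theta x := by
    have h1 : (fun x : ℝ => Real.log (x + 2)) =o[atTop] (fun x : ℝ => x) := by
      have h := Real.isLittleO_log_id_atTop.comp_tendsto (tendsto_atTop_add_const_right atTop (2:ℝ) tendsto_id)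
      refine h.trans_isBigO ?_
      refine Asymptotics.IsBigO.of_bound 3 ?_
      filter_upwards [eventually_ge_atTop (1:ℝ)] with x hx
      simp only [Function.comp, id, Real.norm_eq_abs]
      rw [abs_of_nonneg (by linarith), abs_of_nonneg (by linarith)]; linarith
    have h2 : (fun x : ℝ => √x * Real.log x) =o[atTop] (fun x : ℝ => x) := by
      have h := isLittleO_log_rpow_atTop (r := 1/2) (by norm_num)
      have h' := (Asymptotics.isBigO_refl (fun x : ℝ => √x) atTop).mul_isLittleO h
      refine h'.congr' (Eventually.of_forall fun x => rfl) ?_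
      filter_upwards [eventually_ge_atTop (1:ℝ)] with x hx
      rw [← Real.sqrt_eq_rpow, Real.mul_self_sqrt (by linarith)]
    filter_upwards [h1.bound (c := 1/100) (by norm_num), h2.bound (c := 1/100) (by norm_num),
      eventually_ge_atTop (100:ℝ)] with x e1 e2 hx
    have h := Chebyshev.theta_ge' (x := x) (by linarith)
    have l2 := Real.log_two_gt_d9
    simp only [Real.norm_eq_abs] at e1 e2
    have e1' := (le_abs_self _).trans e1
    have e2' := (le_abs_self _).trans e2
    rw [abs_of_nonneg (by linarith : (0:ℝ) ≤ x)] at e1' e2'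
    nlinarith
  have ht : Tendsto (fun m : ℕ => Real.exp (4 * m + 2)) atTop atTop :=
    Real.tendsto_exp_atTop.comp (tendsto_atTop_add_const_right _ _
      (tendsto_natCast_atTop_atTop.const_mul_atTop (by norm_num)))
  filter_upwards [ht.eventually key] with m hm
  have hs := blk_theta m
  have hu := Chebyshev.theta_le_log4_mul_x (Real.exp_pos (4 * m)).le
  have l4 : Real.log 4 ≤ 1.4 := by
    have : Real.log 4 = 2 * Real.log 2 := by
      rw [show (4:ℝ) = 2 ^ 2 by norm_num, Real.log_pow]; norm_num
    have := Real.log_two_lt_d9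
    linarith
  have hpos := Real.exp_pos (4 * (m:ℝ))
  rw [Real.exp_add] at hm
  have hge : Real.exp (4 * m) ≤ ∑ p ∈ blk m, Real.log p := by
    rw [hs, Real.exp_add]; nlinarith
  have hle : ∑ p ∈ blk m, Real.log p ≤ ∑ p ∈ blk m, (4 * (m:ℝ) + 2) := by
    refine Finset.sum_le_sum fun p hp => ?_
    obtain ⟨h1, h2, h3⟩ := mem_blk hp
    rw [Real.log_le_iff_le_exp (by exact_mod_cast h1.pos)]; exact h3
  rw [Finset.sum_const, nsmul_eq_mul] at hle
  rw [div_le_iff₀ (by positivity)]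
  linarith

end Vor

namespace Vor

lemma bigO_of_le {f : ℂ → ℂ} {C K : ℝ} {s : Set ℂ} (h : ∀ w ∈ s, ‖f w‖ ≤ C * Real.exp (K * ‖w‖)) :
    ∃ c < (2 : ℝ), ∃ B, f =O[Bornology.cobounded ℂ ⊓ 𝓟 s] fun z => Real.exp (B * ‖z‖ ^ c) := by
  refine ⟨1, by norm_num, K, ?_⟩
  refine Asymptotics.IsBigO.of_bound C ?_
  rw [Filter.eventually_inf_principal]
  refine Eventually.of_forall fun w hw => ?_
  rw [Real.rpow_one, Real.norm_eq_abs, abs_of_pos (Real.exp_pos _)]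
  exact h w hw

lemma pl {B : ℂ → ℂ} {R C C' h : ℝ} (hR : 0 ≤ R) (hB : Differentiable ℂ B)
    (hC : ∀ w, ‖B w‖ ≤ C * Real.exp (R * ‖w‖))
    (hS : ∀ x : ℝ, 0 ≤ x → ‖B x‖ ≤ C' * Real.exp (h * x)) (w : ℂ) (hw : 0 ≤ w.re) :
    ‖B w‖ ≤ max C C' * Real.exp (h * w.re + R * |w.im|) := by
  have hC0 : 0 ≤ C := by
    have := (norm_nonneg _).trans (hC 0); simpa using this
  -- auxiliary function with sign
  have aux : ∀ a : ℝ, ∀ w : ℂ, ‖B w * cexp (-(h * w) + a * I * w)‖ =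
      ‖B w‖ * Real.exp (-(h * w.re) - a * w.im) := by
    intro a w
    rw [norm_mul, Complex.norm_exp]
    congr 2
    simp; ring
  have growth : ∀ a : ℝ, ∀ w : ℂ, ‖B w * cexp (-(h * w) + a * I * w)‖ ≤
      C * Real.exp ((R + |h| + |a|) * ‖w‖) := by
    intro a w
    rw [aux]
    calc _ ≤ C * Real.exp (R * ‖w‖) * Real.exp (|h| * ‖w‖ + |a| * ‖w‖) := by
          gcongr
          · exact hC w
          · have h1 : -(h * w.re) ≤ |h| * ‖w‖ := by
              refine (neg_le_abs _).trans ?_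
              rw [abs_mul]; gcongr; exact Complex.abs_re_le_norm w
            have h2 : -(a * w.im) ≤ |a| * ‖w‖ := by
              refine (neg_le_abs _).trans ?_
              rw [abs_mul]; gcongr; exact Complex.abs_im_le_norm w
            linarith
      _ = _ := by rw [mul_assoc, ← Real.exp_add]; congr 2; ring
  have hd : ∀ a : ℝ, Differentiable ℂ (fun w : ℂ => B w * cexp (-(h * w) + a * I * w)) := by
    intro a; fun_prop
  have real : ∀ a : ℝ, ∀ x : ℝ, 0 ≤ x → ‖B x * cexp (-(h * x) + a * I * x)‖ ≤ max C C' := by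
    intro a x hx
    rw [aux]
    have := hS x hx
    calc _ ≤ (C' * Real.exp (h * x)) * Real.exp (-(h * (x:ℂ).re) - a * (x:ℂ).im) := by gcongr
      _ = C' := by simp [mul_assoc, ← Real.exp_add]
      _ ≤ _ := le_max_right _ _
  have conv : ∀ a : ℝ, a * w.im = R * |w.im| → ‖B w * cexp (-(h * w) + a * I * w)‖ ≤ max C C' →
      ‖B w‖ ≤ max C C' * Real.exp (h * w.re + R * |w.im|) := by
    intro a ha hb
    rw [aux, ha] at hb
    calc ‖B w‖ = (‖B w‖ * Real.exp (-(h * w.re) - R * |w.im|)) * Real.exp (h * w.re + R * |w.im|) := by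
          rw [mul_assoc, ← Real.exp_add]; simp
      _ ≤ _ := by gcongr
  rcases le_total 0 w.im with him | him
  · apply conv R (by rw [abs_of_nonneg him])
    refine PhragmenLindelof.quadrant_I (f := fun w : ℂ => B w * cexp (-(h * w) + R * I * w))
      (hd R).diffContOnCl (bigO_of_le (fun w _ => growth R w)) (real R) ?_ hw him
    intro x hx
    simp only [aux]
    have := hC (x * I)
    calc _ ≤ (C * Real.exp (R * ‖(x:ℂ) * I‖)) * Real.exp (-(h * ((x:ℂ) * I).re) - R * ((x:ℂ)*I).im) := by gcongr
      _ = C := by simp [mul_assoc, ← Real.exp_add, abs_of_nonneg hx]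
      _ ≤ _ := le_max_left _ _
  · apply conv (-R) (by rw [abs_of_nonpos him]; ring)
    refine PhragmenLindelof.quadrant_IV (f := fun w : ℂ => B w * cexp (-(h * w) + (-R : ℝ) * I * w))
      (hd (-R)).diffContOnCl (bigO_of_le (fun w _ => growth (-R) w)) (real (-R)) ?_ hw him
    intro x hx
    simp only [aux]
    have := hC (x * I)
    calc _ ≤ (C * Real.exp (R * ‖(x:ℂ) * I‖)) * Real.exp (-(h * ((x:ℂ) * I).re) - (-R) * ((x:ℂ)*I).im) := by gcongr
      _ = C := by simp [mul_assoc, ← Real.exp_add, abs_of_nonpos hx]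
      _ ≤ _ := le_max_left _ _

lemma final_zero {B : ℂ → ℂ} {R C C' κ : ℝ} (hR : 0 ≤ R) (hB : Differentiable ℂ B)
    (hC : ∀ w, ‖B w‖ ≤ C * Real.exp (R * ‖w‖)) (hκ : R < κ)
    (hS : ∀ x : ℝ, 0 ≤ x → ‖B x‖ ≤ C' * Real.exp (-κ * x)) : ∀ w, B w = 0 := by
  have hC0 : 0 ≤ C := by
    have := (norm_nonneg _).trans (hC 0); simpa using this
  have hC0' : 0 ≤ C' := by
    have := (norm_nonneg _).trans (hS 0 le_rfl); simpa using this
  set δ := κ - R with hδ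
  have hδ0 : 0 < δ := by rw [hδ]; linarith
  have hpi := Real.pi_pos
  set E : ℂ → ℂ := fun z => I * R * z - R * z + I * δ * z / 2 - (δ / Real.pi : ℝ) * ((z + 1) * log (z + 1)) with hE
  have hEre : ∀ z : ℂ, (E z).re = - R * z.im - R * z.re - δ * z.im / 2 - (δ / Real.pi) *
      ((z.re + 1) * Real.log ‖z + 1‖ - z.im * arg (z + 1)) := by
    intro z
    simp only [hE, Complex.sub_re, Complex.add_re, Complex.re_ofReal_mul, Complex.mul_re (z+1), Complex.log_re, Complex.log_im]
    simp
    ring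
  have hone : ∀ z : ℂ, 0 ≤ z.re → 1 ≤ ‖z + 1‖ := by
    intro z hz
    have := Complex.re_le_norm (z + 1)
    simp at this; linarith
  have harg : ∀ z : ℂ, 0 ≤ z.re → z.im * arg (z + 1) ≤ |z.im| * (Real.pi / 2) := by
    intro z hz
    refine (le_abs_self _).trans ?_
    rw [abs_mul]
    gcongr
    exact Complex.abs_arg_le_pi_div_two_iff.2 (by simp; linarith)
  have hEle : ∀ z : ℂ, 0 ≤ z.re → (E z).re ≤ - R * z.im - R * z.re - δ * z.im / 2 + δ * |z.im| / 2
      - (δ / Real.pi) * ((z.re + 1) * Real.log ‖z + 1‖) := by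
    intro z hz
    rw [hEre]
    have h1 := harg z hz
    have h3 : (δ / Real.pi) * (z.im * arg (z + 1)) ≤ (δ / Real.pi) * (|z.im| * (Real.pi / 2)) := by gcongr
    have h4 : (δ / Real.pi) * (|z.im| * (Real.pi / 2)) = δ * |z.im| / 2 := by field_simp
    linarith
  have hEle' : ∀ z : ℂ, 0 ≤ z.re → (E z).re ≤ - R * z.im - R * z.re - δ * z.im / 2 + δ * |z.im| / 2 := by
    intro z hz
    have h1 := hEle z hz
    have h2 := Real.log_nonneg (hone z hz)
    have : 0 ≤ (δ / Real.pi) * ((z.re + 1) * Real.log ‖z + 1‖) := by positivity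
    linarith
  set f : ℂ → ℂ := fun z => B (I * z) * cexp (E z) with hf
  have hfn : ∀ z, ‖f z‖ = ‖B (I * z)‖ * Real.exp (E z).re := by
    intro z; rw [hf]; simp only [norm_mul, Complex.norm_exp]
  have hzero : EqOn f 0 {z : ℂ | 0 ≤ z.re} := by
    apply PhragmenLindelof.eq_zero_on_right_half_plane_of_superexponential_decay
    · apply DifferentiableOn.diffContOnCl
      rw [closure_setOfPred_lt_re]
      intro z hz
      simp only [Set.mem_ofPred_eq] at hz
      apply DifferentiableAt.differentiableWithinAt
      have : z + 1 ∈ slitPlane := Or.inl (by simp; linarith)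
      have hl : DifferentiableAt ℂ (fun z => log (z + 1)) z :=
        DifferentiableAt.clog (by fun_prop) this
      have hBB : DifferentiableAt ℂ (fun z => B (I * z)) z := by fun_prop
      simp only [hf, hE]
      fun_prop
    · refine bigO_of_le (C := C) (K := 3 * R + δ) ?_
      intro z hz
      have hz' : 0 ≤ z.re := le_of_lt hz
      rw [hfn]
      have h1 := hEle' z hz'
      have h2 := Complex.abs_im_le_norm z
      have h3 := Complex.abs_re_le_norm z
      have h4 := neg_abs_le z.im
      have h5 := hC (I * z)
      rw [norm_mul, Complex.norm_I, one_mul] at h5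
      have h6 : (E z).re ≤ (2 * R + δ) * ‖z‖ := by
        have : -R * z.im ≤ R * ‖z‖ := by nlinarith
        have : 0 ≤ R * z.re := by positivity
        have : 0 ≤ R * ‖z‖ := by positivity
        nlinarith
      calc _ ≤ (C * Real.exp (R * ‖z‖)) * Real.exp ((2 * R + δ) * ‖z‖) := by gcongr
        _ = _ := by rw [mul_assoc, ← Real.exp_add]; congr 2; ring
    · -- decay
      intro n
      have hlim : Tendsto (fun x : ℝ => C * Real.exp (-(x * ((δ / Real.pi) * Real.log (x + 1) - n)))) atTop (𝓝 0) := by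
        have h1 : Tendsto (fun x : ℝ => (δ / Real.pi) * Real.log (x + 1) - n) atTop atTop := by
          apply tendsto_atTop_add_const_right
          apply Tendsto.const_mul_atTop (by positivity)
          exact Real.tendsto_log_atTop.comp (tendsto_atTop_add_const_right _ _ tendsto_id)
        have h2 := (Real.tendsto_exp_neg_atTop_nhds_zero.comp (tendsto_id.atTop_mul_atTop₀ h1)).const_mul C
        simpa using h2
      refine squeeze_zero' ?_ ?_ hlim
      · exact Eventually.of_forall fun x => by positivity
      · filter_upwards [eventually_ge_atTop (0:ℝ)] with x hx
        rw [hfn]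
        have h1 := hEle x (by simpa using hx)
        have h5 := hC (I * x)
        have hnx : ‖(x:ℂ) + 1‖ = x + 1 := by
          rw [show (x:ℂ) + 1 = ((x+1 : ℝ) : ℂ) by push_cast; ring, Complex.norm_real, Real.norm_eq_abs, abs_of_nonneg (by linarith)]
        rw [hnx] at h1
        simp only [Complex.ofReal_re, Complex.ofReal_im] at h1
        rw [norm_mul, Complex.norm_I, one_mul, Complex.norm_real, Real.norm_eq_abs, abs_of_nonneg hx] at h5
        have hl := Real.log_nonneg (by linarith : 1 ≤ x + 1)
        have h6 : (E x).re ≤ - R * x - (δ / Real.pi) * (x * Real.log (x + 1)) := by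
          have : 0 ≤ (δ / Real.pi) * Real.log (x + 1) := by positivity
          simp at h1
          nlinarith
        rw [← Real.exp_nat_mul]
        calc Real.exp (n * x) * (‖B (I * x)‖ * Real.exp (E x).re)
            ≤ Real.exp (n * x) * ((C * Real.exp (R * x)) * Real.exp (- R * x - (δ / Real.pi) * (x * Real.log (x + 1)))) := by gcongr
          _ = _ := by
            rw [show Real.exp (n * x) * ((C * Real.exp (R * x)) * Real.exp (- R * x - (δ / Real.pi) * (x * Real.log (x + 1)))) = C * (Real.exp (n * x) * Real.exp (R * x) * Real.exp (- R * x - (δ / Real.pi) * (x * Real.log (x + 1)))) by ring, ← Real.exp_add, ← Real.exp_add]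
            congr 2; ring
    · refine ⟨max C C', fun y => ?_⟩
      rw [hfn]
      have h1 := hEle' (y * I) (by simp)
      have hB1 : I * (y * I) = ((-y : ℝ) : ℂ) := by
        push_cast
        linear_combination (y : ℂ) * I_mul_I
      rw [hB1]
      simp at h1
      rcases le_total 0 y with hy | hy
      · refine le_trans ?_ (le_max_left _ _)
        have h5 := hC ((-y : ℝ) : ℂ)
        rw [Complex.norm_real, Real.norm_eq_abs, abs_neg, abs_of_nonneg hy] at h5
        rw [abs_of_nonneg hy] at h1
        calc _ ≤ (C * Real.exp (R * y)) * Real.exp (-(R * y)) := by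
              gcongr
              linarith
          _ = C := by simp [mul_assoc, ← Real.exp_add]
      · refine le_trans ?_ (le_max_right _ _)
        have h5 := hS (-y) (by linarith)
        rw [abs_of_nonpos hy] at h1
        calc _ ≤ (C' * Real.exp (-κ * -y)) * Real.exp (κ * (-y)) := by
              gcongr
              rw [hδ] at h1; linarith
          _ = C' := by simp [mul_assoc, ← Real.exp_add]
  have hup : ∀ w : ℂ, 0 ≤ w.im → B w = 0 := by
    intro w hw
    have := hzero (x := -I * w) (by simpa using hw)
    simp only [hf, Pi.zero_apply, mul_eq_zero, Complex.exp_ne_zero, or_false] at this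
    rwa [show I * (-I * w) = w by linear_combination (-w) * I_mul_I] at this
  have han : AnalyticOnNhd ℂ B univ := fun z _ => hB.analyticAt z
  have h0 : B =ᶠ[𝓝 I] 0 := by
    have : {w : ℂ | 0 < w.im} ∈ 𝓝 I := (isOpen_lt continuous_const Complex.continuous_im).mem_nhds (by simp)
    filter_upwards [this] with w hw
    exact hup w (le_of_lt hw)
  intro w
  exact han.eqOn_zero_of_preconnected_of_eventuallyEq_zero isPreconnected_univ (mem_univ I) h0 (mem_univ w)

lemma division {f : ℂ → ℂ} (hf : Differentiable ℂ f) (v : ℕ → ℂ) (N : ℕ)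
    (hv : ∀ i < N, ∀ j < N, v i = v j → i = j) (h0 : ∀ i < N, f (v i) = 0) :
    ∃ E : ℂ → ℂ, Differentiable ℂ E ∧ ∀ w, f w = (∏ i ∈ Finset.range N, (w - v i)) * E w := by
  induction N with
  | zero => exact ⟨f, hf, by simp⟩
  | succ N ih =>
    obtain ⟨E, hE, hfE⟩ := ih (fun i hi j hj => hv i (by omega) j (by omega)) (fun i hi => h0 i (by omega))
    have hEN : E (v N) = 0 := by
      have := h0 N (by omega)
      rw [hfE, mul_eq_zero] at this
      rcases this with h | h
      · exfalso
        rw [Finset.prod_eq_zero_iff] at h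
        obtain ⟨i, hi, h⟩ := h
        have hi' := Finset.mem_range.1 hi
        have := hv N (by omega) i (by omega) (sub_eq_zero.1 h)
        omega
      · exact h
    refine ⟨dslope E (v N), ?_, ?_⟩
    · have := (Complex.differentiableOn_dslope (f := E) (c := v N) (s := univ) univ_mem).2 hE.differentiableOn
      exact differentiableOn_univ.1 this
    · intro w
      rw [hfE, Finset.prod_range_succ, mul_assoc]
      congr 1
      have := sub_smul_dslope E (v N) w
      rw [smul_eq_mul, hEN, sub_zero] at this
      exact this.symm

lemma interp {F : ℂ → ℂ} (hF : Differentiable ℂ F) (v : ℕ → ℂ) (N : ℕ)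
    (hv : ∀ i < N, ∀ j < N, v i = v j → i = j) (x : ℂ) {ρ e Λ q M : ℝ} (hρ : 0 < ρ) 
    (he0 : 0 ≤ e) (hq0 : 0 ≤ q)
    (he : ∀ i < N, ‖F (v i)‖ ≤ e)
    (hΛ : ∀ j < N, ∀ w ∈ closedBall x ρ,
      ∏ i ∈ (Finset.range N).erase j, (‖w - v i‖ / ‖v j - v i‖) ≤ Λ)
    (hq : ∀ w ∈ sphere x ρ, ∏ i ∈ Finset.range N, ‖x - v i‖ ≤ q * ∏ i ∈ Finset.range N, ‖w - v i‖)
    (hM : ∀ w ∈ sphere x ρ, ‖F w‖ ≤ M) :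
    ‖F x‖ ≤ N * e * Λ + q * (M + N * e * Λ) := by
  set P : ℂ → ℂ := fun w => ∑ j ∈ Finset.range N, F (v j) *
    ∏ i ∈ (Finset.range N).erase j, ((w - v i) / (v j - v i)) with hP
  have hPd : Differentiable ℂ P := by
    simp only [hP]
    fun_prop
  have hPb : ∀ w ∈ closedBall x ρ, ‖P w‖ ≤ N * e * Λ := by
    intro w hw
    calc ‖P w‖ ≤ ∑ j ∈ Finset.range N, ‖F (v j) *
        ∏ i ∈ (Finset.range N).erase j, ((w - v i) / (v j - v i))‖ := norm_sum_le _ _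
      _ ≤ ∑ j ∈ Finset.range N, e * Λ := by
        refine Finset.sum_le_sum fun j hj => ?_
        rw [norm_mul, norm_prod]
        simp only [norm_div]
        have hj' := Finset.mem_range.1 hj
        exact mul_le_mul (he j hj') (hΛ j hj' w hw) (by positivity) he0
      _ = _ := by simp; ring
  have hPv : ∀ j < N, P (v j) = F (v j) := by
    intro j hj
    simp only [hP]
    rw [Finset.sum_eq_single j]
    · rw [Finset.prod_eq_one, mul_one]
      intro i hi
      have hi1 := Finset.ne_of_mem_erase hi
      have hi2 := Finset.mem_range.1 (Finset.mem_of_mem_erase hi)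
      apply div_self
      intro h
      exact hi1 (hv j hj i hi2 (sub_eq_zero.1 h)).symm
    · intro k hk hkj
      rw [mul_eq_zero]; right
      apply Finset.prod_eq_zero (i := j)
      · exact Finset.mem_erase.2 ⟨hkj.symm, Finset.mem_range.2 hj⟩
      · simp
    · intro h; exact absurd (Finset.mem_range.2 hj) h
  obtain ⟨E, hE, hfE⟩ := division (f := fun w => F w - P w) (hF.sub hPd) v N hv
    (fun i hi => by simp [hPv i hi])
  have hmax : ‖(∏ i ∈ Finset.range N, (x - v i)) * E x‖ ≤ q * (M + N * e * Λ) := by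
    have hd : DiffContOnCl ℂ (fun w => (∏ i ∈ Finset.range N, (x - v i)) * E w) (ball x ρ) :=
      (hE.const_mul _).diffContOnCl
    refine Complex.norm_le_of_forall_mem_frontier_norm_le (isBounded_ball) hd ?_
      (subset_closure (mem_ball_self hρ))
    intro w hw
    rw [frontier_ball x hρ.ne'] at hw
    rw [norm_mul, norm_prod]
    calc _ ≤ (q * ∏ i ∈ Finset.range N, ‖w - v i‖) * ‖E w‖ := by
          gcongr; exact hq w hw
      _ = q * ‖(∏ i ∈ Finset.range N, (w - v i)) * E w‖ := by rw [norm_mul, norm_prod]; ring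
      _ ≤ _ := by
        rw [← hfE]
        gcongr
        exact (norm_sub_le _ _).trans (add_le_add (hM w hw) (hPb w (sphere_subset_closedBall hw)))
  rw [← hfE] at hmax
  calc ‖F x‖ = ‖P x + (F x - P x)‖ := by congr 1; ring
    _ ≤ _ := (norm_add_le _ _).trans (add_le_add (hPb x (mem_closedBall_self hρ.le)) hmax)

end Vor

namespace Vor

lemma prod_dist_lower (N j : ℕ) (hj : j < N + 1) :
    (N.factorial : ℝ) ≤ ∏ i ∈ (Finset.range (N + 1)).erase j, (2 * |(i:ℝ) - j|) := by
  have h1 : ∏ i ∈ (Finset.range (N + 1)).erase j, (2 * |(i:ℝ) - j|) =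
      2 ^ N * ((j.factorial : ℝ) * ((N - j).factorial : ℝ)) := by
    rw [Finset.prod_mul_distrib]
    congr 1
    · rw [Finset.prod_const, Finset.card_erase_of_mem (Finset.mem_range.2 hj)]; simp
    · have e : (Finset.range (N + 1)).erase j = (Finset.range j) ∪ (Finset.Ico (j + 1) (N + 1)) := by
        ext i; simp only [Finset.mem_erase, Finset.mem_range, Finset.mem_union, Finset.mem_Ico]; omega
      rw [e, Finset.prod_union]
      · congr 1
        · rw [← Finset.prod_range_reflect, ← Finset.prod_range_add_one_eq_factorial]
          push_cast
          refine Finset.prod_congr rfl fun i hi => ?_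
          have hi' := Finset.mem_range.1 hi
          have : ((j - 1 - i : ℕ) : ℝ) = (j:ℝ) - 1 - i := by
            rw [Nat.cast_sub (by omega), Nat.cast_sub (by omega)]; simp
          rw [this, abs_of_nonpos] <;> [ring; skip]
          have : (i:ℝ) ≥ 0 := by positivity
          linarith
        · rw [Finset.prod_Ico_eq_prod_range, ← Finset.prod_range_add_one_eq_factorial]
          rw [show N + 1 - (j + 1) = N - j by omega]
          push_cast
          refine Finset.prod_congr rfl fun i hi => ?_
          rw [abs_of_nonneg] <;> [ring; skip]
          have : (i:ℝ) ≥ 0 := by positivity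
          linarith
      · rw [Finset.disjoint_left]
        intro a ha hb
        simp only [Finset.mem_range, Finset.mem_Ico] at ha hb; omega
  rw [h1]
  have h2 : N.factorial = N.choose j * (j.factorial * (N - j).factorial) := by
    rw [← Nat.choose_mul_factorial_mul_factorial (by omega : j ≤ N)]; ring
  have h3 : N.choose j ≤ 2 ^ N := Nat.choose_le_two_pow _ _
  rw [h2]
  push_cast
  gcongr
  exact_mod_cast h3

lemma prod_ratio (n : ℕ) : ∏ k ∈ Finset.range n, ((k + 2 : ℝ) / (2 * n - k)) =
    (n + 1) / (n.centralBinom : ℝ) := by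
  rw [Finset.prod_div_distrib]
  have h1 : ∏ k ∈ Finset.range n, (k + 2 : ℝ) = ((n + 1).factorial : ℝ) := by
    rw [← Finset.prod_range_add_one_eq_factorial, Finset.prod_range_succ']
    push_cast; simp; refine Finset.prod_congr rfl fun k _ => by ring
  have h2 : ∏ k ∈ Finset.range n, (2 * n - k : ℝ) = (n.factorial : ℝ) * n.centralBinom := by
    have := Nat.descFactorial_eq_prod_range (2 * n) n
    rw [Nat.descFactorial_eq_factorial_mul_choose] at this
    rw [Nat.centralBinom_eq_two_mul_choose]
    have h3 := congrArg (Nat.cast (R := ℝ)) this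
    push_cast at h3
    rw [h3]
    refine Finset.prod_congr rfl fun k hk => ?_
    have := Finset.mem_range.1 hk
    rw [Nat.cast_sub (by omega)]; push_cast; ring
  rw [h1, h2, Nat.factorial_succ]
  have : (n.factorial : ℝ) ≠ 0 := by positivity
  have : (n.centralBinom : ℝ) ≠ 0 := by exact_mod_cast n.centralBinom_ne_zero
  push_cast
  field_simp

/-- single application of the interpolation bound -/
lemma interp_nodes {F : ℂ → ℂ} (hF : Differentiable ℂ F) {R C e : ℝ} (hR0 : 0 ≤ R) (hR : R ≤ 1 / 4) (hC : 0 ≤ C)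
    (hFb : ∀ w : ℂ, 0 ≤ w.re → ‖F w‖ ≤ C * Real.exp (R * |w.im|))
    (he0 : 0 ≤ e) (x : ℝ) (M n : ℕ) (hM1 : 4 * M ≤ x) (hM2 : x < 4 * M + 4) (hn : 1 ≤ n) (hMn : 8 * (n + 1) ≤ 4 * M)
    (ξ : ℕ → ℝ) (hξ1 : ∀ m, M - n ≤ m → 4 * m ≤ ξ m ∧ ξ m ≤ 4 * m + 2)
    (he : ∀ m, M - n ≤ m → m < M + n → ‖F (ξ m)‖ ≤ e) :
    ‖F x‖ ≤ (4 * n * Real.exp (12 * (n + 1))) * e + 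
      ((n + 1) / (n.centralBinom : ℝ)) ^ 2 * (C * Real.exp (2 * (n + 1))) := by
  set v : ℕ → ℂ := fun i => (ξ (M - n + i) : ℝ) with hvdef
  have hMnR : (8:ℝ) * (n + 1) ≤ 4 * M := by exact_mod_cast hMn
  have hcast : ∀ i : ℕ, ((M - n + i : ℕ) : ℝ) = (M:ℝ) - n + i := by
    intro i; rw [Nat.cast_add, Nat.cast_sub (by omega)]
  have hξ : ∀ i, 4 * ((M:ℝ) - n + i) ≤ ξ (M - n + i) ∧ ξ (M - n + i) ≤ 4 * ((M:ℝ) - n + i) + 2 := by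
    intro i; have := hξ1 (M - n + i) (by omega); rwa [hcast] at this
  set ρ : ℝ := 8 * (n + 1) with hρdef
  have hρ : 0 < ρ := by positivity
  have hvsub : ∀ i j : ℕ, i ≠ j → 2 * |(i:ℝ) - j| ≤ ‖v j - v i‖ := by
    intro i j hij
    simp only [hvdef]
    rw [← Complex.ofReal_sub, Complex.norm_real, Real.norm_eq_abs]
    obtain ⟨a1, a2⟩ := hξ i
    obtain ⟨b1, b2⟩ := hξ j
    rcases lt_or_gt_of_ne hij with h | h
    · have h' : (i:ℝ) + 1 ≤ j := by exact_mod_cast h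
      rw [abs_of_nonpos (by linarith), abs_of_nonneg (by linarith)]; linarith
    · have h' : (j:ℝ) + 1 ≤ i := by exact_mod_cast h
      rw [abs_of_nonneg (by linarith), abs_of_nonpos (by linarith)]; linarith
  have hxlow : ∀ k < n, ‖(x:ℂ) - v (n - 1 - k)‖ ≤ 4 * (k + 2) := by
    intro k hk
    simp only [hvdef]
    rw [← Complex.ofReal_sub, Complex.norm_real, Real.norm_eq_abs]
    obtain ⟨a1, a2⟩ := hξ (n - 1 - k)
    have hc : ((n - 1 - k : ℕ) : ℝ) = (n:ℝ) - 1 - k := by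
      rw [Nat.cast_sub (by omega), Nat.cast_sub (by omega)]; simp
    rw [hc] at a1 a2
    have : (0:ℝ) ≤ k := by positivity
    rw [abs_of_nonneg (by linarith)]; linarith
  have hxhigh : ∀ k < n, ‖(x:ℂ) - v (n + k)‖ ≤ 4 * (k + 2) := by
    intro k hk
    simp only [hvdef]
    rw [← Complex.ofReal_sub, Complex.norm_real, Real.norm_eq_abs]
    obtain ⟨a1, a2⟩ := hξ (n + k)
    push_cast at a1 a2
    have : (0:ℝ) ≤ k := by positivity
    rw [abs_le]; constructor <;> linarith
  have hxall : ∀ i < 2 * n, ‖(x:ℂ) - v i‖ ≤ 4 * (n + 1) := by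
    intro i hi
    rcases lt_or_ge i n with h | h
    · have := hxlow (n - 1 - i) (by omega)
      rw [show n - 1 - (n - 1 - i) = i by omega] at this
      have h2 : ((n - 1 - i : ℕ) : ℝ) + 1 ≤ n := by exact_mod_cast (by omega : n - 1 - i + 1 ≤ n)
      linarith
    · have := hxhigh (i - n) (by omega)
      rw [show n + (i - n) = i by omega] at this
      have h2 : ((i - n : ℕ) : ℝ) + 1 ≤ n := by exact_mod_cast (by omega : i - n + 1 ≤ n)
      linarith
  have main := interp hF v (2 * n) (M := C * Real.exp (2 * (n + 1))) (Λ := Real.exp (12 * (n + 1)))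
    (q := ((n + 1) / (n.centralBinom : ℝ)) ^ 2) (e := e) ?_ (x : ℂ) hρ he0 (by positivity) ?_ ?_ ?_ ?_
  · have hq1 : ((n + 1) / (n.centralBinom : ℝ)) ^ 2 ≤ 1 := by
      have h1 : n + 1 ≤ n.centralBinom := by
        have h4 := Nat.choose_le_centralBinom 1 n
        rw [Nat.choose_one_right] at h4
        omega
      have h1' : ((n:ℝ) + 1) ≤ n.centralBinom := by exact_mod_cast h1
      have : ((n + 1) / (n.centralBinom : ℝ)) ≤ 1 := by
        rw [div_le_one (by exact_mod_cast n.centralBinom_pos)]; exact h1'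
      exact pow_le_one₀ (by positivity) this
    have h0 : 0 ≤ ((2 * n : ℕ) : ℝ) * e * Real.exp (12 * (n + 1)) := by positivity
    push_cast at main h0
    nlinarith
  · intro i hi j hj hij
    by_contra hne
    have := hvsub i j hne
    rw [hij, sub_self, norm_zero] at this
    have h2 : |(i:ℝ) - j| > 0 := abs_pos.2 (sub_ne_zero.2 (by exact_mod_cast hne))
    linarith
  · intro i hi
    exact he _ (by omega) (by omega)
  · intro j hj w hw
    rw [Finset.prod_div_distrib]
    have hw' : ‖w - x‖ ≤ ρ := by simpa [dist_eq_norm] using hw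
    obtain ⟨N, hN⟩ : ∃ N, 2 * n = N + 1 := ⟨2 * n - 1, by omega⟩
    have hnum : ∏ i ∈ (Finset.range (2 * n)).erase j, ‖w - v i‖ ≤ (12 * ((n:ℝ) + 1)) ^ N := by
      calc _ ≤ ∏ i ∈ (Finset.range (2 * n)).erase j, (12 * ((n:ℝ) + 1)) := by
            refine Finset.prod_le_prod (fun _ _ => norm_nonneg _) fun i hi => ?_
            have := hxall i (Finset.mem_range.1 (Finset.mem_of_mem_erase hi))
            calc ‖w - v i‖ = ‖(w - x) + (x - v i)‖ := by congr 1; ring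
              _ ≤ ρ + 4 * (n + 1) := (norm_add_le _ _).trans (add_le_add hw' this)
              _ = _ := by rw [hρdef]; ring
        _ = _ := by
          rw [Finset.prod_const, Finset.card_erase_of_mem (Finset.mem_range.2 hj), Finset.card_range, hN]; simp
    have hden : (N.factorial : ℝ) ≤ ∏ i ∈ (Finset.range (2 * n)).erase j, ‖v j - v i‖ := by
      rw [hN]
      refine (prod_dist_lower N j (by omega)).trans ?_
      refine Finset.prod_le_prod (fun _ _ => by positivity) fun i hi => ?_
      exact hvsub i j (Finset.ne_of_mem_erase hi)
    calc _ ≤ (12 * ((n:ℝ) + 1)) ^ N / (N.factorial : ℝ) := by gcongr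
      _ ≤ _ := Real.pow_div_factorial_le_exp _ (by positivity) N
  · intro w hw
    have hw' : ‖w - x‖ = ρ := by simpa [dist_eq_norm] using hw
    have split : ∀ f : ℕ → ℝ, ∏ i ∈ Finset.range (2 * n), f i =
        ∏ k ∈ Finset.range n, (f (n - 1 - k) * f (n + k)) := by
      intro f
      rw [two_mul, Finset.prod_range_add, Finset.prod_mul_distrib, Finset.prod_range_reflect]
    have one : ∀ k < n, ∀ i, ‖(x:ℂ) - v i‖ ≤ 4 * (k + 2) → ‖(x:ℂ) - v i‖ ≤ ((k + 2 : ℝ) / (2 * n - k)) * ‖w - v i‖ := by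
      intro k hk i hi
      have hk' : (k:ℝ) + 1 ≤ n := by exact_mod_cast hk
      have h1 : ρ ≤ ‖w - v i‖ + ‖(x:ℂ) - v i‖ := by
        rw [← hw', show w - x = (w - v i) - (x - v i) by ring]; exact norm_sub_le _ _
      have h2 : 4 * (2 * n - k) ≤ ‖w - v i‖ := by rw [hρdef] at h1; linarith
      have h3 : (0:ℝ) < 2 * n - k := by linarith
      calc _ ≤ 4 * ((k:ℝ) + 2) := hi
        _ = ((k + 2 : ℝ) / (2 * n - k)) * (4 * (2 * n - k)) := by field_simp
        _ ≤ _ := by gcongr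
    have h2 := prod_ratio n
    rw [split, split, ← h2, ← Finset.prod_pow, ← Finset.prod_mul_distrib]
    refine Finset.prod_le_prod (fun _ _ => by positivity) fun k hk => ?_
    have hk := Finset.mem_range.1 hk
    have hk' : (k:ℝ) + 1 ≤ n := by exact_mod_cast hk
    have h3 : (0:ℝ) < 2 * n - k := by linarith
    have A := one k hk _ (hxlow k hk)
    have B := one k hk _ (hxhigh k hk)
    calc _ ≤ (((k + 2 : ℝ) / (2 * n - k)) * ‖w - v (n - 1 - k)‖) * (((k + 2 : ℝ) / (2 * n - k)) * ‖w - v (n + k)‖) := by gcongr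
      _ = _ := by ring
  · intro w hw
    have hw' : ‖w - x‖ = ρ := by simpa [dist_eq_norm] using hw
    have h1 := (Complex.abs_re_le_norm (w - x)).trans hw'.le
    have h2 := (Complex.abs_im_le_norm (w - x)).trans hw'.le
    simp at h1 h2
    have h3 := (abs_le.1 h1).1
    refine (hFb w (by rw [hρdef] at h3; linarith)).trans ?_
    have h5 : R * |w.im| ≤ 2 * (n + 1) := by
     calc R * |w.im| ≤ (1 / 4) * ρ := by gcongr
      _ = _ := by rw [hρdef]; ring
    exact mul_le_mul_of_nonneg_left (Real.exp_le_exp.2 h5) hC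

end Vor

namespace Vor

lemma term2_bound (n : ℕ) (hn : 1 ≤ n) : ((n+1)/(n.centralBinom:ℝ))^2*Real.exp (2*(n+1)) ≤
    (4 * 16 ^ 4 * Real.exp 3) * Real.exp (-(n:ℝ)/2) := by
  have h1 : (4:ℝ) ^ n ≤ 2 * n * n.centralBinom := by
    exact_mod_cast Nat.four_pow_le_two_mul_self_mul_centralBinom n (by omega)
  have hc : (0:ℝ) < n.centralBinom := by exact_mod_cast n.centralBinom_pos
  have hn0 : (0:ℝ) < n := by exact_mod_cast hn
  have h2 : ((n+1)/(n.centralBinom:ℝ)) ≤ 2 * (n+1)^2 / 4 ^ n := by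
    rw [div_le_div_iff₀ hc (by positivity)]
    calc ((n:ℝ)+1) * 4 ^ n ≤ (n+1) * (2 * n * n.centralBinom) := by gcongr
      _ ≤ (n+1) * (2 * (n+1) * n.centralBinom) := by gcongr; linarith
      _ = _ := by ring
  have h3 : ((n:ℝ)+1)^4 ≤ 16 ^ 4 * Real.exp ((n+1)/4) := by
    have : ((n:ℝ)+1)/16 ≤ Real.exp ((n+1)/16) := by
      have := Real.add_one_le_exp (((n:ℝ)+1)/16); linarith
    have h4 : (((n:ℝ)+1)/16)^4 ≤ Real.exp ((n+1)/16) ^ 4 := by gcongr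
    rw [← Real.exp_nat_mul] at h4
    have h5 : ((4:ℕ):ℝ) * ((n+1)/16) = ((n:ℝ)+1)/4 := by push_cast; ring
    rw [h5, div_pow, div_le_iff₀ (by positivity)] at h4
    linarith
  have h6 : Real.exp (11/4 * n) ≤ 16 ^ n := by
    have : Real.exp (11/4) ≤ 16 := by
      have h : Real.exp (11/4) ^ 4 ≤ 16 ^ 4 := by
        rw [← Real.exp_nat_mul]
        have : ((4:ℕ):ℝ) * (11/4) = ((11:ℕ):ℝ) * 1 := by norm_num
        rw [this, Real.exp_nat_mul]
        calc Real.exp 1 ^ 11 ≤ 2.7182818286 ^ 11 := by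
              gcongr; exact Real.exp_one_lt_d9.le
          _ ≤ 16 ^ 4 := by norm_num
      exact le_of_pow_le_pow_left₀ (by norm_num) (by norm_num) h
    rw [mul_comm, Real.exp_nat_mul]
    gcongr
  calc ((n+1)/(n.centralBinom:ℝ))^2*Real.exp (2*(n+1))
      ≤ (2 * (n+1)^2 / 4 ^ n)^2 * Real.exp (2*(n+1)) := by gcongr
    _ = 4 * (n+1)^4 / 16 ^ n * Real.exp (2*(n+1)) := by
        have : (16:ℝ)^n = (4^n)^2 := by rw [← pow_mul, mul_comm, pow_mul]; norm_num
        rw [this]; field_simp; ring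
    _ ≤ 4 * (16 ^ 4 * Real.exp ((n+1)/4)) / Real.exp (11/4 * n) * Real.exp (2*(n+1)) := by gcongr
    _ = (4 * 16 ^ 4) * Real.exp ((n+1)/4 - 11/4*n + 2*(n+1)) := by
        rw [Real.exp_add, Real.exp_sub]; ring
    _ ≤ (4 * 16 ^ 4) * Real.exp (3 + -(n:ℝ)/2) := by
        refine mul_le_mul_of_nonneg_left (Real.exp_le_exp.2 ?_) (by positivity); linarith
    _ = _ := by rw [Real.exp_add]; ring

lemma bern_step {B : ℂ → ℂ} {R C κ κ' : ℝ} (hR : 0 ≤ R) (hR4 : R ≤ 1/4) (hB : Differentiable ℂ B)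
    (hC : ∀ w, ‖B w‖ ≤ C * Real.exp (R * ‖w‖)) (hκ : κ' < κ) (hκ0 : 0 ≤ κ') (m0 : ℕ)
    (hs : ∀ m : ℕ, m0 ≤ m → ∃ ξ : ℝ, 4 * m ≤ ξ ∧ ξ ≤ 4 * m + 2 ∧ ‖B ξ‖ ≤ Real.exp (-κ * ξ))
    (h : ℝ) (hh : -κ' ≤ h) (hS : ∃ C', ∀ x : ℝ, 0 ≤ x → ‖B x‖ ≤ C' * Real.exp (h * x)) :
    ∃ C', ∀ x : ℝ, 0 ≤ x → ‖B x‖ ≤ C' * Real.exp ((h - min ((κ - κ')/100) (1/100) / 2) * x) := by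
  obtain ⟨C', hC'⟩ := hS
  set γ := κ - κ' with hγ
  have hγ0 : 0 < γ := by linarith
  set θ := min (γ/100) (1/100) with hθ
  have hθ0 : 0 < θ := by rw [hθ]; positivity
  have hθ1 : θ ≤ γ/100 := min_le_left _ _
  have hθ2 : θ ≤ 1/100 := min_le_right _ _
  have hCn : 0 ≤ C := by
    have := (norm_nonneg _).trans (hC 0)
    simpa using this
  set C1 := max C C' with hC1
  have hC10 : 0 ≤ C1 := hCn.trans (le_max_left _ _)
  have hpl := pl hR hB hC hC'
  choose! ξ hξa hξb hξc using hs
  set F : ℂ → ℂ := fun w => B w * Complex.exp (-h * w) with hF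
  have hFd : Differentiable ℂ F := by
    rw [hF]; fun_prop
  have hFn : ∀ w, ‖F w‖ = ‖B w‖ * Real.exp (-h * w.re) := by
    intro w
    rw [hF]; simp [Complex.norm_exp]
  have hFb : ∀ w : ℂ, 0 ≤ w.re → ‖F w‖ ≤ C1 * Real.exp (R * |w.im|) := by
    intro w hw
    rw [hFn]
    calc _ ≤ (C1 * Real.exp (h * w.re + R * |w.im|)) * Real.exp (-h * w.re) := by
          gcongr; exact hpl w hw
      _ = _ := by rw [mul_assoc, ← Real.exp_add]; congr 2; ring
  -- large x
  set x0 : ℝ := 1/θ + 8 * m0 + 100 with hx0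
  set K : ℝ := 4 * Real.exp 12 + (4 * 16 ^ 4 * Real.exp 3) * C1 * Real.exp (1/2) with hK
  have hK0 : 0 ≤ K := by positivity
  have large : ∀ x : ℝ, x0 ≤ x → ‖F x‖ ≤ K * Real.exp (-(θ/2) * x) := by
    intro x hx
    have hθx : 1 ≤ θ * x := by
      have : 1/θ ≤ x := by
        have : (0:ℝ) ≤ m0 := Nat.cast_nonneg _
        rw [hx0] at hx; linarith
      rw [div_le_iff₀ hθ0] at this; linarith
    have hinv : 0 < 1/θ := by positivity
    have hm0 : (0:ℝ) ≤ m0 := Nat.cast_nonneg _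
    have hx100 : 100 + 8 * m0 ≤ x := by linarith
    have hxp : 0 ≤ x := by linarith
    set M := ⌊x/4⌋₊ with hM
    set n := ⌊θ*x⌋₊ with hn
    have hM1 : (M:ℝ) ≤ x/4 := Nat.floor_le (by positivity)
    have hM2 : x/4 < M + 1 := Nat.lt_floor_add_one _
    have hn1 : (n:ℝ) ≤ θ*x := Nat.floor_le (by positivity)
    have hn2 : θ*x < n + 1 := Nat.lt_floor_add_one _
    have hn3 : 1 ≤ n := by rw [hn]; exact Nat.le_floor (by simpa using hθx)
    have hnx : (n:ℝ) ≤ x/100 := by nlinarith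
    have hnγ : (n:ℝ) ≤ γ*x/100 := by nlinarith
    have hMn : 8 * (n+1) ≤ 4 * M := by
      have : (8:ℝ) * (n+1) ≤ 4 * M := by linarith
      exact_mod_cast this
    have hMnm : m0 ≤ M - n := by
      have : (m0 + n : ℝ) ≤ M := by linarith
      have : m0 + n ≤ M := by exact_mod_cast this
      omega
    have key := interp_nodes (F := F) hFd (e := Real.exp (-γ*x/2)) hR hR4 hC10 hFb (Real.exp_pos _).le x M n
      (by linarith) (by linarith) hn3 (by exact_mod_cast hMn) ξ
      (fun m hm => ⟨hξa m (hMnm.trans hm), hξb m (hMnm.trans hm)⟩) (by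
        intro m hm _
        rw [hFn]
        have hb := hξc m (hMnm.trans hm)
        have ha := hξa m (hMnm.trans hm)
        have hmx : (M:ℝ) - n ≤ m := by
          have : M ≤ m + n := by omega
          have : (M:ℝ) ≤ m + n := by exact_mod_cast this
          linarith
        have hξx : x/2 ≤ ξ m := by linarith
        have : ((ξ m : ℝ) : ℂ).re = ξ m := by simp
        rw [this]
        calc ‖B (ξ m)‖ * Real.exp (-h * ξ m) ≤ Real.exp (-κ * ξ m) * Real.exp (-h * ξ m) := by gcongr
          _ = Real.exp (-(κ + h) * ξ m) := by rw [← Real.exp_add]; congr 1; ring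
          _ ≤ Real.exp (-γ*x/2) := by
            gcongr
            have : γ ≤ κ + h := by linarith
            nlinarith)
    refine key.trans ?_
    have t1 : (4*n*Real.exp (12*(n+1))) * Real.exp (-γ*x/2) ≤ 4 * Real.exp 12 * Real.exp (-(θ/2) * x) := by
      have : (n:ℝ) ≤ Real.exp n := by have := Real.add_one_le_exp (n:ℝ); linarith
      calc (4*n*Real.exp (12*(n+1))) * Real.exp (-γ*x/2) ≤
          (4*Real.exp n*Real.exp (12*(n+1))) * Real.exp (-γ*x/2) := by gcongr
        _ = 4 * Real.exp (n + 12 * (n+1) + (-γ*x/2)) := by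
            rw [Real.exp_add, Real.exp_add]; ring
        _ ≤ 4 * Real.exp (12 + (-(θ/2) * x)) := by
            refine mul_le_mul_of_nonneg_left (Real.exp_le_exp.2 ?_) (by positivity)
            have : θ * x ≤ γ/100 * x := by gcongr
            have : 0 ≤ γ * x := by positivity
            linarith
        _ = _ := by rw [Real.exp_add]; ring
    have t2 := term2_bound n hn3
    have t3 : Real.exp (-(n:ℝ)/2) ≤ Real.exp (1/2) * Real.exp (-(θ/2) * x) := by
      rw [← Real.exp_add]; gcongr; linarith
    calc _ ≤ 4 * Real.exp 12 * Real.exp (-(θ/2) * x) +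
          C1 * (((n+1)/(n.centralBinom:ℝ))^2 * Real.exp (2*(n+1))) := by
            refine add_le_add t1 (le_of_eq ?_); ring
      _ ≤ 4 * Real.exp 12 * Real.exp (-(θ/2) * x) +
          C1 * ((4 * 16 ^ 4 * Real.exp 3) * (Real.exp (1/2) * Real.exp (-(θ/2) * x))) := by
            refine add_le_add le_rfl (mul_le_mul_of_nonneg_left ?_ hC10)
            exact t2.trans (by gcongr)
      _ = _ := by rw [hK]; ring
  refine ⟨K + C1 * Real.exp (θ/2 * x0), fun x hx => ?_⟩
  have hFx : ‖F x‖ ≤ (K + C1 * Real.exp (θ/2 * x0)) * Real.exp (-(θ/2) * x) := by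
    rcases le_total x0 x with h1 | h1
    · refine (large x h1).trans ?_
      gcongr
      have : 0 ≤ C1 * Real.exp (θ/2 * x0) := by positivity
      linarith
    · have h2 := hFb x (by simpa using hx)
      simp only [ofReal_im, abs_zero, mul_zero, Real.exp_zero, mul_one] at h2
      calc _ ≤ C1 * 1 := by simpa using h2
        _ ≤ C1 * (Real.exp (θ/2 * x0) * Real.exp (-(θ/2) * x)) := by
            gcongr
            rw [← Real.exp_add]
            apply Real.one_le_exp
            nlinarith
        _ ≤ _ := by
            have : 0 ≤ K * Real.exp (-(θ/2) * x) := by positivity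
            nlinarith
  have h3 : ‖B x‖ = ‖F x‖ * Real.exp (h * x) := by
    rw [hFn, mul_assoc, ← Real.exp_add]; simp
  rw [h3]
  calc _ ≤ ((K + C1 * Real.exp (θ/2 * x0)) * Real.exp (-(θ/2) * x)) * Real.exp (h * x) := by gcongr
    _ = _ := by rw [mul_assoc, ← Real.exp_add]; congr 2; ring

lemma bernstein {B : ℂ → ℂ} {R C κ : ℝ} (hR : 0 ≤ R) (hR4 : R ≤ 1/4) (hB : Differentiable ℂ B)
    (hC : ∀ w, ‖B w‖ ≤ C * Real.exp (R * ‖w‖)) (hκ : R < κ) (m0 : ℕ)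
    (hs : ∀ m : ℕ, m0 ≤ m → ∃ ξ : ℝ, 4 * m ≤ ξ ∧ ξ ≤ 4 * m + 2 ∧ ‖B ξ‖ ≤ Real.exp (-κ * ξ)) :
    ∀ w, B w = 0 := by
  obtain ⟨κ', h1, h2⟩ := exists_between hκ
  set c := min ((κ - κ')/100) (1/100) / 2 with hc
  have hc0 : 0 < c := by
    have : 0 < κ - κ' := by linarith
    rw [hc]; positivity
  have hit : ∀ j : ℕ, ∃ h : ℝ, (h ≤ -κ' ∨ h ≤ R - j * c) ∧ ∃ C', ∀ x : ℝ, 0 ≤ x → ‖B x‖ ≤ C' * Real.exp (h * x) := by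
    intro j
    induction j with
    | zero =>
      refine ⟨R, Or.inr (by simp), C, fun x hx => ?_⟩
      have := hC x
      rwa [Complex.norm_real, Real.norm_of_nonneg hx] at this
    | succ j ih =>
      obtain ⟨h, hor, hS⟩ := ih
      by_cases hh : -κ' ≤ h
      · refine ⟨h - c, ?_, bern_step hR hR4 hB hC h2 (by linarith) m0 hs h hh hS⟩
        rcases hor with h3 | h3
        · left; linarith
        · right; push_cast; linarith
      · exact ⟨h, Or.inl (by linarith), hS⟩
  obtain ⟨j, hj⟩ := exists_nat_gt ((R + κ')/c)
  obtain ⟨h, hor, C', hS⟩ := hit j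
  have hh : h ≤ -κ' := by
    rcases hor with h3 | h3
    · exact h3
    · rw [div_lt_iff₀ hc0] at hj; linarith
  have hC'0 : 0 ≤ C' := by
    have := (norm_nonneg _).trans (hS 0 le_rfl)
    simpa using this
  exact final_zero hR hB hC h1 (C' := C') (fun x hx => (hS x hx).trans (by gcongr))

end Vor

namespace Vor

/-- linear combinations with coefficients of modulus at most one. -/
def combos {E : Type*} [AddCommMonoid E] [Module ℂ E] (S : Set ℕ) (x : ℕ → E) : Set E :=
  {v | ∃ F : Finset ℕ, (↑F ⊆ S) ∧ ∃ a : ℕ → ℂ, (∀ p, ‖a p‖ ≤ 1) ∧ v = ∑ p ∈ F, a p • x p}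

lemma combos_convex {E : Type*} [NormedAddCommGroup E] [NormedSpace ℂ E] (S : Set ℕ) (x : ℕ → E) :
    Convex ℝ (combos S x) := by
  classical
  rintro _ ⟨F, hF, a, ha, rfl⟩ _ ⟨G, hG, b, hb, rfl⟩ α β hα hβ hαβ
  refine ⟨F ∪ G, by simp [hF, hG], fun p => (α:ℂ) * (if p ∈ F then a p else 0) + (β:ℂ) * (if p ∈ G then b p else 0), ?_, ?_⟩
  · intro p
    refine (norm_add_le _ _).trans ?_
    rw [norm_mul, norm_mul, Complex.norm_real, Complex.norm_real, Real.norm_of_nonneg hα, Real.norm_of_nonneg hβ]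
    have h1 : ‖(if p ∈ F then a p else 0)‖ ≤ 1 := by split_ifs; exact ha p; simp
    have h2 : ‖(if p ∈ G then b p else 0)‖ ≤ 1 := by split_ifs; exact hb p; simp
    nlinarith
  · simp only [add_smul, Finset.sum_add_distrib, mul_smul]
    rw [← Finset.smul_sum, ← Finset.smul_sum]
    have e1 : ∑ p ∈ F, a p • x p = ∑ i ∈ F ∪ G, (if i ∈ F then a i else 0) • x i := by
      rw [← Finset.sum_subset (Finset.subset_union_left (s₁ := F) (s₂ := G))]
      · exact Finset.sum_congr rfl (fun i hi => by simp [hi])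
      · intro i _ hi; simp [hi]
    have e2 : ∑ p ∈ G, b p • x p = ∑ i ∈ F ∪ G, (if i ∈ G then b i else 0) • x i := by
      rw [← Finset.sum_subset (Finset.subset_union_right (s₁ := F) (s₂ := G))]
      · exact Finset.sum_congr rfl (fun i hi => by simp [hi])
      · intro i _ hi; simp [hi]
    rw [← e1, ← e2]
    simp [Complex.coe_smul]

lemma combos_dense {E : Type*} [NormedAddCommGroup E] [NormedSpace ℂ E] (S : Set ℕ) (x : ℕ → E)
    (h : ∀ f : E →L[ℂ] ℂ, f ≠ 0 → ∀ C : ℝ, ∃ F : Finset ℕ, ↑F ⊆ S ∧ C < ∑ p ∈ F, ‖f (x p)‖) (v : E) :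
    v ∈ closure (combos S x) := by
  by_contra hv
  obtain ⟨f, u, h1, h2⟩ := RCLike.geometric_hahn_banach_closed_point (𝕜 := ℂ)
    (combos_convex S x).closure isClosed_closure hv
  have h0 : (0:E) ∈ combos S x := ⟨∅, by simp, 0, by simp, by simp⟩
  have hu : 0 < u := by simpa using h1 0 (subset_closure h0)
  have hf : f ≠ 0 := by
    rintro rfl
    simp at h2; linarith
  obtain ⟨F, hF, hC⟩ := h f hf u
  have h3 := h1 (∑ p ∈ F, ((starRingEnd ℂ) (f (x p)) / ‖f (x p)‖) • x p) (subset_closure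
    ⟨F, hF, _, fun p => by
      rw [norm_div, RCLike.norm_conj, Complex.norm_real, norm_norm]; exact div_self_le_one _, rfl⟩)
  rw [map_sum, map_sum] at h3
  have h4 : ∀ p, RCLike.re (f (((starRingEnd ℂ) (f (x p)) / (‖f (x p)‖:ℂ)) • x p)) = ‖f (x p)‖ := by
    intro p
    rw [map_smul, smul_eq_mul]
    by_cases hz : f (x p) = 0
    · simp [hz]
    have : (starRingEnd ℂ) (f (x p)) / (‖f (x p)‖:ℂ) * f (x p) = (‖f (x p)‖ : ℂ) := by
      rw [div_mul_eq_mul_div, mul_comm, Complex.mul_conj, Complex.normSq_eq_norm_sq]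
      have : (‖f (x p)‖:ℂ) ≠ 0 := by simpa using hz
      push_cast; field_simp
    rw [this]; simp
  rw [Finset.sum_congr rfl (fun p _ => h4 p)] at h3
  linarith

lemma avg_unimod (a : ℂ) (ha : ‖a‖ ≤ 1) : ∃ w w' : ℂ, ‖w‖ = 1 ∧ ‖w'‖ = 1 ∧ (a - w) + (a - w') = 0 := by
  obtain ⟨u, hu, hau⟩ : ∃ u : ℂ, ‖u‖ = 1 ∧ a = ‖a‖ * u := by
    by_cases hz : a = 0
    · exact ⟨1, by simp, by simp [hz]⟩
    · have : (‖a‖:ℂ) ≠ 0 := by simpa using hz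
      exact ⟨a / ‖a‖, by rw [norm_div]; simp [hz], by field_simp⟩
  set r := ‖a‖ with hr
  have hr0 : 0 ≤ r := norm_nonneg _
  set q := Real.sqrt (1 - r^2) with hq
  have hq2 : q ^ 2 = 1 - r^2 := Real.sq_sqrt (by nlinarith)
  have key : ∀ t : ℝ, t ^ 2 = 1 - r^2 → ‖u * (r + t * I)‖ = 1 := by
    intro t ht
    rw [norm_mul, hu, one_mul, Complex.norm_add_mul_I, ht]; simp
  refine ⟨u * (r + q * I), u * (r + (-q : ℝ) * I), key q hq2, key (-q) (by rw [neg_sq, hq2]), ?_⟩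
  rw [hau]; push_cast; ring

lemma rounding {E : Type*} [NormedAddCommGroup E] [InnerProductSpace ℂ E] (x : ℕ → E) (a : ℕ → ℂ)
    (ha : ∀ p, ‖a p‖ ≤ 1) (F : Finset ℕ) :
    ∃ w : ℕ → ℂ, (∀ p, ‖w p‖ = 1) ∧ ‖∑ p ∈ F, (a p - w p) • x p‖ ^ 2 ≤ 4 * ∑ p ∈ F, ‖x p‖ ^ 2 := by
  classical
  induction F using Finset.induction_on with
  | empty => exact ⟨fun _ => 1, by simp, by simp⟩
  | insert p F hp ih =>
    obtain ⟨w, hw, hb⟩ := ih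
    set v := ∑ p ∈ F, (a p - w p) • x p with hv
    obtain ⟨c, hc, hre⟩ : ∃ c : ℂ, ‖c‖ = 1 ∧ RCLike.re (inner ℂ v ((a p - c) • x p)) ≤ 0 := by
      obtain ⟨c, c', h1, h2, h3⟩ := avg_unimod (a p) (ha p)
      have : RCLike.re (inner ℂ v ((a p - c) • x p)) + RCLike.re (inner ℂ v ((a p - c') • x p)) = 0 := by
        rw [← map_add, ← inner_add_right, ← add_smul, h3]; simp
      by_cases h : RCLike.re (inner ℂ v ((a p - c) • x p)) ≤ 0
      · exact ⟨c, h1, h⟩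
      · exact ⟨c', h2, by linarith⟩
    refine ⟨Function.update w p c, fun q => ?_, ?_⟩
    · by_cases hq : q = p
      · subst hq; simpa using hc
      · simpa [Function.update_of_ne hq] using hw q
    · rw [Finset.sum_insert hp, Finset.sum_insert hp]
      have e : ∑ q ∈ F, (a q - Function.update w p c q) • x q = v :=
        Finset.sum_congr rfl (fun q hq => by
          rw [Function.update_of_ne]; rintro rfl; exact hp hq)
      rw [e, Function.update_self, add_comm, norm_add_sq (𝕜 := ℂ)]
      have h5 : ‖a p - c‖ ≤ 2 := (norm_sub_le _ _).trans (by linarith [ha p])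
      have h6 : ‖(a p - c) • x p‖ ^ 2 ≤ 4 * ‖x p‖ ^ 2 := by
        rw [norm_smul, mul_pow]
        gcongr
        nlinarith [norm_nonneg (a p - c)]
      linarith

/-- abbreviation for the Hilbert space -/
noncomputable abbrev L2 := lp (fun _ : ℕ => ℂ) 2

noncomputable def ee (k : ℕ) : L2 := lp.single 2 k (1:ℂ)

lemma ee_norm (k : ℕ) : ‖ee k‖ = 1 := by
  rw [ee, lp.norm_single (by norm_num)]; simp

noncomputable def mk (c : ℕ → ℂ) : L2 := ∑' k, c k • ee k

lemma mk_hasSum {c : ℕ → ℂ} (hc : Summable (fun k => ‖c k‖)) : HasSum (fun k => c k • ee k) (mk c) := by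
  refine (Summable.of_norm ?_).hasSum
  simpa [norm_smul, ee_norm] using hc

lemma mk_norm_le {c : ℕ → ℂ} (hc : Summable (fun k => ‖c k‖)) : ‖mk c‖ ≤ ∑' k, ‖c k‖ := by
  rw [mk]
  refine (norm_tsum_le_tsum_norm ?_).trans ?_
  · simpa [norm_smul, ee_norm] using hc
  · simp [norm_smul, ee_norm]

lemma mk_apply {c : ℕ → ℂ} (hc : Summable (fun k => ‖c k‖)) (f : L2 →L[ℂ] ℂ) :
    HasSum (fun k => c k * f (ee k)) (f (mk c)) := by
  have := f.hasSum (mk_hasSum hc)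
  simpa using this

lemma f_zero (f : L2 →L[ℂ] ℂ) (h : ∀ k, f (ee k) = 0) : f = 0 := by
  ext v
  have h1 := f.hasSum (lp.hasSum_single (p := 2) (by norm_num) v)
  have h2 : (fun k => f (lp.single 2 k (v k))) = fun _ => 0 := by
    ext k
    have : lp.single (E := fun _ : ℕ => ℂ) 2 k (v k) = (v k) • ee k := by
      rw [ee, ← lp.single_smul]; simp
    rw [this, map_smul, h k]; simp
  rw [h2] at h1
  simpa using h1.unique hasSum_zero

lemma ee_inner (j k : ℕ) : inner ℂ (ee j) (ee k) = if j = k then (1:ℂ) else 0 := by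
  rw [ee, lp.inner_single_left, ee]
  by_cases h : j = k
  · subst h; simp
  · simp [h]

/-- evaluation functional -/
noncomputable def ev (z : ℂ) : L2 →L[ℂ] ℂ := innerSL ℂ (mk (fun k => (starRingEnd ℂ) z ^ k))

lemma summ_geo {z : ℂ} (hz : ‖z‖ < 1) : Summable (fun k => ‖(starRingEnd ℂ) z ^ k‖) := by
  simpa using summable_geometric_of_lt_one (norm_nonneg z) hz

lemma ev_ee {z : ℂ} (hz : ‖z‖ < 1) (k : ℕ) : ev z (ee k) = z ^ k := by
  have h1 := mk_apply (summ_geo hz) (innerSL ℂ (ee k))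
  simp only [innerSL_apply_apply, ee_inner] at h1
  have h2 : inner ℂ (ee k) (mk (fun k => (starRingEnd ℂ) z ^ k)) = (starRingEnd ℂ) z ^ k := by
    refine h1.unique ?_
    convert hasSum_ite_eq k ((starRingEnd ℂ) z ^ k) using 2 with j
    by_cases h : j = k
    · subst h; simp
    · simp [h, Ne.symm h]
  rw [ev, innerSL_apply_apply, ← inner_conj_symm, h2]; simp

lemma ev_norm {z : ℂ} (hz : ‖z‖ < 1) (v : L2) : ‖ev z v‖ ≤ (1 - ‖z‖)⁻¹ * ‖v‖ := by
  rw [ev, innerSL_apply_apply]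
  refine (norm_inner_le_norm _ _).trans ?_
  gcongr
  refine (mk_norm_le (summ_geo hz)).trans ?_
  simp only [norm_pow, RCLike.norm_conj]
  rw [tsum_geometric_of_lt_one (norm_nonneg z) hz]

lemma ev_mk {z : ℂ} (hz : ‖z‖ < 1) {c : ℕ → ℂ} (hc : Summable (fun k => ‖c k‖)) :
    HasSum (fun k => c k * z ^ k) (ev z (mk c)) := by
  have := mk_apply hc (ev z)
  simpa only [ev_ee hz] using this

end Vor

namespace Vor

lemma hs_congr {E : Type*} [AddCommMonoid E] [TopologicalSpace E] {f g : ℕ → E} {a : E} (h : ∀ n, f n = g n) :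
    HasSum f a ↔ HasSum g a := by
  rw [funext h]

/-- coefficients of `z ↦ p^{-(s0+R z)}` -/
noncomputable def xc (s0 R : ℝ) (p : ℕ) (k : ℕ) : ℂ :=
  ((p:ℝ) ^ (-s0) : ℝ) * ((-(R * Real.log p) : ℝ) ^ k / k.factorial : ℝ)

lemma rexp_hasSum (x : ℝ) : HasSum (fun n : ℕ => x ^ n / n.factorial) (Real.exp x) := by
  rw [Real.exp_eq_exp_ℝ]; exact NormedSpace.expSeries_div_hasSum_exp x

lemma cexp_hasSum (x : ℂ) : HasSum (fun n : ℕ => x ^ n / n.factorial) (Complex.exp x) := by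
  rw [Complex.exp_eq_exp_ℂ]; exact NormedSpace.expSeries_div_hasSum_exp x

lemma xc_norm (s0 R : ℝ) (hR : 0 ≤ R) (p : ℕ) (hp : 1 ≤ p) :
    HasSum (fun k => ‖xc s0 R p k‖) ((p:ℝ) ^ (-(s0 - R))) := by
  have hp0 : (0:ℝ) < p := by exact_mod_cast hp
  have hl : 0 ≤ Real.log p := Real.log_natCast_nonneg p
  have h1 := (rexp_hasSum (R * Real.log p)).mul_left ((p:ℝ) ^ (-s0))
  have hv : (p:ℝ) ^ (-(s0 - R)) = (p:ℝ) ^ (-s0) * Real.exp (R * Real.log p) := by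
    rw [Real.rpow_def_of_pos hp0, Real.rpow_def_of_pos hp0, ← Real.exp_add]
    congr 1; ring
  rw [hv]
  refine (hs_congr fun k => ?_).mpr h1
  · rw [xc, norm_mul, Complex.norm_real, Complex.norm_real, Real.norm_of_nonneg (by positivity),
      norm_div, norm_pow, norm_neg, Real.norm_of_nonneg (by positivity)]
    simp

noncomputable def xv (s0 R : ℝ) (p : ℕ) : L2 := mk (xc s0 R p)

lemma xv_norm (s0 R : ℝ) (hR : 0 ≤ R) (p : ℕ) (hp : 1 ≤ p) : ‖xv s0 R p‖ ≤ (p:ℝ) ^ (-(s0 - R)) := by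
  have := xc_norm s0 R hR p hp
  exact (mk_norm_le this.summable).trans this.tsum_eq.le

lemma ev_xv (s0 R : ℝ) (hR : 0 ≤ R) (p : ℕ) (hp : 1 ≤ p) (z : ℂ) (hz : ‖z‖ < 1) :
    ev z (xv s0 R p) = (p:ℂ) ^ (-(s0 + R * z)) := by
  have hp0 : (p:ℂ) ≠ 0 := by exact_mod_cast (by omega : p ≠ 0)
  refine (ev_mk hz (xc_norm s0 R hR p hp).summable).unique ?_
  have h1 := (cexp_hasSum (-(R * Real.log p) * z)).mul_left (((p:ℝ) ^ (-s0) : ℝ) : ℂ)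
  have hv : (p:ℂ) ^ (-(s0 + R * z)) = (((p:ℝ) ^ (-s0) : ℝ) : ℂ) * Complex.exp (-(R * Real.log p) * z) := by
    rw [Complex.ofReal_cpow (Nat.cast_nonneg p), Complex.cpow_def_of_ne_zero hp0, Complex.ofReal_natCast, Complex.cpow_def_of_ne_zero hp0,
      ← Complex.exp_add, ← Complex.natCast_log]
    congr 1; push_cast; ring
  rw [hv]
  refine (hs_congr fun k => ?_).mpr h1
  rw [xc]; push_cast; ring

/-- The entire function attached to a functional -/
noncomputable def BB (R : ℝ) (f : L2 →L[ℂ] ℂ) (w : ℂ) : ℂ := ∑' k : ℕ, f (ee k) * ((-(R * w)) ^ k / k.factorial)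

lemma BB_term (R : ℝ) (hR : 0 ≤ R) (f : L2 →L[ℂ] ℂ) (w : ℂ) (k : ℕ) :
    ‖f (ee k) * ((-(R * w)) ^ k / k.factorial)‖ ≤ ‖f‖ * ((R * ‖w‖) ^ k / k.factorial) := by
  rw [norm_mul]
  have h1 : ‖f (ee k)‖ ≤ ‖f‖ := by simpa [ee_norm] using f.le_opNorm (ee k)
  have h2 : ‖(-(R * w)) ^ k / (k.factorial : ℂ)‖ = (R * ‖w‖) ^ k / k.factorial := by
    rw [norm_div, norm_pow, norm_neg, norm_mul, Complex.norm_real, Real.norm_of_nonneg hR]; simp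
  rw [h2]; gcongr

lemma BB_hasSum (R : ℝ) (hR : 0 ≤ R) (f : L2 →L[ℂ] ℂ) (w : ℂ) :
    HasSum (fun k : ℕ => f (ee k) * ((-(R * w)) ^ k / k.factorial)) (BB R f w) :=
  (Summable.of_norm_bounded ((rexp_hasSum (R * ‖w‖)).summable.mul_left _) (BB_term R hR f w)).hasSum

lemma BB_norm (R : ℝ) (hR : 0 ≤ R) (f : L2 →L[ℂ] ℂ) (w : ℂ) : ‖BB R f w‖ ≤ ‖f‖ * Real.exp (R * ‖w‖) := by
  rw [BB]
  exact tsum_of_norm_bounded ((rexp_hasSum (R * ‖w‖)).mul_left _) (BB_term R hR f w)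

lemma BB_diff (R : ℝ) (hR : 0 ≤ R) (f : L2 →L[ℂ] ℂ) : Differentiable ℂ (BB R f) := by
  intro w
  have h : DifferentiableOn ℂ (BB R f) (ball 0 (‖w‖ + 1)) := by
    refine Complex.differentiableOn_tsum_of_summable_norm
      (u := fun k => ‖f‖ * ((R * (‖w‖+1)) ^ k / k.factorial))
      ((rexp_hasSum (R * (‖w‖+1))).summable.mul_left _) ?_ isOpen_ball ?_
    · intro k; fun_prop
    · intro k v hv
      refine (BB_term R hR f v k).trans ?_
      have : ‖v‖ ≤ ‖w‖ + 1 := by simpa using (mem_ball_zero_iff.1 hv).le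
      gcongr
  exact h.differentiableAt (isOpen_ball.mem_nhds (by simp))

lemma BB_zero (R : ℝ) (hR : 0 < R) (f : L2 →L[ℂ] ℂ) (h : ∀ w, BB R f w = 0) : f = 0 := by
  apply f_zero
  intro k
  set p := FormalMultilinearSeries.ofScalars ℂ (fun k : ℕ => f (ee k) * ((-(R:ℂ)) ^ k / k.factorial)) with hp
  have h1 : HasFPowerSeriesAt (0 : ℂ → ℂ) p 0 := by
    rw [hasFPowerSeriesAt_iff]
    refine Eventually.of_forall fun z => ?_
    have := BB_hasSum R hR.le f z
    rw [h z] at this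
    refine (hs_congr fun n => ?_).mpr this
    rw [hp, FormalMultilinearSeries.coeff_ofScalars, smul_eq_mul, neg_mul_eq_neg_mul, mul_pow]; ring
  have h2 := h1.eq_zero
  have h3 : p.coeff k = 0 := by rw [h2]; rfl
  rw [hp, FormalMultilinearSeries.coeff_ofScalars] at h3
  have hR' : (R:ℂ) ≠ 0 := by exact_mod_cast hR.ne'
  have hk : (k.factorial : ℂ) ≠ 0 := by exact_mod_cast k.factorial_ne_zero
  rcases mul_eq_zero.1 h3 with h4 | h4
  · exact h4
  · exfalso
    rw [div_eq_zero_iff] at h4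
    rcases h4 with h4 | h4
    · exact pow_ne_zero k (neg_ne_zero.2 hR') h4
    · exact hk h4

lemma f_xv (s0 R : ℝ) (hR : 0 ≤ R) (f : L2 →L[ℂ] ℂ) (p : ℕ) (hp : 1 ≤ p) :
    ‖f (xv s0 R p)‖ = (p:ℝ) ^ (-s0) * ‖BB R f (Real.log p)‖ := by
  have h1 := mk_apply (xc_norm s0 R hR p hp).summable f
  have h2 := (BB_hasSum R hR f (Real.log p)).mul_left (((p:ℝ) ^ (-s0) : ℝ) : ℂ)
  have : f (xv s0 R p) = (((p:ℝ) ^ (-s0) : ℝ) : ℂ) * BB R f (Real.log p) := by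
    refine h1.unique ?_
    refine (hs_congr fun k => ?_).mpr h2
    rw [xc]; push_cast; ring
  rw [this, norm_mul, Complex.norm_real, Real.norm_of_nonneg (by positivity)]

lemma sums_unbounded (s0 R : ℝ) (hs0 : 0 ≤ s0) (hR : 0 < R) (hR4 : R ≤ 1/4) (hRs : R < 1 - s0) (y : ℕ)
    (f : L2 →L[ℂ] ℂ) (hf : f ≠ 0) (C : ℝ) :
    ∃ F : Finset ℕ, (↑F ⊆ {p : ℕ | p.Prime ∧ y < p}) ∧ C < ∑ p ∈ F, ‖f (xv s0 R p)‖ := by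
  obtain ⟨κ, hκ1, hκ2⟩ := exists_between hRs
  have hB : ∀ m0 : ℕ, ∃ m : ℕ, m0 ≤ m ∧ ∀ ξ : ℝ, 4 * m ≤ ξ → ξ ≤ 4 * m + 2 → Real.exp (-κ * ξ) < ‖BB R f ξ‖ := by
    by_contra hcon
    push Not at hcon
    obtain ⟨m0, hm0⟩ := hcon
    exact hf (BB_zero R hR f (bernstein hR.le hR4 (BB_diff R hR.le f) (BB_norm R hR.le f) hκ1 m0 hm0))
  set δ := 1 - s0 - κ with hδ
  have hδ0 : 0 < δ := by linarith
  have hlim : Tendsto (fun m : ℕ => Real.exp (δ * (4 * m)) / (4*m+2) * Real.exp (-2*(s0+κ))) atTop atTop := by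
    apply Tendsto.atTop_mul_const (Real.exp_pos _)
    have h1 : Tendsto (fun x : ℝ => Real.exp (δ * x) / (x + 2)) atTop atTop := by
      have h2 := tendsto_exp_mul_div_rpow_atTop 1 δ hδ0
      have h3 : Tendsto (fun x : ℝ => Real.exp (δ * x) / x ^ (1:ℝ) * (1/2)) atTop atTop :=
        h2.atTop_mul_const (by norm_num)
      refine tendsto_atTop_mono' _ ?_ h3
      filter_upwards [eventually_ge_atTop 2] with x hx
      rw [Real.rpow_one, div_mul_div_comm, mul_one]
      gcongr
      linarith
    refine h1.comp (Tendsto.const_mul_atTop (by norm_num : (0:ℝ) < 4) tendsto_natCast_atTop_atTop)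
  obtain ⟨m1, hm1⟩ := eventually_atTop.1 (blk_card.and (hlim.eventually_gt_atTop C))
  obtain ⟨m, hm, hξ⟩ := hB (max m1 (y+1))
  obtain ⟨hc, hCm⟩ := hm1 m ((le_max_left _ _).trans hm)
  have hym : y < m := lt_of_lt_of_le (Nat.lt_succ_self y) ((le_max_right _ _).trans hm)
  refine ⟨blk m, ?_, ?_⟩
  · intro p hp
    obtain ⟨h1, h2, h3⟩ := mem_blk hp
    refine ⟨h1, ?_⟩
    have h4 : (m:ℝ) < p := by
      have := Real.add_one_le_exp (4 * (m:ℝ))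
      have : (0:ℝ) ≤ m := Nat.cast_nonneg _
      linarith
    have : m < p := by exact_mod_cast h4
    omega
  · have hterm : ∀ p ∈ blk m, Real.exp (-(s0+κ) * (4*m+2)) ≤ ‖f (xv s0 R p)‖ := by
      intro p hp
      obtain ⟨h1, h2, h3⟩ := mem_blk hp
      have hp0 : (0:ℝ) < p := by exact_mod_cast h1.pos
      rw [f_xv s0 R hR.le f p h1.one_lt.le]
      have hl1 : 4 * (m:ℝ) ≤ Real.log p := by rw [Real.le_log_iff_exp_le hp0]; exact h2.le
      have hl2 : Real.log p ≤ 4 * (m:ℝ) + 2 := by rw [Real.log_le_iff_le_exp hp0]; exact h3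
      have h5 := hξ _ hl1 hl2
      calc _ ≤ Real.exp (-(s0+κ) * Real.log p) := by
            have : 0 ≤ s0 + κ := by linarith
            apply Real.exp_le_exp.2
            nlinarith
        _ = (p:ℝ)^(-s0) * Real.exp (-κ * Real.log p) := by
            rw [Real.rpow_def_of_pos hp0, ← Real.exp_add]; congr 1; ring
        _ ≤ _ := by gcongr
    calc C < Real.exp (δ * (4 * m)) / (4*m+2) * Real.exp (-2*(s0+κ)) := hCm
      _ = Real.exp (4*m) / (4*m+2) * Real.exp (-(s0+κ) * (4*m+2)) := by
          rw [div_mul_eq_mul_div, div_mul_eq_mul_div, ← Real.exp_add, ← Real.exp_add]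
          congr 2; rw [hδ]; ring
      _ ≤ (blk m).card * Real.exp (-(s0+κ) * (4*m+2)) := by gcongr
      _ ≤ _ := by
          have := Finset.card_nsmul_le_sum (blk m) (fun p => ‖f (xv s0 R p)‖) _ hterm
          simpa using this

lemma tail_small {a δ : ℝ} (ha : 1 < a) (hδ : 0 < δ) : ∃ y : ℕ, ∀ F : Finset ℕ, (∀ p ∈ F, y < p) → ∑ p ∈ F, (p:ℝ) ^ (-a) < δ := by
  have hs : Summable (fun n : ℕ => (n:ℝ) ^ (-a)) := Real.summable_nat_rpow.2 (by linarith)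
  obtain ⟨s, hs⟩ := (summable_iff_vanishing_norm.1 hs) δ hδ
  refine ⟨s.sup id, fun F hF => ?_⟩
  have := hs F (by
    rw [Finset.disjoint_left]
    intro p hp hps
    have h1 := hF p hp
    have h2 : p ≤ s.sup id := Finset.le_sup (f := id) hps
    omega)
  exact (le_abs_self _).trans_lt this

lemma xc_target {Φ : ℂ → ℂ} {ρ : ℝ} (hρ : 1 < ρ) (hΦ : DifferentiableOn ℂ Φ (ball 0 ρ)) :
    ∃ c : ℕ → ℂ, Summable (fun k => ‖c k‖) ∧ ∀ z : ℂ, ‖z‖ < 1 → HasSum (fun k => c k * z ^ k) (Φ z) := by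
  obtain ⟨r, hr1, hr2⟩ := exists_between hρ
  lift r to NNReal using by linarith
  have h1 := (hΦ.mono (closedBall_subset_ball hr2)).hasFPowerSeriesOnBall (by exact_mod_cast (by linarith : (0:ℝ) < r))
  set p := cauchyPowerSeries Φ 0 r
  have h2 : ((1:NNReal) : ENNReal) < p.radius := lt_of_lt_of_le (by exact_mod_cast hr1) h1.r_le
  refine ⟨p.coeff, ?_, fun z hz => ?_⟩
  · have := p.summable_norm_mul_pow h2
    simpa using this
  · have h3 := h1.hasSum (y := z) (by
      rw [Metric.mem_eball, edist_zero_right]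
      have : ‖z‖₊ < r := by
        have : ‖z‖ < (r:ℝ) := by linarith
        exact_mod_cast this
      rw [enorm_eq_nnnorm]
      exact_mod_cast this)
    simp only [zero_add, FormalMultilinearSeries.apply_eq_pow_smul_coeff] at h3
    simpa [mul_comm] using h3

lemma approx1 (s0 R : ℝ) (hs0 : 0 ≤ s0) (hR : 0 < R) (hR4 : R ≤ 1/4) (hRs : R < 1 - s0) (hRs2 : 1/2 < s0 - R)
    {r δ : ℝ} (hr : r < 1) (hδ : 0 < δ) : ∃ y1 : ℕ, ∀ y ≥ y1, ∀ {Φ : ℂ → ℂ} {ρ : ℝ}, 1 < ρ →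
      DifferentiableOn ℂ Φ (ball 0 ρ) → ∃ F : Finset ℕ, (∀ p ∈ F, p.Prime ∧ y < p) ∧
      ∃ w : ℕ → ℂ, (∀ p, ‖w p‖ = 1) ∧ ∀ z : ℂ, ‖z‖ ≤ r →
        ‖Φ z - ∑ p ∈ F, w p * (p:ℂ) ^ (-(s0 + R * z))‖ < δ := by
  set ε := δ * (1 - r) / 4 with hε
  have hr1 : 0 < 1 - r := by linarith
  have hε0 : 0 < ε := by positivity
  obtain ⟨y1, hy1⟩ := tail_small (a := 2*(s0-R)) (δ := ε^2/4) (by linarith) (by positivity)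
  refine ⟨y1, fun y hy Φ ρ hρ hΦ => ?_⟩
  obtain ⟨c, hc, hcΦ⟩ := xc_target hρ hΦ
  have hd := combos_dense {p : ℕ | p.Prime ∧ y < p} (xv s0 R) (sums_unbounded s0 R hs0 hR hR4 hRs y) (mk c)
  obtain ⟨v, ⟨F, hF, a, ha, rfl⟩, hv⟩ := Metric.mem_closure_iff.1 hd ε hε0
  obtain ⟨w, hw, hwF⟩ := rounding (xv s0 R) a ha F
  refine ⟨F, fun p hp => hF hp, w, hw, fun z hz => ?_⟩
  have hz1 : ‖z‖ < 1 := by linarith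
  have hb : ‖∑ p ∈ F, (a p - w p) • xv s0 R p‖ ≤ ε := by
    refine le_of_sq_le_sq ?_ hε0.le
    refine hwF.trans ?_
    have h1 : ∑ p ∈ F, ‖xv s0 R p‖ ^ 2 ≤ ∑ p ∈ F, (p:ℝ) ^ (-(2*(s0-R))) := by
      refine Finset.sum_le_sum fun p hp => ?_
      have hp1 : 1 ≤ p := (hF hp).1.one_lt.le
      calc ‖xv s0 R p‖ ^ 2 ≤ ((p:ℝ) ^ (-(s0-R)))^2 := by gcongr; exact xv_norm s0 R hR.le p hp1
        _ = _ := by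
          rw [← Real.rpow_natCast, ← Real.rpow_mul (Nat.cast_nonneg p)]; congr 1; push_cast; ring
    have h2 := hy1 F (fun p hp => lt_of_le_of_lt hy (hF hp).2)
    linarith
  have hsum : ‖mk c - ∑ p ∈ F, w p • xv s0 R p‖ < 2 * ε := by
    have : mk c - ∑ p ∈ F, w p • xv s0 R p = (mk c - ∑ p ∈ F, a p • xv s0 R p) + ∑ p ∈ F, (a p - w p) • xv s0 R p := by
      simp only [sub_smul, Finset.sum_sub_distrib]; abel
    rw [this]
    rw [dist_eq_norm] at hv
    exact (norm_add_le _ _).trans_lt (by linarith)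
  have hev : Φ z - ∑ p ∈ F, w p * (p:ℂ) ^ (-(s0 + R * z)) = ev z (mk c - ∑ p ∈ F, w p • xv s0 R p) := by
    rw [map_sub, map_sum, (hcΦ z hz1).unique (ev_mk hz1 hc)]
    congr 1
    refine Finset.sum_congr rfl fun p hp => ?_
    rw [map_smul, ev_xv s0 R hR.le p (hF hp).1.one_lt.le z hz1, smul_eq_mul]
  rw [hev]
  calc _ ≤ (1 - ‖z‖)⁻¹ * ‖mk c - ∑ p ∈ F, w p • xv s0 R p‖ := ev_norm hz1 _
    _ ≤ (1 - r)⁻¹ * (2 * ε) := by gcongr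
    _ = δ / 2 := by rw [hε]; field_simp; ring
    _ < δ := by linarith

end Vor

namespace Vor

lemma norm_prime_cpow {p : ℕ} (hp : 1 ≤ p) (s : ℂ) : ‖(p:ℂ) ^ (-s)‖ = (p:ℝ) ^ (-s.re) := by
  rw [Complex.norm_natCast_cpow_of_pos (by omega)]; simp

lemma prime_cpow_lt_one {p : ℕ} (hp : p.Prime) {s : ℂ} (hs : 0 < s.re) : ‖(p:ℂ) ^ (-s)‖ < 1 := by
  rw [norm_prime_cpow hp.one_lt.le]
  exact Real.rpow_lt_one_of_one_lt_of_neg (by exact_mod_cast hp.one_lt) (by linarith)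

lemma one_sub_slit {u : ℂ} (hu : ‖u‖ < 1) : 1 - u ∈ Complex.slitPlane := by
  left
  have := (abs_re_le_norm u)
  have := abs_lt.1 (this.trans_lt hu)
  simp; linarith

lemma euler_approx {ε l : ℝ} (hl : 0 < l) (hle : l < ε) (hε : ε < 1/4) {h : ℂ → ℂ} {ρ : ℝ} (hρ : 1 < ρ)
    (hh : DifferentiableOn ℂ h (ball 0 ρ)) {δ : ℝ} (hδ : 0 < δ) (y0 : ℕ) :
    ∃ M : Finset ℕ, (∀ p ∈ M, p.Prime) ∧ (∀ p : ℕ, p.Prime → p ≤ y0 → p ∈ M) ∧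
      ∃ w : ℕ → ℂ, (∀ p, ‖w p‖ = 1) ∧ ∀ z : ℂ, ‖z‖ ≤ 1 →
        ‖Complex.exp (h z) - ∏ p ∈ M, (1 - w p * (p:ℂ) ^ (-(1/2 + ε + l * z)))⁻¹‖ < δ := by
  classical
  -- bound for exp h
  obtain ⟨H, hH⟩ : ∃ H : ℝ, ∀ z : ℂ, ‖z‖ ≤ 1 → ‖Complex.exp (h z)‖ ≤ H := by
    have hc : ContinuousOn (fun z => Complex.exp (h z)) (closedBall 0 1) :=
      (hh.continuousOn.mono (closedBall_subset_ball hρ)).cexp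
    obtain ⟨H, hH⟩ := (isCompact_closedBall (0:ℂ) 1).exists_bound_of_continuousOn hc
    exact ⟨H, fun z hz => hH z (by simpa using hz)⟩
  have hH0 : 0 ≤ H := (norm_nonneg _).trans (hH 0 (by simp))
  set δ1 := min (1/2) (δ / (8 * (H + 1))) with hδ1
  have hδ10 : 0 < δ1 := by rw [hδ1]; positivity
  have hδ1a : δ1 ≤ 1/2 := min_le_left _ _
  have hδ1b : δ1 ≤ δ / (8 * (H + 1)) := min_le_right _ _
  set s0 := 1/2 + ε with hs0
  obtain ⟨R, hR1, hR2⟩ := exists_between (show l < min ε (l * ρ) from lt_min hle (by nlinarith))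
  have hR2a : R < ε := hR2.trans_le (min_le_left _ _)
  have hR2b : R < l * ρ := hR2.trans_le (min_le_right _ _)
  have hR0 : 0 < R := by linarith
  obtain ⟨y1, hy1⟩ := approx1 s0 R (by linarith) hR0 (by linarith) (by linarith) (by linarith)
    (r := l/R) (δ := δ1) (by rw [div_lt_one hR0]; exact hR1) hδ10
  obtain ⟨y2, hy2⟩ := tail_small (a := 2*(s0-l)) (δ := δ1) (by linarith) hδ10
  set y := max (max y0 y1) (max y2 4) with hy
  have hyy0 : y0 ≤ y := (le_max_left _ _).trans (le_max_left _ _)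
  have hyy1 : y1 ≤ y := (le_max_right _ _).trans (le_max_left _ _)
  have hyy2 : y2 ≤ y := (le_max_left _ _).trans (le_max_right _ _)
  have hyy4 : 4 ≤ y := (le_max_right _ _).trans (le_max_right _ _)
  set P := (Finset.range (y+1)).filter Nat.Prime with hP
  set Φ : ℂ → ℂ := fun z => h (R / l * z) + ∑ p ∈ P, Complex.log (1 - (p:ℂ) ^ (-(s0 + R * z))) with hΦ
  have hΦd : DifferentiableOn ℂ Φ (ball 0 (min (l * ρ / R) (s0 / R))) := by
    rw [hΦ]
    refine DifferentiableOn.add ?_ ?_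
    · refine hh.comp (by fun_prop) ?_
      intro z hz
      have hz' : ‖z‖ < l * ρ / R := (mem_ball_zero_iff.1 hz).trans_le (min_le_left _ _)
      rw [mem_ball_zero_iff, norm_mul, norm_div, Complex.norm_real, Complex.norm_real,
        Real.norm_of_nonneg hR0.le, Real.norm_of_nonneg hl.le]
      rw [lt_div_iff₀ hR0] at hz'
      rw [div_mul_eq_mul_div, div_lt_iff₀ hl]; linarith
    · refine DifferentiableOn.fun_sum fun p hp => ?_
      have hpp : p.Prime := (Finset.mem_filter.1 hp).2
      have hp0 : (p:ℂ) ≠ 0 := by exact_mod_cast hpp.ne_zero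
      refine DifferentiableOn.clog ?_ ?_
      · refine DifferentiableOn.sub (by fun_prop) ?_
        refine DifferentiableOn.const_cpow (by fun_prop) (Or.inl hp0)
      · intro z hz
        have hz' : ‖z‖ < s0 / R := (mem_ball_zero_iff.1 hz).trans_le (min_le_right _ _)
        rw [lt_div_iff₀ hR0] at hz'
        apply one_sub_slit
        apply prime_cpow_lt_one hpp
        have h1 : -‖z‖ ≤ z.re := (abs_le.1 (abs_re_le_norm z)).1
        simp
        nlinarith
  obtain ⟨F, hF, w, hw, happ⟩ := hy1 y hyy1 (Φ := Φ) (lt_min (by rw [lt_div_iff₀ hR0]; linarith)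
    (by rw [lt_div_iff₀ hR0]; linarith)) hΦd
  set w' : ℕ → ℂ := fun p => if p ≤ y then 1 else w p with hw'
  have hdisj : Disjoint P F := by
    rw [Finset.disjoint_left]
    intro p hp hpF
    have h1 := (hF p hpF).2
    have h2 := Finset.mem_range.1 (Finset.mem_filter.1 hp).1
    omega
  refine ⟨P ∪ F, ?_, ?_, w', ?_, ?_⟩
  · intro p hp
    rcases Finset.mem_union.1 hp with hp | hp
    · exact (Finset.mem_filter.1 hp).2
    · exact (hF p hp).1
  · intro p hp hpy
    exact Finset.mem_union_left _ (Finset.mem_filter.2 ⟨Finset.mem_range.2 (by omega), hp⟩)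
  · intro p; simp only [hw']; split_ifs
    · simp
    · exact hw p
  intro z hz
  set s : ℂ := 1/2 + ε + l * z with hs
  have hzre : -1 ≤ z.re := by
    have := (abs_le.1 (abs_re_le_norm z)).1; linarith
  have hsre : s0 - l ≤ s.re := by
    rw [hs]; simp [-one_div]; norm_num; nlinarith
  have hsz : (s0:ℂ) + R * (l / R * z) = s := by
    have : (R:ℂ) ≠ 0 := by exact_mod_cast hR0.ne'
    rw [hs, hs0]; push_cast; field_simp
  have hlog : ∀ u : ℂ, ‖u‖ < 1 → (1 - u)⁻¹ = Complex.exp (-Complex.log (1 - u)) := by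
    intro u hu
    rw [Complex.exp_neg, Complex.exp_log (Complex.slitPlane_ne_zero (one_sub_slit hu))]
  have hu1 : ∀ p : ℕ, p.Prime → ∀ c : ℂ, ‖c‖ = 1 → ‖c * (p:ℂ)^(-s)‖ < 1 := by
    intro p hp c hc
    rw [norm_mul, hc, one_mul]; exact prime_cpow_lt_one hp (by linarith)
  have hprod : ∏ p ∈ P ∪ F, (1 - w' p * (p:ℂ) ^ (-s))⁻¹ =
      Complex.exp (-∑ p ∈ P, Complex.log (1 - (p:ℂ)^(-s)) - ∑ p ∈ F, Complex.log (1 - w p * (p:ℂ)^(-s))) := by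
    rw [Finset.prod_union hdisj, sub_eq_add_neg, Complex.exp_add, ← Finset.sum_neg_distrib, ← Finset.sum_neg_distrib,
      Complex.exp_sum, Complex.exp_sum]
    congr 1
    · refine Finset.prod_congr rfl fun p hp => ?_
      have h1 := Finset.mem_filter.1 hp
      have h2 : p ≤ y := by have := Finset.mem_range.1 h1.1; omega
      simp only [hw', h2, if_true, one_mul]
      exact hlog _ (by simpa using hu1 p h1.2 1 (by simp))
    · refine Finset.prod_congr rfl fun p hp => ?_
      have h1 := hF p hp
      simp only [hw', not_le.2 h1.2, if_false]
      exact hlog _ (hu1 p h1.1 _ (hw p))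
  rw [hprod]
  set D := (-∑ p ∈ P, Complex.log (1 - (p:ℂ)^(-s)) - ∑ p ∈ F, Complex.log (1 - w p * (p:ℂ)^(-s))) - h z with hD
  have hDn : ‖D‖ ≤ 2 * δ1 := by
    have hz' : ‖(l / R * z : ℂ)‖ ≤ l / R := by
      rw [norm_mul, norm_div, Complex.norm_real, Complex.norm_real, Real.norm_of_nonneg hR0.le, Real.norm_of_nonneg hl.le]
      exact mul_le_of_le_one_right (by positivity) hz
    have h1 := happ _ hz'
    simp only [hΦ, hsz] at h1
    have h2 : (R / l * (l / R * z) : ℂ) = z := by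
      have h3 : (R:ℂ) ≠ 0 := by exact_mod_cast hR0.ne'
      have h4 : (l:ℂ) ≠ 0 := by exact_mod_cast hl.ne'
      field_simp
    rw [h2] at h1
    have h5 : -D = (h z + ∑ p ∈ P, Complex.log (1 - (p:ℂ) ^ (-s)) - ∑ p ∈ F, w p * (p:ℂ)^(-s)) +
        ∑ p ∈ F, (Complex.log (1 + -(w p * (p:ℂ)^(-s))) - (-(w p * (p:ℂ)^(-s)))) := by
      rw [hD, Finset.sum_sub_distrib]
      simp only [Finset.sum_neg_distrib, ← sub_eq_add_neg]; ring
    rw [← norm_neg, h5]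
    refine (norm_add_le _ _).trans ?_
    have h6 : ‖∑ p ∈ F, (Complex.log (1 + -(w p * (p:ℂ)^(-s))) - (-(w p * (p:ℂ)^(-s))))‖ ≤
        ∑ p ∈ F, (p:ℝ) ^ (-(2*(s0-l))) := by
      refine norm_sum_le_of_le _ fun p hp => ?_
      have hpp := (hF p hp).1
      have hpy := (hF p hp).2
      have hp0 : (0:ℝ) < p := by exact_mod_cast hpp.pos
      have hp1 : (1:ℝ) ≤ p := by exact_mod_cast hpp.one_lt.le
      have hn : ‖-(w p * (p:ℂ)^(-s))‖ = (p:ℝ)^(-s.re) := by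
        rw [norm_neg, norm_mul, hw p, one_mul, norm_prime_cpow hpp.one_lt.le]
      have hn2 : (p:ℝ)^(-s.re) ≤ (p:ℝ)^(-(s0-l)) := by
        apply Real.rpow_le_rpow_of_exponent_le hp1; linarith
      have hn3 : (p:ℝ)^(-s.re) ≤ 1/2 := by
        calc (p:ℝ)^(-s.re) ≤ (p:ℝ)^(-(1/2):ℝ) := by
              apply Real.rpow_le_rpow_of_exponent_le hp1; linarith
          _ ≤ (4:ℝ)^(-(1/2):ℝ) := by
              apply Real.rpow_le_rpow_of_nonpos (by norm_num) _ (by norm_num)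
              exact_mod_cast (by omega : 4 ≤ p)
          _ = 1/2 := by
              rw [show (4:ℝ) = 2^(2:ℝ) by norm_num, ← Real.rpow_mul (by norm_num)]
              norm_num [Real.rpow_neg]
      have hlt : ‖-(w p * (p:ℂ)^(-s))‖ < 1 := by rw [hn]; linarith
      refine (Complex.norm_log_one_add_sub_self_le hlt).trans ?_
      rw [hn]
      have hinv : (1 - (p:ℝ)^(-s.re))⁻¹ ≤ 2 := by
        rw [inv_le_comm₀ (by linarith) (by norm_num)]; linarith
      have hpos : 0 ≤ (p:ℝ)^(-s.re) := by positivity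
      calc ((p:ℝ)^(-s.re))^2 * (1 - (p:ℝ)^(-s.re))⁻¹ / 2 ≤ ((p:ℝ)^(-s.re))^2 * 2 / 2 := by gcongr
        _ = ((p:ℝ)^(-s.re))^2 := by ring
        _ ≤ ((p:ℝ)^(-(s0-l)))^2 := by gcongr
        _ = _ := by
          rw [← Real.rpow_natCast, ← Real.rpow_mul (Nat.cast_nonneg p)]; congr 1; push_cast; ring
    have h7 := hy2 F (fun p hp => lt_of_le_of_lt hyy2 (hF p hp).2)
    linarith
  have hfac : Complex.exp (h z) - Complex.exp (-∑ p ∈ P, Complex.log (1 - (p:ℂ)^(-s)) - ∑ p ∈ F, Complex.log (1 - w p * (p:ℂ)^(-s)))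
      = -(Complex.exp (h z) * (Complex.exp D - 1)) := by
    rw [mul_sub, ← Complex.exp_add, mul_one, hD, add_sub_cancel]; ring
  rw [hfac, norm_neg, norm_mul]
  have h8 := Complex.norm_exp_sub_one_le (x := D) (by linarith)
  calc _ ≤ H * (2 * ‖D‖) := by gcongr; exact hH z hz
    _ ≤ H * (2 * (2 * (δ / (8 * (H+1))))) := by gcongr; linarith
    _ = δ / 2 * (H / (H+1)) := by field_simp; ring
    _ ≤ δ / 2 * 1 := by
      gcongr
      rw [div_le_one (by linarith)]; linarith
    _ < δ := by linarith

end Vor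

namespace Vor

/-- `n^{1-s}/(1-s)` -/
noncomputable def za (s : ℂ) (n : ℕ) : ℂ := (n:ℂ) ^ (1 - s) / (1 - s)

noncomputable def zt (s : ℂ) (n : ℕ) : ℂ := (n:ℂ) ^ (-s) - (za s (n+1) - za s n)

noncomputable def zc (s : ℂ) (n : ℕ) : ℂ := ∫ u in (0:ℝ)..1, ((1 + u / n : ℝ) : ℂ) ^ (-s)

lemma cpow_lip {s : ℂ} (hs : 0 ≤ s.re) {v v' : ℝ} (hv : 0 ≤ v) (hv' : 0 ≤ v') :
    ‖((1 + v : ℝ) : ℂ) ^ (-s) - ((1 + v' : ℝ) : ℂ) ^ (-s)‖ ≤ ‖s‖ * |v - v'| := by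
  have hd : ∀ x ∈ Ici (0:ℝ), HasDerivWithinAt (fun x : ℝ => ((1 + x : ℝ) : ℂ) ^ (-s))
      (-s * ((1 + x : ℝ) : ℂ) ^ (-s - 1)) (Ici 0) x := by
    intro x hx
    have hx' : (0:ℝ) ≤ x := hx
    have h1 : HasDerivAt (fun z : ℂ => (1 + z) ^ (-s)) (-s * (1 + (x:ℂ)) ^ (-s - 1) * 1) (x:ℂ) := by
      refine HasDerivAt.cpow_const ((hasDerivAt_id _).const_add 1) ?_
      left; simp; linarith
    have h2 := h1.comp_ofReal
    have h3 : (fun x : ℝ => ((1 + x : ℝ) : ℂ) ^ (-s)) = fun y : ℝ => (1 + (y:ℂ)) ^ (-s) := by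
      ext y; push_cast; rfl
    rw [h3]
    have := h2.hasDerivWithinAt (s := Ici 0)
    simpa using this
  have := Convex.norm_image_sub_le_of_norm_hasDerivWithin_le (C := ‖s‖) hd (by
    intro x hx
    have hx' : (0:ℝ) ≤ x := hx
    rw [norm_mul, norm_neg, Complex.norm_cpow_eq_rpow_re_of_pos (by linarith)]
    refine mul_le_of_le_one_right (norm_nonneg _) ?_
    apply Real.rpow_le_one_of_one_le_of_nonpos (by linarith)
    simp; linarith) (convex_Ici 0) hv' hv
  simpa using this

lemma zc_intble (s : ℂ) (n : ℕ) :
    IntervalIntegrable (fun u : ℝ => ((1 + u / n : ℝ) : ℂ) ^ (-s)) MeasureTheory.volume 0 1 := by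
  apply ContinuousOn.intervalIntegrable
  intro u hu
  rw [uIcc_of_le zero_le_one] at hu
  have h0 : 0 ≤ u / n := div_nonneg hu.1 (Nat.cast_nonneg n)
  apply ContinuousAt.continuousWithinAt
  refine ContinuousAt.cpow (by fun_prop) continuousAt_const ?_
  left; simp only [ofReal_re]; linarith

lemma zc_sub_one {s : ℂ} (hs : 0 ≤ s.re) {n : ℕ} (hn : 1 ≤ n) : ‖zc s n - 1‖ ≤ ‖s‖ / n := by
  have h1 : zc s n - 1 = ∫ u in (0:ℝ)..1, (((1 + u / n : ℝ) : ℂ) ^ (-s) - 1) := by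
    rw [intervalIntegral.integral_sub (zc_intble s n) (by simp)]; simp [zc]
  rw [h1]
  have := intervalIntegral.norm_integral_le_of_norm_le_const (a := 0) (b := 1) (C := ‖s‖ / n)
    (f := fun u : ℝ => ((1 + u / n : ℝ) : ℂ) ^ (-s) - 1) (by
    intro u hu
    rw [uIoc_of_le zero_le_one] at hu
    have hn' : (0:ℝ) < n := by exact_mod_cast hn
    have h2 := cpow_lip hs (v := u/n) (v' := 0) (div_nonneg hu.1.le hn'.le) le_rfl
    simp only [add_zero, ofReal_one, one_cpow, sub_zero, abs_of_nonneg (div_nonneg hu.1.le hn'.le)] at h2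
    refine h2.trans ?_
    rw [mul_div_assoc']
    gcongr
    exact mul_le_of_le_one_right (norm_nonneg _) hu.2)
  simpa using this

lemma zc_sub {s : ℂ} (hs : 0 ≤ s.re) {n : ℕ} (hn : 1 ≤ n) : ‖zc s n - zc s (n+1)‖ ≤ ‖s‖ / n^2 := by
  rw [zc, zc, ← intervalIntegral.integral_sub (zc_intble s n) (zc_intble s (n+1))]
  have hn' : (0:ℝ) < n := by exact_mod_cast hn
  have := intervalIntegral.norm_integral_le_of_norm_le_const (a := 0) (b := 1) (C := ‖s‖ / n^2)
    (f := fun u : ℝ => ((1 + u / n : ℝ) : ℂ) ^ (-s) - ((1 + u / (n+1 : ℕ) : ℝ) : ℂ) ^ (-s)) (by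
    intro u hu
    rw [uIoc_of_le zero_le_one] at hu
    have h2 := cpow_lip hs (v := u/n) (v' := u/(n+1:ℕ)) (div_nonneg hu.1.le hn'.le) (div_nonneg hu.1.le (Nat.cast_nonneg _))
    refine h2.trans ?_
    have h3 : |u / n - u / (n+1:ℕ)| ≤ 1 / (n:ℝ)^2 := by
      have : u / n - u / (n+1:ℕ) = u / (n * (n+1)) := by push_cast; field_simp; ring
      rw [this, abs_of_nonneg (div_nonneg hu.1.le (by positivity))]
      apply div_le_div₀ zero_le_one hu.2 (by positivity)
      nlinarith
    calc ‖s‖ * |u / n - u / (n+1:ℕ)| ≤ ‖s‖ * (1 / (n:ℝ)^2) := by gcongr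
      _ = _ := by ring)
  simpa using this

lemma za_diff {s : ℂ} (hs : s ≠ 1) {n : ℕ} (hn : 1 ≤ n) : za s (n+1) - za s n = (n:ℂ)^(-s) * zc s n := by
  have hn' : (0:ℝ) < n := by exact_mod_cast hn
  have hs' : 1 - s ≠ 0 := sub_ne_zero.2 hs.symm
  have key : ∫ u in (0:ℝ)..1, (n:ℂ)^(-s) * ((1 + u / n : ℝ) : ℂ) ^ (-s) =
      (fun u : ℝ => ((n + u : ℂ)) ^ (1-s) / (1-s)) 1 - (fun u : ℝ => ((n + u : ℂ)) ^ (1-s) / (1-s)) 0 := by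
    refine intervalIntegral.integral_eq_sub_of_hasDerivAt (f := fun u : ℝ => ((n + u : ℂ)) ^ (1-s) / (1-s)) (f' := fun u : ℝ => (n:ℂ)^(-s) * ((1 + u / n : ℝ) : ℂ) ^ (-s)) (a := 0) (b := 1) ?_ ?_
    · intro u hu
      rw [uIcc_of_le zero_le_one] at hu
      have h1 : HasDerivAt (fun z : ℂ => (n + z) ^ (1-s) / (1-s)) ((1-s) * (n + (u:ℂ)) ^ (1 - s - 1) * 1 / (1-s)) (u:ℂ) := by
        apply HasDerivAt.div_const
        refine HasDerivAt.cpow_const ((hasDerivAt_id _).const_add _) ?_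
        left; simp; linarith [hu.1]
      have h2 := h1.comp_ofReal
      refine h2.congr_deriv ?_
      have h3 : (n:ℂ) + u = ((n:ℝ):ℂ) * ((1 + u / n : ℝ) : ℂ) := by
        push_cast
        have : (n:ℂ) ≠ 0 := by exact_mod_cast hn'.ne'
        field_simp
      have h0 : 0 ≤ u / n := div_nonneg hu.1 hn'.le
      rw [h3, Complex.mul_cpow_ofReal_nonneg hn'.le (by linarith)]
      have h4 : (1 - s - 1) = -s := by ring
      rw [h4]; field_simp; simp [mul_comm]
    · exact (zc_intble s n).const_mul _
  rw [intervalIntegral.integral_const_mul] at key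
  rw [zc, key, za, za]; simp

lemma zt_eq {s : ℂ} (hs : s ≠ 1) {n : ℕ} (hn : 1 ≤ n) : zt s n = (n:ℂ)^(-s) * (1 - zc s n) := by
  rw [zt, za_diff hs hn]; ring

lemma zt_norm {s : ℂ} (hs : s ≠ 1) (hsr : 0 ≤ s.re) {n : ℕ} (hn : 1 ≤ n) : ‖zt s n‖ ≤ ‖s‖ * (n:ℝ)^(-(s.re + 1)) := by
  have hn' : (0:ℝ) < n := by exact_mod_cast hn
  rw [zt_eq hs hn, norm_mul, norm_prime_cpow hn, norm_sub_rev]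
  calc _ ≤ (n:ℝ)^(-s.re) * (‖s‖ / n) := by gcongr; exact zc_sub_one hsr hn
    _ = _ := by rw [neg_add, Real.rpow_add hn', Real.rpow_neg_one]; ring

lemma zt_zero {s : ℂ} (hs : s ≠ 1) (hsr : 0 < s.re) : zt s 0 = -1/(1-s) := by
  have hs' : 1 - s ≠ 0 := sub_ne_zero.2 hs.symm
  have hs0 : s ≠ 0 := by rintro rfl; simp at hsr
  rw [zt, za, za]; simp [Complex.zero_cpow hs', Complex.zero_cpow (neg_ne_zero.2 hs0)]; ring

lemma zt_sum {s : ℂ} (hs : s ≠ 1) (K : ℕ) :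
    ∑ n ∈ Finset.range K, zt s n = ∑ n ∈ Finset.range K, (n:ℂ)^(-s) - za s K := by
  have hs' : 1 - s ≠ 0 := sub_ne_zero.2 hs.symm
  have h0 : za s 0 = 0 := by simp [za, Complex.zero_cpow hs']
  simp only [zt]
  rw [Finset.sum_sub_distrib, Finset.sum_range_sub, h0, sub_zero]

lemma zt_summable {s : ℂ} (hs : s ≠ 1) (hsr : 0 < s.re) : Summable (zt s) := by
  rw [← summable_nat_add_iff 1]
  refine Summable.of_norm_bounded (g := fun n : ℕ => ‖s‖ * ((n+1:ℕ):ℝ)^(-(s.re + 1))) ?_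
    (fun n => zt_norm hs hsr.le (by omega))
  refine Summable.mul_left _ ?_
  exact (summable_nat_add_iff 1).2 (Real.summable_nat_rpow.2 (by linarith))

lemma zeta_eq_of_one_lt {s : ℂ} (hs : 1 < s.re) : riemannZeta s = ∑' n, zt s n := by
  have hs1 : s ≠ 1 := by rintro rfl; simp at hs
  have h1 := (zt_summable hs1 (by linarith)).hasSum.tendsto_sum_nat
  have h2 : Tendsto (fun K => ∑ n ∈ Finset.range K, zt s n) atTop (𝓝 (riemannZeta s - 0)) := by
    simp_rw [zt_sum hs1]
    refine Tendsto.sub ?_ ?_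
    · rw [zeta_eq_tsum_one_div_nat_cpow hs]
      have h3 : (fun n : ℕ => (n:ℂ)^(-s)) = fun n : ℕ => 1 / (n:ℂ)^s := by
        ext n; rw [Complex.cpow_neg, one_div]
      have := (Complex.summable_one_div_nat_cpow.2 hs).hasSum.tendsto_sum_nat
      rw [← h3] at this
      rw [← h3]
      exact this
    · rw [tendsto_zero_iff_norm_tendsto_zero]
      have h4 : Tendsto (fun K : ℕ => (K:ℝ) ^ (-(s.re - 1)) / ‖1 - s‖) atTop (𝓝 (0 / ‖1 - s‖)) :=
        ((tendsto_rpow_neg_atTop (by linarith : 0 < s.re - 1)).comp tendsto_natCast_atTop_atTop).div_const _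
      rw [zero_div] at h4
      refine h4.congr' ?_
      filter_upwards [eventually_ge_atTop 1] with K hK
      rw [za, norm_div, Complex.norm_natCast_cpow_of_pos (by omega)]; simp
  rw [sub_zero] at h2
  exact tendsto_nhds_unique h2 h1

lemma zeta_eq {s : ℂ} (hsr : 0 < s.re) (hsi : 0 < s.im) : riemannZeta s = ∑' n, zt s n := by
  set d := s.re / 2 with hd
  set K := ‖s‖ + 10 with hK
  set U : Set ℂ := {w | d < w.re} ∩ {w | 0 < w.im} ∩ ball 0 K with hU
  have hUo : IsOpen U := ((isOpen_lt continuous_const Complex.continuous_re).inter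
    (isOpen_lt continuous_const Complex.continuous_im)).inter isOpen_ball
  have hUc : Convex ℝ U := ((convex_halfSpace_re_gt d).inter (convex_halfSpace_im_gt 0)).inter (convex_ball 0 K)
  have hne : ∀ w ∈ U, w ≠ 1 := by
    rintro w ⟨⟨_, h⟩, _⟩ rfl
    simp at h
  have hd0 : 0 < d := by rw [hd]; linarith
  have hF : DifferentiableOn ℂ (fun w => ∑' n, zt w n) U := by
    have hs0 : DifferentiableOn ℂ (fun w => zt w 0 + ∑' n, zt w (n+1)) U := by
      have hzt : ∀ n : ℕ, DifferentiableOn ℂ (fun w => zt w (n+1)) U := by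
        intro n w hw
        have hw1 : 1 - w ≠ 0 := sub_ne_zero.2 (hne w hw).symm
        have h1 : ((n+1:ℕ):ℂ) ≠ 0 := by exact_mod_cast Nat.succ_ne_zero n
        have h2 : ((n+1+1:ℕ):ℂ) ≠ 0 := by exact_mod_cast Nat.succ_ne_zero (n+1)
        apply DifferentiableAt.differentiableWithinAt
        simp only [zt, za]
        refine DifferentiableAt.sub (DifferentiableAt.const_cpow (by fun_prop) (Or.inl h1)) ?_
        refine DifferentiableAt.sub ?_ ?_
        · exact DifferentiableAt.div (DifferentiableAt.const_cpow (by fun_prop) (Or.inl h2)) (by fun_prop) hw1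
        · exact DifferentiableAt.div (DifferentiableAt.const_cpow (by fun_prop) (Or.inl h1)) (by fun_prop) hw1
      refine DifferentiableOn.add ?_ ?_
      · have : DifferentiableOn ℂ (fun w : ℂ => -1/(1-w)) U := by
          intro w hw
          have hw1 : 1 - w ≠ 0 := sub_ne_zero.2 (hne w hw).symm
          exact (DifferentiableAt.div (by fun_prop) (by fun_prop) hw1).differentiableWithinAt
        refine this.congr fun w hw => zt_zero (hne w hw) (hd0.trans hw.1.1)
      · refine Complex.differentiableOn_tsum_of_summable_norm
          (u := fun n : ℕ => K * ((n+1:ℕ):ℝ)^(-(d + 1))) ?_ hzt hUo ?_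
        · refine Summable.mul_left _ ?_
          exact (summable_nat_add_iff 1).2 (Real.summable_nat_rpow.2 (by linarith))
        · intro n w hw
          have hwd : d < w.re := hw.1.1
          have hwK : ‖w‖ < K := by simpa using hw.2
          refine (zt_norm (hne w hw) (by linarith) (by omega)).trans ?_
          gcongr
          exact_mod_cast (by omega : 1 ≤ n + 1)
    refine hs0.congr fun w hw => ?_
    have := (zt_summable (hne w hw) (hd0.trans hw.1.1)).sum_add_tsum_nat_add 1
    simpa using this.symm
  have hZ : DifferentiableOn ℂ riemannZeta U := fun w hw =>
    (differentiableAt_riemannZeta (hne w hw)).differentiableWithinAt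
  set z0 : ℂ := s.re + 2 + s.im * I with hz0
  have hz0U : z0 ∈ U := by
    refine ⟨⟨?_, ?_⟩, ?_⟩
    · simp [hz0]; linarith
    · simpa [hz0] using hsi
    · rw [mem_ball_zero_iff]
      have : z0 = s + 2 := by rw [hz0, add_right_comm, Complex.re_add_im]
      rw [this]
      refine (norm_add_le _ _).trans_lt ?_
      rw [hK]; norm_num
  have hsU : s ∈ U := by
    refine ⟨⟨by simp [hd]; linarith, hsi⟩, ?_⟩
    rw [mem_ball_zero_iff]; linarith
  refine AnalyticOnNhd.eqOn_of_preconnected_of_eventuallyEq (hZ.analyticOnNhd hUo) (hF.analyticOnNhd hUo)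
    hUc.isPreconnected hz0U ?_ hsU
  have : {w : ℂ | 1 < w.re} ∈ 𝓝 z0 := (isOpen_lt continuous_const Complex.continuous_re).mem_nhds (by simp [hz0]; linarith)
  filter_upwards [this] with w hw
  exact zeta_eq_of_one_lt hw

end Vor

namespace Vor

noncomputable def zee (s : ℂ) (n : ℕ) : ℂ := (zc s n)⁻¹ - 1

lemma zc_half {s : ℂ} (hs : 0 ≤ s.re) {n : ℕ} (hn : 1 ≤ n) (hns : 2 * ‖s‖ ≤ n) : 1 / 2 ≤ ‖zc s n‖ := by
  have hn' : (0:ℝ) < n := by exact_mod_cast hn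
  have h1 := zc_sub_one hs hn
  have h2 : ‖s‖ / n ≤ 1/2 := by rw [div_le_iff₀ hn']; linarith
  have h3 : ‖(1:ℂ)‖ ≤ ‖zc s n‖ + ‖zc s n - 1‖ := by
    have := norm_sub_le (zc s n) (zc s n - 1)
    simpa using this
  rw [norm_one] at h3
  linarith

lemma zee_norm {s : ℂ} (hs : 0 ≤ s.re) {n : ℕ} (hn : 1 ≤ n) (hns : 2 * ‖s‖ ≤ n) : ‖zee s n‖ ≤ 2 * ‖s‖ / n := by
  have h1 := zc_half hs hn hns
  have h0 : zc s n ≠ 0 := by rw [← norm_pos_iff]; linarith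
  have h2 : zee s n = (1 - zc s n) / zc s n := by rw [zee]; field_simp
  rw [h2, norm_div, norm_sub_rev]
  calc _ ≤ (‖s‖ / n) / (1/2) := by
        apply div_le_div₀ (by positivity) (zc_sub_one hs hn) (by norm_num) h1
    _ = _ := by ring

lemma zee_sub {s : ℂ} (hs : 0 ≤ s.re) {n : ℕ} (hn : 1 ≤ n) (hns : 2 * ‖s‖ ≤ n) :
    ‖zee s n - zee s (n+1)‖ ≤ 4 * ‖s‖ / n^2 := by
  have h1 := zc_half hs hn hns
  have h1' := zc_half hs (n := n+1) (by omega) (by push_cast; linarith)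
  have h0 : zc s n ≠ 0 := by rw [← norm_pos_iff]; linarith
  have h0' : zc s (n+1) ≠ 0 := by rw [← norm_pos_iff]; linarith
  have h2 : zee s n - zee s (n+1) = -(zc s n - zc s (n+1)) / (zc s n * zc s (n+1)) := by
    rw [zee, zee]; field_simp; ring
  rw [h2, norm_div, norm_neg, norm_mul]
  calc _ ≤ (‖s‖ / n^2) / (1/2*(1/2)) := by
        apply div_le_div₀ (by positivity) (zc_sub hs hn) (by norm_num)
        exact mul_le_mul h1 h1' (by norm_num) (norm_nonneg _)
    _ = _ := by ring

lemma zt_zee {s : ℂ} (hs1 : s ≠ 1) (hs : 0 ≤ s.re) {n : ℕ} (hn : 1 ≤ n) (hns : 2 * ‖s‖ ≤ n) :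
    zt s n = (za s (n+1) - za s n) * zee s n := by
  have h1 := zc_half hs hn hns
  have h0 : zc s n ≠ 0 := by rw [← norm_pos_iff]; linarith
  rw [zt_eq hs1 hn, za_diff hs1 hn, zee]; field_simp

lemma abel_id {s : ℂ} (hs1 : s ≠ 1) (hs : 0 ≤ s.re) {N : ℕ} (hn : 1 ≤ N) (hns : 2 * ‖s‖ ≤ N) (K : ℕ) (hK : N ≤ K) :
    ∑ n ∈ Finset.Ico N K, zt s n = za s K * zee s K - za s N * zee s N +
      ∑ n ∈ Finset.Ico N K, za s (n+1) * (zee s n - zee s (n+1)) := by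
  induction K, hK using Nat.le_induction with
  | base => simp
  | succ K hK ih =>
    have hKs : 2 * ‖s‖ ≤ K := hns.trans (by exact_mod_cast hK)
    rw [Finset.sum_Ico_succ_top hK, Finset.sum_Ico_succ_top hK, ih, zt_zee hs1 hs (hn.trans hK) hKs]
    ring

lemma za_norm {s : ℂ} (hi : 0 < s.im) {n : ℕ} (hn : 1 ≤ n) : ‖za s n‖ ≤ (n:ℝ)^(1 - s.re) / s.im := by
  rw [za, norm_div, Complex.norm_natCast_cpow_of_pos (by omega)]
  simp only [sub_re, one_re]
  apply div_le_div_of_nonneg_left (by positivity) hi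
  have := Complex.abs_im_le_norm (1 - s)
  simp at this
  exact (le_abs_self _).trans this

lemma zt_tail {s : ℂ} {σ : ℝ} (hσ : 0 < σ) (hs : σ ≤ s.re) (hs' : s.re ≤ 1) (hi : 0 < s.im)
    {N : ℕ} (hn : 1 ≤ N) (hns : 2 * ‖s‖ ≤ N) (K : ℕ) (hK : N ≤ K) :
    ‖∑ n ∈ Finset.Ico N K, zt s n‖ ≤ ‖s‖ / s.im * (4 * (N:ℝ)^(-σ) + 8 * ∑ n ∈ Finset.Ico N K, (n:ℝ)^(-(1+σ))) := by
  have hs1 : s ≠ 1 := by rintro rfl; simp at hi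
  have hs0 : 0 ≤ s.re := by linarith
  rw [abel_id hs1 hs0 hn hns K hK]
  have hb : ∀ n : ℕ, N ≤ n → ‖za s n * zee s n‖ ≤ ‖s‖ / s.im * (2 * (N:ℝ)^(-σ)) := by
    intro n hNn
    have hn1 : 1 ≤ n := hn.trans hNn
    have hn' : (0:ℝ) < n := by exact_mod_cast hn1
    have hnN : (N:ℝ) ≤ n := by exact_mod_cast hNn
    have hN1 : (1:ℝ) ≤ N := by exact_mod_cast hn
    rw [norm_mul]
    calc _ ≤ ((n:ℝ)^(1 - s.re) / s.im) * (2 * ‖s‖ / n) :=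
          mul_le_mul (za_norm hi hn1) (zee_norm hs0 hn1 (hns.trans hnN)) (norm_nonneg _) (by positivity)
      _ = ‖s‖ / s.im * (2 * (n:ℝ)^(-s.re)) := by
          rw [sub_eq_add_neg, Real.rpow_add hn', Real.rpow_one]; field_simp
      _ ≤ _ := by
          refine mul_le_mul_of_nonneg_left (mul_le_mul_of_nonneg_left ?_ (by norm_num)) (by positivity)
          calc (n:ℝ)^(-s.re) ≤ (n:ℝ)^(-σ) := Real.rpow_le_rpow_of_exponent_le (hN1.trans hnN) (by linarith)
            _ ≤ _ := Real.rpow_le_rpow_of_nonpos (by linarith) hnN (by linarith)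
  have hc : ∀ n ∈ Finset.Ico N K, ‖za s (n+1) * (zee s n - zee s (n+1))‖ ≤ ‖s‖ / s.im * (8 * (n:ℝ)^(-(1+σ))) := by
    intro n hnm
    have hNn : N ≤ n := (Finset.mem_Ico.1 hnm).1
    have hn1 : 1 ≤ n := hn.trans hNn
    have hn' : (0:ℝ) < n := by exact_mod_cast hn1
    have hn1' : (1:ℝ) ≤ n := by exact_mod_cast hn1
    have hnN : (N:ℝ) ≤ n := by exact_mod_cast hNn
    rw [norm_mul]
    have h2 : (((n+1:ℕ)):ℝ)^(1-s.re) ≤ 2 * (n:ℝ)^(1-s.re) := by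
      calc (((n+1:ℕ)):ℝ)^(1-s.re) ≤ (2*n:ℝ)^(1-s.re) := by
            apply Real.rpow_le_rpow (by positivity) (by push_cast; linarith) (by linarith)
        _ = 2^(1-s.re) * (n:ℝ)^(1-s.re) := Real.mul_rpow (by norm_num) hn'.le
        _ ≤ _ := by
          apply mul_le_mul_of_nonneg_right _ (by positivity)
          calc (2:ℝ)^(1-s.re) ≤ 2^(1:ℝ) := Real.rpow_le_rpow_of_exponent_le (by norm_num) (by linarith)
            _ = 2 := Real.rpow_one 2
    calc _ ≤ ((2 * (n:ℝ)^(1 - s.re)) / s.im) * (4 * ‖s‖ / n^2) :=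
          mul_le_mul ((za_norm hi (by omega)).trans (by gcongr)) (zee_sub hs0 hn1 (hns.trans hnN)) (norm_nonneg _) (by positivity)
      _ = ‖s‖ / s.im * (8 * (n:ℝ)^(-(1+s.re))) := by
          rw [show -(1+s.re) = (1 - s.re) + (-2:ℝ) by ring, Real.rpow_add hn', Real.rpow_neg hn'.le 2, Real.rpow_two]
          field_simp; ring
      _ ≤ _ := by
          refine mul_le_mul_of_nonneg_left (mul_le_mul_of_nonneg_left ?_ (by norm_num)) (by positivity)
          exact Real.rpow_le_rpow_of_exponent_le hn1' (by linarith)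
  have h1 := norm_sum_le_of_le _ hc
  rw [← Finset.mul_sum, ← Finset.mul_sum] at h1
  refine (norm_add_le _ _).trans ?_
  have h3 := norm_sub_le (za s K * zee s K) (za s N * zee s N)
  have h4 := hb K hK
  have h5 := hb N le_rfl
  have : ‖s‖ / s.im * (4 * (N:ℝ)^(-σ) + 8 * ∑ n ∈ Finset.Ico N K, (n:ℝ)^(-(1+σ))) =
    ‖s‖ / s.im * (2 * (N:ℝ)^(-σ)) + ‖s‖ / s.im * (2 * (N:ℝ)^(-σ)) + ‖s‖ / s.im * (8 * ∑ n ∈ Finset.Ico N K, (n:ℝ)^(-(1+σ))) := by ring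
  rw [this]
  linarith

lemma rpow_neg_small {σ : ℝ} (hσ : 0 < σ) {δ : ℝ} (hδ : 0 < δ) : ∃ N0 : ℕ, ∀ N : ℕ, N0 ≤ N → (N:ℝ)^(-σ) < δ := by
  have := ((tendsto_rpow_neg_atTop hσ).comp tendsto_natCast_atTop_atTop).eventually (gt_mem_nhds hδ)
  exact eventually_atTop.1 this

/-- approximation of zeta by finitely many terms -/
lemma zeta_approx {σ : ℝ} (hσ : 0 < σ) (hσ1 : σ < 1) {δ : ℝ} (hδ : 0 < δ) : ∃ T0 : ℕ, ∀ T : ℕ, T0 ≤ T →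
    ∀ s : ℂ, σ ≤ s.re → s.re ≤ 1 → (T:ℝ) - 1 ≤ s.im → s.im ≤ 2 * T + 1 →
      ‖riemannZeta s - ∑ n ∈ Finset.range (8*T), (n:ℂ)^(-s)‖ ≤ δ := by
  obtain ⟨y, hy⟩ := tail_small (a := 1 + σ) (by linarith) (show 0 < δ / 48 by positivity)
  obtain ⟨N0, hN0⟩ := rpow_neg_small hσ (show 0 < δ / 48 by positivity)
  refine ⟨y + N0 + 2, fun T hT s h1 h2 h3 h4 => ?_⟩
  have hT2 : (2:ℝ) ≤ T := by exact_mod_cast (by omega : 2 ≤ T)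
  have him : 1 ≤ s.im := by linarith
  have hi : 0 < s.im := by linarith
  have hs1 : s ≠ 1 := by rintro rfl; simp at hi
  have hsn : ‖s‖ ≤ 1 + s.im := by
    refine (Complex.norm_le_abs_re_add_abs_im s).trans ?_
    rw [abs_of_nonneg (by linarith), abs_of_nonneg hi.le]; linarith
  have hr : ‖s‖ / s.im ≤ 2 := by rw [div_le_iff₀ hi]; linarith
  set N := 8 * T with hN
  have hNr : (N:ℝ) = 8 * T := by rw [hN]; push_cast; ring
  have hN1 : 1 ≤ N := by omega
  have htl : ∀ K, N ≤ K → ‖∑ n ∈ Finset.Ico N K, zt s n‖ ≤ δ / 2 := by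
    intro K hK
    refine (zt_tail hσ h1 h2 hi hN1 (by rw [hNr]; linarith) K hK).trans ?_
    have a1 := hN0 N (by omega)
    have a2 := hy (Finset.Ico N K) (by intro p hp; have := (Finset.mem_Ico.1 hp).1; omega)
    calc _ ≤ 2 * (4 * (δ/48) + 8 * (δ/48)) := by
          refine mul_le_mul hr ?_ (by positivity) (by norm_num)
          linarith
      _ = _ := by ring
  have hlim : Tendsto (fun K => ∑ n ∈ Finset.range K, zt s n - ∑ n ∈ Finset.range N, zt s n) atTop
      (𝓝 (riemannZeta s - ∑ n ∈ Finset.range N, zt s n)) := by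
    rw [zeta_eq (by linarith) hi]
    exact (zt_summable hs1 (by linarith)).hasSum.tendsto_sum_nat.sub_const _
  have hle : ‖riemannZeta s - ∑ n ∈ Finset.range N, zt s n‖ ≤ δ / 2 := by
    refine le_of_tendsto hlim.norm ?_
    filter_upwards [eventually_ge_atTop N] with K hK
    have := htl K hK
    rwa [Finset.sum_Ico_eq_sub _ hK] at this
  rw [zt_sum hs1] at hle
  have hza : ‖za s N‖ ≤ δ / 2 := by
    refine (za_norm hi hN1).trans ?_
    have hNp : (0:ℝ) < N := by rw [hNr]; linarith
    have hN1' : (1:ℝ) ≤ N := by rw [hNr]; linarith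
    have a1 := hN0 N (by omega)
    have a3 : (N:ℝ)^(1 - s.re) ≤ N * (N:ℝ)^(-σ) := by
      rw [sub_eq_add_neg, Real.rpow_add hNp, Real.rpow_one]
      exact mul_le_mul_of_nonneg_left (Real.rpow_le_rpow_of_exponent_le hN1' (by linarith)) hNp.le
    rw [div_le_iff₀ hi]
    refine a3.trans ?_
    calc (N:ℝ) * (N:ℝ)^(-σ) ≤ N * (δ/48) := mul_le_mul_of_nonneg_left a1.le hNp.le
      _ ≤ δ / 2 * s.im := by rw [hNr]; nlinarith
  have : riemannZeta s - ∑ n ∈ Finset.range N, (n:ℂ)^(-s) =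
    (riemannZeta s - (∑ n ∈ Finset.range N, (n:ℂ)^(-s) - za s N)) - za s N := by ring
  rw [this]
  refine (norm_sub_le _ _).trans (by linarith)

end Vor

namespace Vor

lemma cpow_it {n : ℕ} (hn : 1 ≤ n) (τ : ℝ) : (n:ℂ)^(-(τ * I)) = exp (((-(τ * Real.log n) : ℝ):ℂ) * I) := by
  rw [Complex.cpow_def_of_ne_zero (by exact_mod_cast (by omega : n ≠ 0)), ← Complex.ofReal_natCast,
    ← Complex.ofReal_log (by positivity)]
  congr 1; push_cast; ring

lemma cpow_it_conj {n : ℕ} (hn : 1 ≤ n) (τ : ℝ) :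
    (starRingEnd ℂ) ((n:ℂ)^(-(τ * I))) = exp ((((τ * Real.log n) : ℝ):ℂ) * I) := by
  rw [cpow_it hn, ← Complex.exp_conj, map_mul, Complex.conj_ofReal, Complex.conj_I]; congr 1; push_cast; ring

lemma exp_integral {μ : ℝ} (hμ : μ ≠ 0) (a b : ℝ) : ‖∫ τ in a..b, exp (((τ * μ : ℝ):ℂ) * I)‖ ≤ 2 / |μ| := by
  have h : ∀ τ : ℝ, exp (((τ * μ : ℝ):ℂ) * I) = exp ((μ * I) * τ) := by
    intro τ; congr 1; push_cast; ring
  simp_rw [h]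
  have hne : (μ * I : ℂ) ≠ 0 := mul_ne_zero (by exact_mod_cast hμ) I_ne_zero
  rw [integral_exp_mul_complex hne, norm_div]
  have h2 : ‖(μ * I : ℂ)‖ = |μ| := by simp
  rw [h2]
  apply div_le_div_of_nonneg_right _ (abs_nonneg _)
  refine (norm_sub_le _ _).trans ?_
  have h3 : ∀ τ : ℝ, ‖exp ((μ * I) * τ)‖ = 1 := by
    intro τ; rw [← h]; exact Complex.norm_exp_ofReal_mul_I _
  rw [h3, h3]; norm_num

lemma parseval {ι : Type*} [DecidableEq ι] (J : Finset ι) (ν : ι → ℕ) (hν : ∀ i ∈ J, 1 ≤ ν i) (hinj : Set.InjOn ν J)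
    (c : ι → ℂ) (T : ℝ) :
    |(∫ τ in T..(2*T), ‖∑ i ∈ J, c i * (ν i:ℂ)^(-(τ * I))‖^2) - T * ∑ i ∈ J, ‖c i‖^2| ≤
      ∑ i ∈ J, ∑ j ∈ J, if i = j then 0 else ‖c i‖ * ‖c j‖ * (2 / |Real.log (ν j) - Real.log (ν i)|) := by
  have hpt : ∀ τ : ℝ, ((‖∑ i ∈ J, c i * (ν i:ℂ)^(-(τ * I))‖^2 : ℝ) : ℂ) =
      ∑ i ∈ J, ∑ j ∈ J, c i * (starRingEnd ℂ) (c j) * exp (((τ * (Real.log (ν j) - Real.log (ν i)) : ℝ):ℂ) * I) := by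
    intro τ
    rw [← Complex.normSq_eq_norm_sq, ← Complex.mul_conj, map_sum, Finset.sum_mul_sum]
    refine Finset.sum_congr rfl fun i hi => Finset.sum_congr rfl fun j hj => ?_
    rw [map_mul, cpow_it_conj (hν j hj), cpow_it (hν i hi)]
    have : exp (((τ * (Real.log (ν j) - Real.log (ν i)) : ℝ):ℂ) * I) =
      exp (((-(τ * Real.log (ν i)) : ℝ):ℂ) * I) * exp ((((τ * Real.log (ν j)) : ℝ):ℂ) * I) := by
      rw [← Complex.exp_add]; congr 1; push_cast; ring
    rw [this]; ring
  have hcont : ∀ μ : ℝ, Continuous fun τ : ℝ => exp (((τ * μ : ℝ):ℂ) * I) := by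
    intro μ; fun_prop
  have hintg : (((∫ τ in T..(2*T), ‖∑ i ∈ J, c i * (ν i:ℂ)^(-(τ * I))‖^2) : ℝ) : ℂ) =
      ∑ i ∈ J, ∑ j ∈ J, c i * (starRingEnd ℂ) (c j) * ∫ τ in T..(2*T), exp (((τ * (Real.log (ν j) - Real.log (ν i)) : ℝ):ℂ) * I) := by
    rw [← intervalIntegral.integral_ofReal]
    simp_rw [hpt]
    rw [intervalIntegral.integral_finsetSum]
    · refine Finset.sum_congr rfl fun i hi => ?_
      rw [intervalIntegral.integral_finsetSum]
      · refine Finset.sum_congr rfl fun j hj => ?_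
        rw [intervalIntegral.integral_const_mul]
      · intro j hj
        exact (continuous_const.mul (hcont _)).intervalIntegrable _ _
    · intro i hi
      refine Continuous.intervalIntegrable ?_ _ _
      exact continuous_finsetSum _ fun j hj => continuous_const.mul (hcont _)
  have hdiag : ((T * ∑ i ∈ J, ‖c i‖^2 : ℝ):ℂ) = ∑ i ∈ J, ∑ j ∈ J, if i = j then c i * (starRingEnd ℂ) (c i) * T else 0 := by
    push_cast
    rw [Finset.mul_sum]
    refine Finset.sum_congr rfl fun i hi => ?_
    rw [Finset.sum_ite_eq, if_pos hi, Complex.mul_conj, Complex.normSq_eq_norm_sq]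
    push_cast; ring
  rw [← Real.norm_eq_abs, ← Complex.norm_real, Complex.ofReal_sub, hintg, hdiag, ← Finset.sum_sub_distrib]
  refine norm_sum_le_of_le _ fun i hi => ?_
  rw [← Finset.sum_sub_distrib]
  refine norm_sum_le_of_le _ fun j hj => ?_
  split_ifs with h
  · subst h
    simp
    ring
  · rw [sub_zero, norm_mul, norm_mul, RCLike.norm_conj]
    refine mul_le_mul_of_nonneg_left (exp_integral ?_ _ _) (by positivity)
    rw [sub_ne_zero]
    intro he
    have h1 : (ν j : ℝ) = ν i := Real.log_injOn_pos (mem_Ioi.2 (Nat.cast_pos.2 (hν j hj))) (mem_Ioi.2 (Nat.cast_pos.2 (hν i hi))) he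
    exact h (hinj hi hj (by exact_mod_cast h1.symm))

/-- bounded coefficients -/
lemma parseval_bdd {ι : Type*} [DecidableEq ι] (J : Finset ι) (ν : ι → ℕ) (hν : ∀ i ∈ J, 1 ≤ ν i) (hinj : Set.InjOn ν J) :
    ∃ C : ℝ, 0 ≤ C ∧ ∀ c : ι → ℂ, (∀ i ∈ J, ‖c i‖ ≤ 1) → ∀ T : ℝ,
    |(∫ τ in T..(2*T), ‖∑ i ∈ J, c i * (ν i:ℂ)^(-(τ * I))‖^2) - T * ∑ i ∈ J, ‖c i‖^2| ≤ C := by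
  refine ⟨∑ i ∈ J, ∑ j ∈ J, (2 / |Real.log (ν j) - Real.log (ν i)|), by positivity, fun c hc T => ?_⟩
  refine (parseval J ν hν hinj c T).trans ?_
  refine Finset.sum_le_sum fun i hi => Finset.sum_le_sum fun j hj => ?_
  split_ifs
  · positivity
  · have : ‖c i‖ * ‖c j‖ ≤ 1 := mul_le_one₀ (hc i hi) (norm_nonneg _) (hc j hj)
    exact mul_le_of_le_one_left (by positivity) this

lemma sum_rpow_le {b : ℝ} (hb : 0 < b) (hb1 : b < 1) (N : ℕ) :
    ∑ m ∈ Finset.Icc 1 N, (m:ℝ)^(-b) ≤ (N:ℝ)^(1-b) / (1-b) := by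
  have hp : 0 < 1 - b := by linarith
  induction N with
  | zero => simp; positivity
  | succ N ih =>
    rw [Finset.sum_Icc_succ_top (by omega)]
    have hN : (0:ℝ) < ((N+1:ℕ):ℝ) := by positivity
    have h1 : (N:ℝ)^(1-b) ≤ ((N+1:ℕ):ℝ)^(1-b) - (1-b) * ((N+1:ℕ):ℝ)^(-b) := by
      have h2 := rpow_one_add_le_one_add_mul_self (s := -1/((N+1:ℕ):ℝ)) (p := 1-b) (by
        rw [le_div_iff₀ hN]; push_cast; linarith [(Nat.cast_nonneg N : (0:ℝ) ≤ N)]) hp.le (by linarith)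
      have h3 : (N:ℝ) = ((N+1:ℕ):ℝ) * (1 + -1/((N+1:ℕ):ℝ)) := by field_simp; push_cast; ring
      have h4 : 0 ≤ 1 + -1/((N+1:ℕ):ℝ) := by
        have : (1 + -1/((N+1:ℕ):ℝ)) = N / ((N+1:ℕ):ℝ) := by field_simp; push_cast; ring
        rw [this]; positivity
      rw [h3, Real.mul_rpow hN.le h4]
      calc _ ≤ ((N+1:ℕ):ℝ)^(1-b) * (1 + (1-b) * (-1/((N+1:ℕ):ℝ))) := mul_le_mul_of_nonneg_left h2 (by positivity)
        _ = _ := by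
          rw [sub_eq_add_neg 1 b, Real.rpow_add hN, Real.rpow_one]; field_simp; ring
    have : ((N+1:ℕ):ℝ)^(-b) = ((1-b) * ((N+1:ℕ):ℝ)^(-b)) / (1-b) := by field_simp
    rw [this]
    calc _ ≤ (N:ℝ)^(1-b) / (1-b) + ((1-b) * ((N+1:ℕ):ℝ)^(-b)) / (1-b) := by gcongr
      _ ≤ _ := by rw [← add_div]; gcongr; linarith

/-- pointwise off diagonal bound, `m < n` -/
lemma offdiag_pt {σ : ℝ} (h1 : 1/2 < σ) (h2 : σ < 1) {m d : ℕ} (hm : 1 ≤ m) (hd : 1 ≤ d) :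
    (m:ℝ)^(-σ) * ((m + d : ℕ):ℝ)^(-σ) * (2 / |Real.log ((m + d : ℕ):ℝ) - Real.log m|) ≤
      2 * ((m:ℝ)^(-(2*σ-1)) * (d:ℝ)^(-(1 - (σ - 1/2))) + (m:ℝ)^(-σ) * (d:ℝ)^(-σ)) := by
  have hm' : (0:ℝ) < m := by exact_mod_cast hm
  have hd' : (0:ℝ) < d := by exact_mod_cast hd
  have hd1 : (1:ℝ) ≤ d := by exact_mod_cast hd
  push_cast
  set n : ℝ := (m:ℝ) + d with hn
  have hn' : 0 < n := by positivity
  have hlog : d / n ≤ Real.log n - Real.log m := by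
    rw [← Real.log_div hn'.ne' hm'.ne']
    have := Real.one_sub_inv_le_log_of_pos (x := n / m) (by positivity)
    refine le_trans (le_of_eq ?_) this
    rw [inv_div]; field_simp; rw [hn]; ring
  have hpos : 0 < d / n := by positivity
  have hl2 : 2 / |Real.log n - Real.log m| ≤ 2 * (n / d) := by
    rw [abs_of_pos (hpos.trans_le hlog)]
    calc 2 / (Real.log n - Real.log m) ≤ 2 / (d / n) := div_le_div_of_nonneg_left (by norm_num) hpos hlog
      _ = _ := by field_simp
  have hsub : n^(1-σ) ≤ (m:ℝ)^(1-σ) + (d:ℝ)^(1-σ) := Real.rpow_add_le_add_rpow hm'.le hd'.le (by linarith) (by linarith)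
  calc _ ≤ (m:ℝ)^(-σ) * n^(-σ) * (2 * (n / d)) := mul_le_mul_of_nonneg_left hl2 (by positivity)
    _ = 2 * ((m:ℝ)^(-σ) * (d:ℝ)^(-1:ℝ) * n^(1-σ)) := by
      rw [sub_eq_add_neg 1 σ, Real.rpow_add hn', Real.rpow_one, Real.rpow_neg_one]; ring
    _ ≤ 2 * ((m:ℝ)^(-σ) * (d:ℝ)^(-1:ℝ) * ((m:ℝ)^(1-σ) + (d:ℝ)^(1-σ))) := by gcongr
    _ = 2 * ((m:ℝ)^(-(2*σ-1)) * (d:ℝ)^(-1:ℝ) + (m:ℝ)^(-σ) * (d:ℝ)^(-σ)) := by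
      rw [show -(2*σ-1) = -σ + (1 - σ) by ring, Real.rpow_add hm']
      have : (d:ℝ)^(-σ) = (d:ℝ)^(-1:ℝ) * (d:ℝ)^(1-σ) := by rw [← Real.rpow_add hd']; congr 1; ring
      rw [this]; ring
    _ ≤ _ := by
      refine mul_le_mul_of_nonneg_left (add_le_add_left (mul_le_mul_of_nonneg_left ?_ (by positivity)) _) (by norm_num)
      exact Real.rpow_le_rpow_of_exponent_le hd1 (by linarith)

lemma offdiag {σ : ℝ} (h1 : 1/2 < σ) (h2 : σ < 1) : ∃ C : ℝ, 0 ≤ C ∧ ∀ N : ℕ, 1 ≤ N →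
    ∑ m ∈ Finset.Icc 1 N, ∑ n ∈ Finset.Icc 1 N, (if m = n then 0 else
      (m:ℝ)^(-σ) * (n:ℝ)^(-σ) * (2 / |Real.log n - Real.log m|)) ≤ C * (N:ℝ)^(1 - (σ - 1/2)) := by
  refine ⟨4 * (1 / (1 - (2*σ-1)) * (1 / (1 - (1 - (σ - 1/2)))) + 1 / (1-σ) * (1 / (1-σ))), ?_, ?_⟩
  · have : 0 < 1 - (2*σ-1) := by linarith
    have : 0 < 1 - (1 - (σ - 1/2)) := by linarith
    have : 0 < 1 - σ := by linarith
    positivity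
  intro N hN
  set f : ℕ → ℕ → ℝ := fun m n => (m:ℝ)^(-σ) * (n:ℝ)^(-σ) * (2 / |Real.log n - Real.log m|) with hf
  have hfs : ∀ m n, f m n = f n m := by
    intro m n; simp only [hf]; rw [abs_sub_comm]; ring
  have hf0 : ∀ m n, 0 ≤ f m n := by intro m n; simp only [hf]; positivity
  set g : ℕ → ℕ → ℝ := fun m d => 2 * ((m:ℝ)^(-(2*σ-1)) * (d:ℝ)^(-(1 - (σ - 1/2))) + (m:ℝ)^(-σ) * (d:ℝ)^(-σ)) with hg
  have hg0 : ∀ m n, 0 ≤ g m n := by intro m n; simp only [hg]; positivity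
  -- inner sum for m<n
  have hin : ∀ m ∈ Finset.Icc 1 N, ∑ n ∈ Finset.Icc 1 N, (if m < n then f m n else 0) ≤ ∑ d ∈ Finset.Icc 1 N, g m d := by
    intro m hm
    have hm1 := (Finset.mem_Icc.1 hm).1
    rw [← Finset.sum_filter]
    calc ∑ n ∈ Finset.Icc 1 N with m < n, f m n ≤ ∑ n ∈ Finset.Icc 1 N with m < n, g m (n - m) := by
          refine Finset.sum_le_sum fun n hn => ?_
          rw [Finset.mem_filter] at hn
          have h3 := offdiag_pt h1 h2 hm1 (show 1 ≤ n - m by omega)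
          rw [show m + (n - m) = n by omega] at h3
          exact h3
      _ = ∑ d ∈ (Finset.Icc 1 N).filter (fun n => m < n) |>.image (fun n => n - m), g m d := by
          rw [Finset.sum_image]
          intro x hx y hy hxy
          have hx' := (Finset.mem_filter.1 hx).2
          have hy' := (Finset.mem_filter.1 hy).2
          simp only at hxy
          omega
      _ ≤ _ := by
          refine Finset.sum_le_sum_of_subset_of_nonneg ?_ (fun _ _ _ => hg0 _ _)
          intro d hd
          rw [Finset.mem_image] at hd
          obtain ⟨n, hn, rfl⟩ := hd
          rw [Finset.mem_filter, Finset.mem_Icc] at hn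
          rw [Finset.mem_Icc]; omega
  have hsplit : ∑ m ∈ Finset.Icc 1 N, ∑ n ∈ Finset.Icc 1 N, (if m = n then 0 else f m n) =
      2 * ∑ m ∈ Finset.Icc 1 N, ∑ n ∈ Finset.Icc 1 N, (if m < n then f m n else 0) := by
    have hsw : ∑ m ∈ Finset.Icc 1 N, ∑ n ∈ Finset.Icc 1 N, (if m < n then f m n else 0) =
        ∑ m ∈ Finset.Icc 1 N, ∑ n ∈ Finset.Icc 1 N, (if n < m then f m n else 0) := by
      rw [Finset.sum_comm]
      refine Finset.sum_congr rfl fun m _ => Finset.sum_congr rfl fun n _ => ?_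
      rw [hfs]
    rw [two_mul]
    nth_rw 2 [hsw]
    rw [← Finset.sum_add_distrib]
    refine Finset.sum_congr rfl fun m _ => ?_
    rw [← Finset.sum_add_distrib]
    refine Finset.sum_congr rfl fun n _ => ?_
    rcases lt_trichotomy m n with h | h | h
    · rw [if_neg h.ne, if_pos h, if_neg h.not_gt, add_zero]
    · subst h; simp
    · rw [if_neg h.ne', if_pos h, if_neg h.not_gt, zero_add]
  have hNp : (0:ℝ) < N := by exact_mod_cast hN
  have hN1 : (1:ℝ) ≤ N := by exact_mod_cast hN
  change ∑ m ∈ Finset.Icc 1 N, ∑ n ∈ Finset.Icc 1 N, (if m = n then 0 else f m n) ≤ _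
  rw [hsplit]
  have hA := sum_rpow_le (b := 2*σ-1) (by linarith) (by linarith) N
  have hB := sum_rpow_le (b := 1 - (σ - 1/2)) (by linarith) (by linarith) N
  have hC := sum_rpow_le (b := σ) (by linarith) h2 N
  have e1 : 0 < 1 - (2*σ-1) := by linarith
  have e2 : 0 < 1 - (1 - (σ - 1/2)) := by linarith
  have e3 : 0 < 1 - σ := by linarith
  calc 2 * ∑ m ∈ Finset.Icc 1 N, ∑ n ∈ Finset.Icc 1 N, (if m < n then f m n else 0)
      ≤ 2 * ∑ m ∈ Finset.Icc 1 N, ∑ d ∈ Finset.Icc 1 N, g m d :=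
        mul_le_mul_of_nonneg_left (Finset.sum_le_sum hin) (by norm_num)
    _ = 4 * ((∑ m ∈ Finset.Icc 1 N, (m:ℝ)^(-(2*σ-1))) * (∑ d ∈ Finset.Icc 1 N, (d:ℝ)^(-(1 - (σ - 1/2)))) +
          (∑ m ∈ Finset.Icc 1 N, (m:ℝ)^(-σ)) * (∑ d ∈ Finset.Icc 1 N, (d:ℝ)^(-σ))) := by
        simp only [hg, Finset.sum_mul_sum, ← Finset.mul_sum, Finset.sum_add_distrib]
        ring
    _ ≤ 4 * (((N:ℝ)^(1-(2*σ-1)) / (1-(2*σ-1))) * ((N:ℝ)^(1-(1 - (σ - 1/2))) / (1-(1 - (σ - 1/2)))) +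
          ((N:ℝ)^(1-σ) / (1-σ)) * ((N:ℝ)^(1-σ) / (1-σ))) := by
        refine mul_le_mul_of_nonneg_left (add_le_add ?_ ?_) (by norm_num)
        · exact mul_le_mul hA hB (by positivity) (by positivity)
        · exact mul_le_mul hC hC (by positivity) (by positivity)
    _ ≤ _ := by
        have q1 : (N:ℝ)^(1-(2*σ-1)) * (N:ℝ)^(1-(1 - (σ - 1/2))) ≤ (N:ℝ)^(1 - (σ - 1/2)) := by
          rw [← Real.rpow_add hNp]
          exact Real.rpow_le_rpow_of_exponent_le hN1 (by linarith)
        have q2 : (N:ℝ)^(1-σ) * (N:ℝ)^(1-σ) ≤ (N:ℝ)^(1 - (σ - 1/2)) := by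
          rw [← Real.rpow_add hNp]
          exact Real.rpow_le_rpow_of_exponent_le hN1 (by linarith)
        have r1 : 0 ≤ 1 / (1 - (2*σ-1)) * (1 / (1 - (1 - (σ - 1/2)))) := by positivity
        have r2 : 0 ≤ 1 / (1-σ) * (1 / (1-σ)) := by positivity
        calc _ = 4 * (1 / (1 - (2*σ-1)) * (1 / (1 - (1 - (σ - 1/2)))) * ((N:ℝ)^(1-(2*σ-1)) * (N:ℝ)^(1-(1 - (σ - 1/2)))) +
              1 / (1-σ) * (1 / (1-σ)) * ((N:ℝ)^(1-σ) * (N:ℝ)^(1-σ))) := by ring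
          _ ≤ 4 * (1 / (1 - (2*σ-1)) * (1 / (1 - (1 - (σ - 1/2)))) * (N:ℝ)^(1 - (σ - 1/2)) +
              1 / (1-σ) * (1 / (1-σ)) * (N:ℝ)^(1 - (σ - 1/2))) := by
            refine mul_le_mul_of_nonneg_left (add_le_add ?_ ?_) (by norm_num)
            · exact mul_le_mul_of_nonneg_left q1 r1
            · exact mul_le_mul_of_nonneg_left q2 r2
          _ = _ := by ring

end Vor

namespace Vor

lemma cpow_split {n : ℕ} (hn : 1 ≤ n) (s : ℂ) (τ : ℝ) : (n:ℂ)^(-(s + τ * I)) = (n:ℂ)^(-s) * (n:ℂ)^(-(τ * I)) := by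
  rw [← Complex.cpow_add _ _ (by exact_mod_cast (by omega : n ≠ 0))]; congr 1; ring

lemma ms_tail {σ : ℝ} (h1 : 1/2 < σ) (h2 : σ < 1) {δ : ℝ} (hδ : 0 < δ) : ∃ X0 : ℕ, ∀ X : ℕ, X0 ≤ X → ∃ T0 : ℕ, ∀ T : ℕ, T0 ≤ T →
    ∀ s : ℂ, σ ≤ s.re → ∫ τ in (T:ℝ)..(2*T), ‖∑ n ∈ Finset.Ico (X+1) (8*T), (n:ℂ)^(-(s + τ * I))‖^2 ≤ δ * T := by
  obtain ⟨y, hy⟩ := tail_small (a := 2 * σ) (by linarith) (show 0 < δ / 2 by positivity)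
  obtain ⟨C, hC0, hC⟩ := offdiag h1 h2
  obtain ⟨N0, hN0⟩ := rpow_neg_small (σ := σ - 1/2) (by linarith) (show 0 < δ / (16 * (C + 1)) by positivity)
  refine ⟨y, fun X hX => ⟨N0 + 1, fun T hT s hs => ?_⟩⟩
  have hTp : (0:ℝ) < T := by exact_mod_cast (by omega : 0 < T)
  set J := Finset.Ico (X+1) (8*T) with hJ
  have hJ1 : ∀ n ∈ J, 1 ≤ n := by intro n hn; have := (Finset.mem_Ico.1 hn).1; omega
  have hp := parseval J id hJ1 (Function.injective_id.injOn) (fun n => (n:ℂ)^(-s)) T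
  have heq : ∀ τ : ℝ, ∑ n ∈ J, (n:ℂ)^(-(s + τ * I)) = ∑ n ∈ J, (n:ℂ)^(-s) * ((id n : ℕ) : ℂ)^(-(τ * I)) :=
    fun τ => Finset.sum_congr rfl fun n hn => cpow_split (hJ1 n hn) s τ
  simp_rw [heq]
  have h3 := (abs_le.1 hp).2
  have hcn : ∀ n ∈ J, ‖(n:ℂ)^(-s)‖ ≤ (n:ℝ)^(-σ) := by
    intro n hn
    rw [norm_prime_cpow (hJ1 n hn)]
    exact Real.rpow_le_rpow_of_exponent_le (by exact_mod_cast hJ1 n hn) (by linarith)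
  have hdiag : ∑ n ∈ J, ‖(n:ℂ)^(-s)‖^2 ≤ δ / 2 := by
    refine le_trans (Finset.sum_le_sum fun n hn => ?_) (hy J (by
      intro p hp; have := (Finset.mem_Ico.1 hp).1; omega)).le
    calc ‖(n:ℂ)^(-s)‖^2 ≤ ((n:ℝ)^(-σ))^2 := by
          apply pow_le_pow_left₀ (norm_nonneg _) (hcn n hn)
      _ = _ := by rw [← Real.rpow_natCast, ← Real.rpow_mul (Nat.cast_nonneg n)]; congr 1; push_cast; ring
  have hoff : (∑ i ∈ J, ∑ j ∈ J, if i = j then 0 else ‖(i:ℂ)^(-s)‖ * ‖(j:ℂ)^(-s)‖ * (2 / |Real.log (id j : ℕ) - Real.log (id i : ℕ)|)) ≤ δ / 2 * T := by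
    have hsub : J ⊆ Finset.Icc 1 (8*T) := by
      intro n hn; rw [hJ, Finset.mem_Ico] at hn; rw [Finset.mem_Icc]; omega
    calc _ ≤ ∑ i ∈ J, ∑ j ∈ J, (if i = j then 0 else (i:ℝ)^(-σ) * (j:ℝ)^(-σ) * (2 / |Real.log j - Real.log i|)) := by
          refine Finset.sum_le_sum fun i hi => Finset.sum_le_sum fun j hj => ?_
          split_ifs
          · exact le_rfl
          · refine mul_le_mul_of_nonneg_right ?_ (by positivity)
            exact mul_le_mul (hcn i hi) (hcn j hj) (norm_nonneg _) (by positivity)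
      _ ≤ ∑ i ∈ Finset.Icc 1 (8*T), ∑ j ∈ J, (if i = j then 0 else (i:ℝ)^(-σ) * (j:ℝ)^(-σ) * (2 / |Real.log j - Real.log i|)) := by
          refine Finset.sum_le_sum_of_subset_of_nonneg hsub fun i _ _ => Finset.sum_nonneg fun j _ => ?_
          split_ifs <;> positivity
      _ ≤ ∑ i ∈ Finset.Icc 1 (8*T), ∑ j ∈ Finset.Icc 1 (8*T), (if i = j then 0 else (i:ℝ)^(-σ) * (j:ℝ)^(-σ) * (2 / |Real.log j - Real.log i|)) := by
          refine Finset.sum_le_sum fun i _ => Finset.sum_le_sum_of_subset_of_nonneg hsub fun j _ _ => ?_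
          split_ifs <;> positivity
      _ ≤ C * ((8*T:ℕ):ℝ)^(1 - (σ - 1/2)) := hC (8*T) (by omega)
      _ ≤ C * (((8*T:ℕ):ℝ) * (δ / (16 * (C+1)))) := by
          refine mul_le_mul_of_nonneg_left ?_ hC0
          have hp : (0:ℝ) < ((8*T:ℕ):ℝ) := by exact_mod_cast (by omega : 0 < 8*T)
          rw [sub_eq_add_neg, Real.rpow_add hp, Real.rpow_one]
          exact mul_le_mul_of_nonneg_left (hN0 _ (by omega)).le hp.le
      _ ≤ _ := by
          push_cast
          have : C * (8 * T * (δ / (16 * (C+1)))) = (C / (C+1)) * (δ / 2 * T) := by field_simp; ring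
          rw [this]
          refine mul_le_of_le_one_left (by positivity) ?_
          rw [div_le_one (by linarith)]; linarith
  have h4 : (T:ℝ) * ∑ n ∈ J, ‖(n:ℂ)^(-s)‖^2 ≤ T * (δ / 2) := mul_le_mul_of_nonneg_left hdiag hTp.le
  linarith

def UH : Set ℂ := {w : ℂ | 0 < w.im}

def SmallFam (σ : ℝ) (Φ : ℕ → ℂ → ℂ) : Prop :=
  (∀ X, ContinuousOn (Φ X) UH) ∧ ∀ δ : ℝ, 0 < δ → ∃ X0 : ℕ, ∀ X : ℕ, X0 ≤ X → ∃ T0 : ℕ, 2 ≤ T0 ∧ ∀ T : ℕ, T0 ≤ T →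
    ∀ s : ℂ, σ ≤ s.re → s.re ≤ 1 → |s.im| ≤ 1 → ∫ τ in (T:ℝ)..(2*T), ‖Φ X (s + τ * I)‖^2 ≤ δ * T

lemma line_cont {f : ℂ → ℂ} (hf : ContinuousOn f UH) {T : ℕ} (hT : 2 ≤ T) {s : ℂ} (hs : |s.im| ≤ 1) :
    ContinuousOn (fun τ : ℝ => f (s + τ * I)) (uIcc (T:ℝ) (2*T)) := by
  have hT' : (2:ℝ) ≤ T := by exact_mod_cast hT
  refine hf.comp (by fun_prop) ?_
  intro τ hτ
  rw [uIcc_of_le (by linarith)] at hτ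
  have := (abs_le.1 hs).1
  simp [UH]; linarith [hτ.1]

lemma line_int {f : ℂ → ℂ} (hf : ContinuousOn f UH) {T : ℕ} (hT : 2 ≤ T) {s : ℂ} (hs : |s.im| ≤ 1) :
    IntervalIntegrable (fun τ : ℝ => ‖f (s + τ * I)‖^2) MeasureTheory.volume (T:ℝ) (2*T) :=
  ((line_cont hf hT hs).norm.pow 2).intervalIntegrable

lemma smallfam_comb {σ : ℝ} {Φ Ψ Θ : ℕ → ℂ → ℂ} (hΦ : SmallFam σ Φ) (hΨ : SmallFam σ Ψ)
    (hc : ∀ X, ContinuousOn (Θ X) UH) {p : ℕ} (hp : 1 ≤ p)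
    (hle : ∀ X w, 0 < w.im → σ ≤ w.re → ‖Θ X w‖^2 ≤ 2 * ‖Φ X w‖^2 + 2 * ‖Ψ (X/p) w‖^2) : SmallFam σ Θ := by
  refine ⟨hc, fun δ hδ => ?_⟩
  obtain ⟨X1, h1⟩ := hΦ.2 (δ/4) (by positivity)
  obtain ⟨X2, h2⟩ := hΨ.2 (δ/4) (by positivity)
  refine ⟨X1 + p * X2, fun X hX => ?_⟩
  obtain ⟨T1, hT1, h1⟩ := h1 X (by omega)
  obtain ⟨T2, hT2, h2⟩ := h2 (X/p) (by rw [Nat.le_div_iff_mul_le (by omega), mul_comm]; omega)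
  refine ⟨T1 + T2, by omega, fun T hT s a1 a2 a3 => ?_⟩
  have hT2' : 2 ≤ T := by omega
  have hTr : (2:ℝ) ≤ T := by exact_mod_cast hT2'
  have i1 := line_int (hΦ.1 X) hT2' a3
  have i2 := line_int (hΨ.1 (X/p)) hT2' a3
  have i3 := line_int (hc X) hT2' a3
  have b1 := h1 T (by omega) s a1 a2 a3
  have b2 := h2 T (by omega) s a1 a2 a3
  calc _ ≤ ∫ τ in (T:ℝ)..(2*T), (2 * ‖Φ X (s + τ * I)‖^2 + 2 * ‖Ψ (X/p) (s + τ * I)‖^2) := by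
        refine intervalIntegral.integral_mono_on (by linarith) i3 ((i1.const_mul 2).add (i2.const_mul 2)) fun τ hτ => ?_
        refine hle X _ ?_ (by simpa using a1)
        have := (abs_le.1 a3).1
        simp; linarith [hτ.1]
    _ = 2 * (∫ τ in (T:ℝ)..(2*T), ‖Φ X (s + τ * I)‖^2) + 2 * ∫ τ in (T:ℝ)..(2*T), ‖Ψ (X/p) (s + τ * I)‖^2 := by
        rw [intervalIntegral.integral_add (i1.const_mul 2) (i2.const_mul 2), intervalIntegral.integral_const_mul,
          intervalIntegral.integral_const_mul]
    _ ≤ _ := by linarith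

lemma norm_sq_two (a b : ℂ) : ‖a + b‖^2 ≤ 2 * ‖a‖^2 + 2 * ‖b‖^2 := by
  have := norm_add_le a b
  nlinarith [norm_nonneg (a+b), sq_nonneg (‖a‖ - ‖b‖), norm_nonneg a, norm_nonneg b]

noncomputable def SS (M : Finset ℕ) (X : ℕ) (w : ℂ) : ℂ := ∑ n ∈ (Finset.range (X+1)).filter (fun n => ∀ p ∈ M, ¬ p ∣ n), (n:ℂ)^(-w)
noncomputable def GG (M : Finset ℕ) (w : ℂ) : ℂ := riemannZeta w * ∏ p ∈ M, (1 - (p:ℂ)^(-w))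

lemma cpow_cont {n : ℕ} : ContinuousOn (fun w : ℂ => (n:ℂ)^(-w)) UH := by
  intro w hw
  have hw0 : w ≠ 0 := by rintro rfl; simp [UH] at hw
  exact (ContinuousAt.const_cpow (by fun_prop) (Or.inr (neg_ne_zero.2 hw0))).continuousWithinAt

lemma SS_cont (M : Finset ℕ) (X : ℕ) : ContinuousOn (SS M X) UH :=
  continuousOn_finsetSum _ fun n _ => cpow_cont

lemma GG_cont (M : Finset ℕ) : ContinuousOn (GG M) UH := by
  refine ContinuousOn.mul ?_ (continuousOn_finsetProd _ fun n _ => continuousOn_const.sub cpow_cont)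
  intro w hw
  have hw1 : w ≠ 1 := by rintro rfl; simp [UH] at hw
  exact (differentiableAt_riemannZeta hw1).continuousAt.continuousWithinAt

lemma small_base {σ : ℝ} (h1 : 1/2 < σ) (h2 : σ < 1) : SmallFam σ (fun X w => GG ∅ w - SS ∅ X w) := by
  refine ⟨fun X => (GG_cont _).sub (SS_cont _ _), fun δ hδ => ?_⟩
  obtain ⟨X0, hX0⟩ := ms_tail h1 h2 (show 0 < δ/4 by positivity)
  refine ⟨X0, fun X hX => ?_⟩
  obtain ⟨T1, hT1⟩ := hX0 X hX
  obtain ⟨T2, hT2⟩ := zeta_approx (σ := σ) (by linarith) h2 (δ := Real.sqrt (δ/4)) (Real.sqrt_pos.2 (by positivity))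
  refine ⟨T1 + T2 + X + 2, by omega, fun T hT s a1 a2 a3 => ?_⟩
  have hTr : (2:ℝ) ≤ T := by exact_mod_cast (by omega : 2 ≤ T)
  have ha := abs_le.1 a3
  have b1 := hT1 T (by omega) s a1
  have hc : ContinuousOn (fun w : ℂ => ∑ n ∈ Finset.Ico (X+1) (8*T), (n:ℂ)^(-w)) UH :=
    continuousOn_finsetSum _ fun n _ => cpow_cont
  have i1 := line_int hc (show 2 ≤ T by omega) a3
  have i2 := line_int ((GG_cont ∅).sub (SS_cont ∅ X)) (show 2 ≤ T by omega) a3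
  calc _ ≤ ∫ τ in (T:ℝ)..(2*T), (2 * (δ/4) + 2 * ‖∑ n ∈ Finset.Ico (X+1) (8*T), (n:ℂ)^(-(s + τ * I))‖^2) := by
        refine intervalIntegral.integral_mono_on (by linarith) i2
          ((intervalIntegrable_const).add (i1.const_mul 2)) fun τ hτ => ?_
        set w : ℂ := s + τ * I with hw
        have hd : GG ∅ w - SS ∅ X w = (riemannZeta w - ∑ n ∈ Finset.range (8*T), (n:ℂ)^(-w)) +
            ∑ n ∈ Finset.Ico (X+1) (8*T), (n:ℂ)^(-w) := by
          rw [Finset.sum_Ico_eq_sub _ (by omega : X+1 ≤ 8*T)]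
          simp [GG, SS]
        change ‖GG ∅ w - SS ∅ X w‖^2 ≤ _
        rw [hd]
        refine (norm_sq_two _ _).trans (add_le_add_left ?_ _)
        have := hT2 T (by omega) w (by simpa [hw] using a1) (by simpa [hw] using a2)
          (by simp [hw]; linarith [hτ.1]) (by simp [hw]; linarith [hτ.2])
        have h3 := pow_le_pow_left₀ (norm_nonneg _) this 2
        rw [Real.sq_sqrt (by positivity)] at h3
        linarith
    _ = 2 * (δ/4) * T + 2 * ∫ τ in (T:ℝ)..(2*T), ‖∑ n ∈ Finset.Ico (X+1) (8*T), (n:ℂ)^(-(s + τ * I))‖^2 := by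
        rw [intervalIntegral.integral_add intervalIntegrable_const (i1.const_mul 2), intervalIntegral.integral_const_mul]
        simp; ring
    _ ≤ _ := by linarith

lemma SS_insert {M : Finset ℕ} (hM : ∀ q ∈ M, q.Prime) {p : ℕ} (hp : p.Prime) (hpM : p ∉ M) (X : ℕ) (w : ℂ) :
    SS (insert p M) X w = SS M X w - (p:ℂ)^(-w) * SS M (X/p) w := by
  rw [SS, SS, SS, ← Finset.sum_filter_add_sum_filter_not ((Finset.range (X+1)).filter (fun n => ∀ q ∈ M, ¬ q ∣ n)) (fun n => p ∣ n)]
  have hA : ∑ n ∈ ((Finset.range (X+1)).filter (fun n => ∀ q ∈ M, ¬ q ∣ n)).filter (fun n => p ∣ n), (n:ℂ)^(-w) =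
      (p:ℂ)^(-w) * ∑ n ∈ (Finset.range (X/p+1)).filter (fun n => ∀ q ∈ M, ¬ q ∣ n), (n:ℂ)^(-w) := by
    rw [Finset.mul_sum]
    symm
    refine Finset.sum_nbij' (fun m => p * m) (fun n => n / p) ?_ ?_ ?_ ?_ ?_
    · intro m hm
      simp only [Finset.mem_filter, Finset.mem_range] at hm ⊢
      refine ⟨⟨?_, fun q hq hd => ?_⟩, dvd_mul_right _ _⟩
      · have : m ≤ X / p := by omega
        rw [Nat.le_div_iff_mul_le hp.pos] at this
        rw [mul_comm]; omega
      · rcases (hM q hq).dvd_mul.1 hd with h | h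
        · rw [(Nat.prime_dvd_prime_iff_eq (hM q hq) hp)] at h
          exact hpM (h ▸ hq)
        · exact hm.2 q hq h
    · intro n hn
      simp only [Finset.mem_filter, Finset.mem_range] at hn ⊢
      obtain ⟨⟨h1, h2⟩, m, rfl⟩ := hn
      rw [Nat.mul_div_cancel_left _ hp.pos]
      refine ⟨?_, fun q hq hd => h2 q hq (hd.mul_left p)⟩
      have : m ≤ X / p := by rw [Nat.le_div_iff_mul_le hp.pos, mul_comm]; omega
      omega
    · intro m _
      exact Nat.mul_div_cancel_left _ hp.pos
    · intro n hn
      exact Nat.mul_div_cancel' (Finset.mem_filter.1 hn).2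
    · intro m _
      rw [Nat.cast_mul, Complex.natCast_mul_natCast_cpow]
  rw [hA]
  have hB : ((Finset.range (X+1)).filter (fun n => ∀ q ∈ insert p M, ¬ q ∣ n)) =
      ((Finset.range (X+1)).filter (fun n => ∀ q ∈ M, ¬ q ∣ n)).filter (fun n => ¬ p ∣ n) := by
    ext n; simp only [Finset.mem_filter, Finset.mem_insert, forall_eq_or_imp]; tauto
  rw [hB]; ring

lemma small_GG {σ : ℝ} (h1 : 1/2 < σ) (h2 : σ < 1) (M : Finset ℕ) (hM : ∀ q ∈ M, q.Prime) :
    SmallFam σ (fun X w => GG M w - SS M X w) := by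
  induction M using Finset.induction_on with
  | empty => exact small_base h1 h2
  | insert p M hpM ih =>
    have hM' : ∀ q ∈ M, q.Prime := fun q hq => hM q (Finset.mem_insert_of_mem hq)
    have hp : p.Prime := hM p (Finset.mem_insert_self _ _)
    have ih := ih hM'
    refine smallfam_comb ih ih (fun X => (GG_cont _).sub (SS_cont _ _)) hp.one_le fun X w hw hσ => ?_
    have : GG (insert p M) w - SS (insert p M) X w = (GG M w - SS M X w) + (-(p:ℂ)^(-w)) * (GG M w - SS M (X/p) w) := by
      rw [SS_insert hM' hp hpM, GG, GG, Finset.prod_insert hpM]; ring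
    rw [this]
    refine (norm_sq_two _ _).trans (add_le_add_right ?_ _)
    rw [norm_mul, norm_neg]
    have h3 := (prime_cpow_lt_one hp (s := w) (by linarith)).le
    refine mul_le_mul_of_nonneg_left (pow_le_pow_left₀ (by positivity) ?_ 2) (by norm_num)
    exact mul_le_of_le_one_left (norm_nonneg _) h3

end Vor

namespace Vor

noncomputable def chi (v : ℕ → ℂ) (n : ℕ) : ℂ := n.factorization.prod fun p e => (v p)^e

lemma chi_mul (v : ℕ → ℂ) {a b : ℕ} (ha : 1 ≤ a) (hb : 1 ≤ b) : chi v (a * b) = chi v a * chi v b := by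
  rw [chi, Nat.factorization_mul (by omega) (by omega)]
  exact Finsupp.prod_add_index' (fun p => pow_zero _) (fun p e f => pow_add _ _ _)

lemma chi_prime (v : ℕ → ℂ) {p : ℕ} (hp : p.Prime) : chi v p = v p := by
  rw [chi, hp.factorization, Finsupp.prod_single_index (h := fun p e => (v p)^e) (pow_zero _), pow_one]

lemma chi_norm {v : ℕ → ℂ} (hv : ∀ p, ‖v p‖ = 1) (n : ℕ) : ‖chi v n‖ = 1 := by
  rw [chi, Finsupp.prod, norm_prod]
  exact Finset.prod_eq_one fun p _ => by rw [norm_pow, hv, one_pow]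

noncomputable def bet (v : ℕ → ℂ) (n : ℕ) (τ : ℝ) : ℂ := chi v n * (n:ℂ)^(-(τ * I))

lemma bet_mul (v : ℕ → ℂ) {a b : ℕ} (ha : 1 ≤ a) (hb : 1 ≤ b) (τ : ℝ) : bet v (a * b) τ = bet v a τ * bet v b τ := by
  rw [bet, bet, bet, chi_mul v ha hb, Nat.cast_mul, Complex.natCast_mul_natCast_cpow]; ring

lemma bet_one (v : ℕ → ℂ) (τ : ℝ) : bet v 1 τ = 1 := by simp [bet, chi]

lemma bet_pow (v : ℕ → ℂ) {a : ℕ} (ha : 1 ≤ a) (j : ℕ) (τ : ℝ) : bet v (a^j) τ = (bet v a τ)^j := by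
  induction j with
  | zero => simp [bet_one]
  | succ j ih => rw [pow_succ, pow_succ, bet_mul v (Nat.one_le_pow _ _ ha) ha, ih]

lemma bet_norm {v : ℕ → ℂ} (hv : ∀ p, ‖v p‖ = 1) {n : ℕ} (hn : 1 ≤ n) (τ : ℝ) : ‖bet v n τ‖ = 1 := by
  rw [bet, norm_mul, chi_norm hv, cpow_it hn, Complex.norm_exp_ofReal_mul_I, one_mul]

lemma bet_cont (v : ℕ → ℂ) {n : ℕ} (hn : 1 ≤ n) : Continuous (bet v n) := by
  unfold bet
  simp_rw [cpow_it hn]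
  fun_prop

noncomputable def AA (v : ℕ → ℂ) (M : Finset ℕ) (L : ℕ) (τ : ℝ) : ℂ := ∏ p ∈ M, ∑ j ∈ Finset.range L, (bet v p τ)^j

lemma AA_cont (v : ℕ → ℂ) (M : Finset ℕ) (hM : ∀ p ∈ M, p.Prime) (L : ℕ) : Continuous (AA v M L) :=
  continuous_finsetProd _ fun p hp => continuous_finsetSum _ fun j _ => (bet_cont v (hM p hp).one_le).pow j

lemma AA_norm {v : ℕ → ℂ} (hv : ∀ p, ‖v p‖ = 1) (M : Finset ℕ) (hM : ∀ p ∈ M, p.Prime) (L : ℕ) (τ : ℝ) :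
    ‖AA v M L τ‖ ≤ (L:ℝ)^M.card := by
  rw [AA, norm_prod]
  rw [← Finset.prod_const]
  refine Finset.prod_le_prod (fun p _ => norm_nonneg _) fun p hp => ?_
  refine (norm_sum_le _ _).trans ?_
  simp [bet_norm hv (hM p hp).one_le]

/-- smooth numbers -/
lemma AA_exp (M : Finset ℕ) (hM : ∀ p ∈ M, p.Prime) (L : ℕ) : ∃ K : Finset ℕ, K.card = L^M.card ∧
    (∀ k ∈ K, 1 ≤ k ∧ ∀ q : ℕ, q.Prime → q ∣ k → q ∈ M) ∧ ∀ v τ, AA v M L τ = ∑ k ∈ K, bet v k τ := by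
  induction M using Finset.induction_on with
  | empty =>
    refine ⟨{1}, by simp, ?_, ?_⟩
    · intro k hk
      rw [Finset.mem_singleton] at hk
      subst hk
      exact ⟨le_rfl, fun q hq h => absurd (Nat.dvd_one.1 h) hq.one_lt.ne'⟩
    · intro v τ; simp [AA, bet_one]
  | insert p M hpM ih =>
    obtain ⟨K, hK1, hK2, hK3⟩ := ih (fun q hq => hM q (Finset.mem_insert_of_mem hq))
    have hp : p.Prime := hM p (Finset.mem_insert_self _ _)
    have hfac : ∀ k ∈ K, ∀ j : ℕ, (k * p^j).factorization p = j := by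
      intro k hk j
      have h0 : ¬ p ∣ k := fun h => hpM ((hK2 k hk).2 p hp h)
      rw [Nat.factorization_mul (by have := (hK2 k hk).1; omega) (pow_ne_zero _ hp.ne_zero), Finsupp.add_apply,
        Nat.factorization_eq_zero_of_not_dvd h0, hp.factorization_pow]
      simp
    have hinj : Set.InjOn (fun x : ℕ × ℕ => x.1 * p^x.2) (K ×ˢ Finset.range L : Finset (ℕ × ℕ)) := by
      rintro ⟨k, j⟩ hx ⟨k', j'⟩ hy h
      simp only [Finset.coe_product, Set.mem_prod, Finset.mem_coe] at hx hy
      simp only at h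
      have e : j = j' := by rw [← hfac k hx.1 j, h, hfac k' hy.1 j']
      subst e
      have := Nat.eq_of_mul_eq_mul_right (pow_pos hp.pos j) h
      rw [this]
    refine ⟨(K ×ˢ Finset.range L).image (fun x => x.1 * p^x.2), ?_, ?_, ?_⟩
    · rw [Finset.card_image_of_injOn hinj, Finset.card_product, Finset.card_range, hK1, Finset.card_insert_of_notMem hpM, pow_succ]
    · intro k hk
      rw [Finset.mem_image] at hk
      obtain ⟨⟨k, j⟩, hx, rfl⟩ := hk
      rw [Finset.mem_product] at hx
      refine ⟨Nat.mul_pos (hK2 k hx.1).1 (pow_pos hp.pos j), fun q hq hd => ?_⟩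
      rcases hq.dvd_mul.1 hd with h | h
      · exact Finset.mem_insert_of_mem ((hK2 k hx.1).2 q hq h)
      · rw [(Nat.prime_dvd_prime_iff_eq hq hp).1 (hq.dvd_of_dvd_pow h)]
        exact Finset.mem_insert_self _ _
    · intro v τ
      rw [Finset.sum_image hinj, Finset.sum_product, AA, Finset.prod_insert hpM]
      change _ * AA v M L τ = _
      rw [hK3, mul_comm, Finset.sum_mul_sum]
      refine Finset.sum_congr rfl fun k hk => Finset.sum_congr rfl fun j _ => ?_
      rw [bet_mul v (hK2 k hk).1 (Nat.one_le_pow _ _ hp.pos), bet_pow v hp.one_le]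

/-- mean square of `A` -/
lemma AA_ms (M : Finset ℕ) (hM : ∀ p ∈ M, p.Prime) (L : ℕ) : ∃ C : ℝ, 0 ≤ C ∧ ∀ v : ℕ → ℂ, (∀ p, ‖v p‖ = 1) → ∀ T : ℝ,
    |(∫ τ in T..(2*T), ‖AA v M L τ‖^2) - T * (L:ℝ)^M.card| ≤ C := by
  obtain ⟨K, hK1, hK2, hK3⟩ := AA_exp M hM L
  obtain ⟨C, hC0, hC⟩ := parseval_bdd K id (fun k hk => (hK2 k hk).1) Function.injective_id.injOn
  refine ⟨C, hC0, fun v hv T => ?_⟩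
  have := hC (chi v) (fun i _ => (chi_norm hv i).le) T
  simp only [chi_norm hv, one_pow, Finset.sum_const, hK1, nsmul_eq_mul, mul_one] at this
  simp_rw [hK3]
  push_cast at this
  exact this

lemma AA_erase {v : ℕ → ℂ} (hv : ∀ p, ‖v p‖ = 1) (M : Finset ℕ) (hM : ∀ p ∈ M, p.Prime) (L : ℕ) {p : ℕ} (hp : p ∈ M) (τ : ℝ) :
    ‖AA v M L τ‖^2 * ‖bet v p τ - 1‖^2 ≤ 4 * ‖AA v (M.erase p) L τ‖^2 := by
  have h1 : AA v M L τ * (bet v p τ - 1) = ((bet v p τ)^L - 1) * AA v (M.erase p) L τ := by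
    rw [AA, ← Finset.mul_prod_erase _ _ hp, AA, ← geom_sum_mul]; ring
  rw [← mul_pow, ← norm_mul, h1, norm_mul, mul_pow]
  refine mul_le_mul_of_nonneg_right ?_ (by positivity)
  have : ‖(bet v p τ)^L - 1‖ ≤ 2 := by
    refine (norm_sub_le _ _).trans ?_
    rw [norm_pow, bet_norm hv (hM p hp).one_le, norm_one, one_pow]; norm_num
  calc _ ≤ (2:ℝ)^2 := pow_le_pow_left₀ (norm_nonneg _) this 2
    _ = 4 := by norm_num

/-- mean square of `A * (S - 1)` -/
lemma AS_ms {σ : ℝ} (hσ : 1/2 < σ) (M : Finset ℕ) (hM : ∀ p ∈ M, p.Prime) (L X y0 : ℕ) {κ : ℝ}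
    (hκ : ∀ F : Finset ℕ, (∀ n ∈ F, y0 < n) → ∑ n ∈ F, (n:ℝ)^(-(2*σ)) < κ)
    (hMy : ∀ p : ℕ, p.Prime → p ≤ y0 → p ∈ M) (hX : 1 ≤ X) :
    ∃ C : ℝ, 0 ≤ C ∧ ∀ v : ℕ → ℂ, (∀ p, ‖v p‖ = 1) → ∀ T : ℝ, 0 ≤ T → ∀ s : ℂ, σ ≤ s.re →
      ∫ τ in T..(2*T), ‖AA v M L τ * (SS M X (s + τ * I) - 1)‖^2 ≤ T * (L:ℝ)^M.card * κ + C := by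
  obtain ⟨K, hK1, hK2, hK3⟩ := AA_exp M hM L
  set Y := (Finset.range (X+1)).filter (fun n => 1 < n ∧ ∀ p ∈ M, ¬ p ∣ n) with hY
  have hYm : ∀ n ∈ Y, 1 < n ∧ ∀ p ∈ M, ¬ p ∣ n := fun n hn => (Finset.mem_filter.1 hn).2
  have hcop : ∀ k ∈ K, ∀ n ∈ Y, Nat.Coprime k n := by
    intro k hk n hn
    refine Nat.Coprime.symm (Nat.coprime_of_dvd fun q hq h1 h2 => ?_)
    exact (hYm n hn).2 q ((hK2 k hk).2 q hq h2) h1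
  have hinj : Set.InjOn (fun x : ℕ × ℕ => x.1 * x.2) (K ×ˢ Y : Finset (ℕ × ℕ)) := by
    rintro ⟨k, n⟩ hx ⟨k', n'⟩ hy h
    simp only [Finset.coe_product, Set.mem_prod, Finset.mem_coe] at hx hy
    simp only at h
    have e : k = k' := by
      apply Nat.dvd_antisymm
      · exact (hcop k hx.1 n' hy.2).dvd_of_dvd_mul_right (h ▸ dvd_mul_right k n)
      · exact (hcop k' hy.1 n hx.2).dvd_of_dvd_mul_right (h ▸ dvd_mul_right k' n')
    subst e
    have := Nat.eq_of_mul_eq_mul_left (hK2 k hx.1).1 h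
    rw [this]
  obtain ⟨C, hC0, hC⟩ := parseval_bdd (K ×ˢ Y) (fun x : ℕ × ℕ => x.1 * x.2) (by
    rintro ⟨k, n⟩ hx
    rw [Finset.mem_product] at hx
    exact Nat.mul_pos (hK2 k hx.1).1 (by have := (hYm n hx.2).1; simp only; omega)) hinj
  refine ⟨C, hC0, fun v hv T hT s hs => ?_⟩
  have hn1 : ∀ n ∈ Y, 1 ≤ n := fun n hn => (hYm n hn).1.le
  have hcn : ∀ n ∈ Y, ‖(n:ℂ)^(-s)‖ ≤ (n:ℝ)^(-σ) := by
    intro n hn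
    rw [norm_prime_cpow (hn1 n hn)]
    exact Real.rpow_le_rpow_of_exponent_le (by exact_mod_cast hn1 n hn) (by linarith)
  have hS : ∀ τ : ℝ, SS M X (s + τ * I) - 1 = ∑ n ∈ Y, (n:ℂ)^(-(s + τ * I)) := by
    intro τ
    set w : ℂ := s + τ * I with hw
    have hw0 : w ≠ 0 := by
      intro h
      have := congrArg Complex.re h
      simp [hw] at this
      linarith
    rw [SS, sub_eq_iff_eq_add]
    have h1 : (1:ℕ) ∈ (Finset.range (X+1)).filter (fun n => ∀ p ∈ M, ¬ p ∣ n) := by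
      rw [Finset.mem_filter, Finset.mem_range]
      exact ⟨by omega, fun p hp h => (hM p hp).one_lt.ne' (Nat.dvd_one.1 h)⟩
    rw [← Finset.sum_erase_add _ _ h1]
    congr 1
    · symm
      refine Finset.sum_subset ?_ ?_
      · intro n hn
        rw [hY, Finset.mem_filter] at hn
        rw [Finset.mem_erase, Finset.mem_filter]
        exact ⟨by omega, hn.1, hn.2.2⟩
      · intro n hn hnY
        rw [Finset.mem_erase, Finset.mem_filter] at hn
        have : n = 0 := by
          by_contra h0
          apply hnY
          rw [hY, Finset.mem_filter]
          exact ⟨hn.2.1, by omega, hn.2.2⟩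
        subst this
        rw [Nat.cast_zero, Complex.zero_cpow (neg_ne_zero.2 hw0)]
    · simp
  have heq : ∀ τ : ℝ, AA v M L τ * (SS M X (s + τ * I) - 1) =
      ∑ x ∈ K ×ˢ Y, (chi v x.1 * (x.2:ℂ)^(-s)) * ((x.1 * x.2 : ℕ):ℂ)^(-(τ * I)) := by
    intro τ
    rw [hS, hK3, Finset.sum_mul_sum, Finset.sum_product]
    refine Finset.sum_congr rfl fun k hk => Finset.sum_congr rfl fun n hn => ?_
    rw [cpow_split (hn1 n hn), bet, Nat.cast_mul, Complex.natCast_mul_natCast_cpow]; ring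
  simp_rw [heq]
  have hc1 : ∀ x ∈ K ×ˢ Y, ‖chi v x.1 * (x.2:ℂ)^(-s)‖ ≤ (x.2:ℝ)^(-σ) := by
    intro x hx
    rw [Finset.mem_product] at hx
    rw [norm_mul, chi_norm hv, one_mul]
    exact hcn _ hx.2
  have h5 := hC (fun x => chi v x.1 * (x.2:ℂ)^(-s)) (fun x hx => (hc1 x hx).trans (by
    rw [Finset.mem_product] at hx
    exact Real.rpow_le_one_of_one_le_of_nonpos (by exact_mod_cast hn1 _ hx.2) (by linarith))) T
  have h6 := (abs_le.1 h5).2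
  have h7 : ∑ x ∈ K ×ˢ Y, ‖chi v x.1 * (x.2:ℂ)^(-s)‖^2 ≤ (L:ℝ)^M.card * κ := by
    calc _ ≤ ∑ x ∈ K ×ˢ Y, (x.2:ℝ)^(-(2*σ)) := by
          refine Finset.sum_le_sum fun x hx => ?_
          calc _ ≤ ((x.2:ℝ)^(-σ))^2 := pow_le_pow_left₀ (norm_nonneg _) (hc1 x hx) 2
            _ = _ := by rw [← Real.rpow_natCast, ← Real.rpow_mul (Nat.cast_nonneg _)]; congr 1; push_cast; ring
      _ = (L:ℝ)^M.card * ∑ n ∈ Y, (n:ℝ)^(-(2*σ)) := by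
          rw [Finset.sum_product]
          simp only [Finset.sum_const, hK1, nsmul_eq_mul]
          push_cast; ring
      _ ≤ _ := by
          refine mul_le_mul_of_nonneg_left (hκ Y fun n hn => ?_).le (by positivity)
          have hn' := hYm n hn
          have hp := Nat.minFac_prime (n := n) (by omega)
          by_contra hle
          have : n.minFac ≤ y0 := (Nat.minFac_le (by omega)).trans (by omega)
          exact hn'.2 _ (hMy _ hp this) (Nat.minFac_dvd n)
  have h8 := mul_le_mul_of_nonneg_left h7 hT
  linarith

end Vor

namespace Vor

lemma AG_ms {σ : ℝ} (hσ : 1/2 < σ) (hσ1 : σ < 1) (M : Finset ℕ) (hM : ∀ p ∈ M, p.Prime) (L y0 : ℕ) (hL : 1 ≤ L) {κ : ℝ}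
    (hκ0 : 0 < κ)
    (hκ : ∀ F : Finset ℕ, (∀ n ∈ F, y0 < n) → ∑ n ∈ F, (n:ℝ)^(-(2*σ)) < κ)
    (hMy : ∀ p : ℕ, p.Prime → p ≤ y0 → p ∈ M) {v : ℕ → ℂ} (hv : ∀ p, ‖v p‖ = 1) :
    ∃ T0 : ℕ, 2 ≤ T0 ∧ ∀ T : ℕ, T0 ≤ T → ∀ s : ℂ, σ ≤ s.re → s.re ≤ 1 → |s.im| ≤ 1 →
      ∫ τ in (T:ℝ)..(2*T), ‖AA v M L τ‖^2 * ‖GG M (s + τ * I) - 1‖^2 ≤ 4 * κ * (T * (L:ℝ)^M.card) := by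
  have hLr : (1:ℝ) ≤ L := by exact_mod_cast hL
  set B := (L:ℝ)^M.card with hB
  have hB1 : 1 ≤ B := one_le_pow₀ hLr
  have hsm := small_GG hσ hσ1 M hM
  obtain ⟨X0, hX0⟩ := hsm.2 (κ / (2 * B)) (by positivity)
  obtain ⟨T1, hT1, h1⟩ := hX0 (X0+1) (by omega)
  obtain ⟨C, hC0, hC⟩ := AS_ms hσ M hM L (X0+1) y0 hκ hMy (by omega)
  obtain ⟨T2, hT2⟩ := exists_nat_ge (2 * C / κ)
  refine ⟨T1 + T2, by omega, fun T hT s a1 a2 a3 => ?_⟩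
  have hT2' : 2 ≤ T := by omega
  have hTr : (2:ℝ) ≤ T := by exact_mod_cast hT2'
  have hAc := AA_cont v M hM L
  have lc1 := line_cont (hsm.1 (X0+1)) hT2' a3
  have lc2 := line_cont ((SS_cont M (X0+1)).sub (continuousOn_const (c := (1:ℂ)))) hT2' a3
  have lc3 := line_cont ((GG_cont M).sub (continuousOn_const (c := (1:ℂ)))) hT2' a3
  have i1 : IntervalIntegrable (fun τ : ℝ => B^2 * ‖GG M (s + τ * I) - SS M (X0+1) (s + τ * I)‖^2) MeasureTheory.volume (T:ℝ) (2*T) :=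
    (continuousOn_const.mul (lc1.norm.pow 2)).intervalIntegrable
  have i2 : IntervalIntegrable (fun τ : ℝ => ‖AA v M L τ * (SS M (X0+1) (s + τ * I) - 1)‖^2) MeasureTheory.volume (T:ℝ) (2*T) :=
    ((hAc.continuousOn.mul lc2).norm.pow 2).intervalIntegrable
  have i3 : IntervalIntegrable (fun τ : ℝ => ‖AA v M L τ‖^2 * ‖GG M (s + τ * I) - 1‖^2) MeasureTheory.volume (T:ℝ) (2*T) :=
    ((hAc.continuousOn.norm.pow 2).mul (lc3.norm.pow 2)).intervalIntegrable
  have b1 := h1 T (by omega) s a1 a2 a3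
  have b2 := hC v hv T (by linarith) s a1
  have hCT : 2 * C ≤ κ * (T * B) := by
    have : 2 * C / κ ≤ T := hT2.trans (by exact_mod_cast (by omega : T2 ≤ T))
    rw [div_le_iff₀ hκ0] at this
    have h3 : (T:ℝ) ≤ T * B := le_mul_of_one_le_right (by linarith) hB1
    nlinarith
  calc _ ≤ ∫ τ in (T:ℝ)..(2*T), (2 * (B^2 * ‖GG M (s + τ * I) - SS M (X0+1) (s + τ * I)‖^2) +
            2 * ‖AA v M L τ * (SS M (X0+1) (s + τ * I) - 1)‖^2) := by
        refine intervalIntegral.integral_mono_on (by linarith) i3 ((i1.const_mul 2).add (i2.const_mul 2)) fun τ hτ => ?_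
        rw [← mul_pow, ← norm_mul]
        have : AA v M L τ * (GG M (s + τ * I) - 1) = AA v M L τ * (GG M (s + τ * I) - SS M (X0+1) (s + τ * I)) +
          AA v M L τ * (SS M (X0+1) (s + τ * I) - 1) := by ring
        rw [this]
        refine (norm_sq_two _ _).trans (add_le_add_left ?_ _)
        rw [norm_mul, mul_pow]
        refine mul_le_mul_of_nonneg_left (mul_le_mul_of_nonneg_right ?_ (by positivity)) (by norm_num)
        exact pow_le_pow_left₀ (norm_nonneg _) (AA_norm hv M hM L τ) 2
    _ = 2 * (B^2 * ∫ τ in (T:ℝ)..(2*T), ‖GG M (s + τ * I) - SS M (X0+1) (s + τ * I)‖^2) +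
          2 * ∫ τ in (T:ℝ)..(2*T), ‖AA v M L τ * (SS M (X0+1) (s + τ * I) - 1)‖^2 := by
        rw [intervalIntegral.integral_add (i1.const_mul 2) (i2.const_mul 2), intervalIntegral.integral_const_mul,
          intervalIntegral.integral_const_mul, intervalIntegral.integral_const_mul]
    _ ≤ 2 * (B^2 * (κ / (2 * B) * T)) + 2 * (T * B * κ + C) := by
        refine add_le_add (mul_le_mul_of_nonneg_left (mul_le_mul_of_nonneg_left b1 (by positivity)) (by norm_num)) ?_
        linarith
    _ = 3 * κ * (T * B) + 2 * C := by field_simp; ring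
    _ ≤ _ := by linarith

/-- the point on the circle -/
noncomputable def cp (c R θ : ℝ) : ℂ := c + R * exp (θ * I)

lemma cp_re (c R θ : ℝ) : (cp c R θ).re = c + R * Real.cos θ := by
  simp [cp, Complex.exp_ofReal_mul_I_re]
lemma cp_im (c R θ : ℝ) : (cp c R θ).im = R * Real.sin θ := by
  simp [cp, Complex.exp_ofReal_mul_I_im]

lemma tau_exists {σ : ℝ} (hσ : 1/2 < σ) (hσ1 : σ < 1) (M : Finset ℕ) (hM : ∀ p ∈ M, p.Prime) (y0 : ℕ) {J0 : ℝ}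
    (hJ0 : 0 < J0)
    (hκ : ∀ F : Finset ℕ, (∀ n ∈ F, y0 < n) → ∑ n ∈ F, (n:ℝ)^(-(2*σ)) < J0 / (32 * Real.pi))
    (hMy : ∀ p : ℕ, p.Prime → p ≤ y0 → p ∈ M) {v : ℕ → ℂ} (hv : ∀ p, ‖v p‖ = 1) {η : ℝ} (hη : 0 < η)
    {c R : ℝ} (hR0 : 0 ≤ R) (hR1 : R ≤ 1) (hcR : σ ≤ c - R) (hcR' : c + R ≤ 1) (T1 : ℝ) :
    ∃ τ : ℝ, T1 ≤ τ ∧ 2 ≤ τ ∧ (∀ p ∈ M, ‖bet v p τ - 1‖ < η) ∧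
      ∫ θ in (0:ℝ)..(2*Real.pi), ‖GG M (cp c R θ + τ * I) - 1‖^2 < J0 := by
  have hpi := Real.pi_pos
  obtain ⟨L, hL⟩ := exists_nat_gt (20 * M.card / η^2)
  have hLr0 : (0:ℝ) < L := lt_of_le_of_lt (by positivity) hL
  have hL1 : 1 ≤ L := by exact_mod_cast hLr0
  set B := (L:ℝ)^M.card with hB
  have hB1 : 1 ≤ B := one_le_pow₀ (by exact_mod_cast hL1)
  obtain ⟨T2, hT2, hG⟩ := AG_ms hσ hσ1 M hM L y0 hL1 (by positivity) hκ hMy hv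
  obtain ⟨C, hC0, hC⟩ := AA_ms M hM L
  have hCp : ∀ p : ℕ, ∃ Cp : ℝ, 0 ≤ Cp ∧ (p ∈ M → ∀ T : ℝ, |(∫ τ in T..(2*T), ‖AA v (M.erase p) L τ‖^2) - T * (L:ℝ)^(M.erase p).card| ≤ Cp) := by
    intro p
    obtain ⟨Cp, h0, h⟩ := AA_ms (M.erase p) (fun q hq => hM q (Finset.mem_of_mem_erase hq)) L
    exact ⟨Cp, h0, fun _ T => h v hv T⟩
  choose Cp hCp0 hCp using hCp
  obtain ⟨T3, hT3⟩ := exists_nat_gt (|T1| + 10 * C + ∑ p ∈ M, 4 * Cp p * L)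
  set T := T2 + T3 with hT
  have hT2' : 2 ≤ T := by omega
  have hTr : (2:ℝ) ≤ T := by exact_mod_cast hT2'
  have hT3T : (T3:ℝ) ≤ T := by exact_mod_cast (by omega : T3 ≤ T)
  by_contra hcon
  push Not at hcon
  -- the integrand
  have hAc := AA_cont v M hM L
  set H : ℝ → ℝ → ℝ := fun τ θ => ‖GG M (cp c R θ + (max τ 2 : ℝ) * I) - 1‖^2 with hH
  have hHc : Continuous (Function.uncurry H) := by
    have h1 : Continuous fun x : ℝ × ℝ => GG M (cp c R x.2 + (max x.1 2 : ℝ) * I) := by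
      refine (GG_cont M).comp_continuous (by unfold cp; fun_prop) fun x => ?_
      simp only [UH, Set.mem_ofPred_eq, add_im, cp_im, mul_im, ofReal_re, I_im, ofReal_im, I_re]
      have h2 : -1 ≤ R * Real.sin x.2 := by nlinarith [Real.neg_one_le_sin x.2]
      have h3 : (2:ℝ) ≤ max x.1 2 := le_max_right _ _
      linarith
    exact (h1.sub continuous_const).norm.pow 2
  set Jt : ℝ → ℝ := fun τ => ∫ θ in (0:ℝ)..(2*Real.pi), H τ θ with hJt
  have hJc : Continuous Jt := intervalIntegral.continuous_parametric_intervalIntegral_of_continuous' hHc _ _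
  have hHeq : ∀ τ θ : ℝ, 2 ≤ τ → H τ θ = ‖GG M (cp c R θ + τ * I) - 1‖^2 := by
    intro τ θ hτ; simp only [hH, max_eq_left hτ]
  have hW0 : ∀ τ, 0 ≤ ‖AA v M L τ‖^2 := fun τ => by positivity
  have hJ0' : ∀ τ, 0 ≤ Jt τ := fun τ => intervalIntegral.integral_nonneg (by positivity) fun θ _ => by simp only [hH]; positivity
  -- pointwise
  have hpt : ∀ τ ∈ Icc (T:ℝ) (2*T), ‖AA v M L τ‖^2 ≤
      (∑ p ∈ M, 1/η^2 * (‖AA v M L τ‖^2 * ‖bet v p τ - 1‖^2)) + 1/J0 * (‖AA v M L τ‖^2 * Jt τ) := by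
    intro τ hτ
    have hτ2 : 2 ≤ τ := hTr.trans hτ.1
    have hT1τ : T1 ≤ τ := by
      have : 0 ≤ ∑ p ∈ M, 4 * Cp p * L := Finset.sum_nonneg fun p _ => by have := hCp0 p; positivity
      linarith [hτ.1, le_abs_self T1]
    have hsum0 : ∀ p ∈ M, 0 ≤ 1/η^2 * (‖AA v M L τ‖^2 * ‖bet v p τ - 1‖^2) := fun p _ => by positivity
    by_cases hcase : ∀ p ∈ M, ‖bet v p τ - 1‖ < η
    · have h1 := hcon τ hT1τ hτ2 hcase
      have h2 : J0 ≤ Jt τ := by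
        simp only [hJt]
        simp_rw [hHeq τ _ hτ2]; exact h1
      have h3 : ‖AA v M L τ‖^2 ≤ 1/J0 * (‖AA v M L τ‖^2 * Jt τ) := by
        rw [one_div, ← div_eq_inv_mul, le_div_iff₀ hJ0]
        exact mul_le_mul_of_nonneg_left h2 (hW0 τ)
      linarith [Finset.sum_nonneg hsum0]
    · push Not at hcase
      obtain ⟨p, hp, hpη⟩ := hcase
      have h4 : ‖AA v M L τ‖^2 ≤ 1/η^2 * (‖AA v M L τ‖^2 * ‖bet v p τ - 1‖^2) := by
        rw [one_div, ← div_eq_inv_mul, le_div_iff₀ (by positivity)]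
        exact mul_le_mul_of_nonneg_left (pow_le_pow_left₀ hη.le hpη 2) (hW0 τ)
      have h5 := Finset.single_le_sum hsum0 hp
      have h6 : 0 ≤ 1/J0 * (‖AA v M L τ‖^2 * Jt τ) := mul_nonneg (by positivity) (mul_nonneg (hW0 τ) (hJ0' τ))
      linarith
  have hle : (T:ℝ) ≤ 2 * T := by linarith
  have hbc : ∀ p ∈ M, Continuous (bet v p) := fun p hp => bet_cont v (hM p hp).one_le
  have hWc : Continuous fun τ => ‖AA v M L τ‖^2 := hAc.norm.pow 2
  have hWpc : ∀ p ∈ M, Continuous fun τ => 1/η^2 * (‖AA v M L τ‖^2 * ‖bet v p τ - 1‖^2) :=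
    fun p hp => continuous_const.mul (hWc.mul (((hbc p hp).sub continuous_const).norm.pow 2))
  have hWJc : Continuous fun τ => 1/J0 * (‖AA v M L τ‖^2 * Jt τ) := continuous_const.mul (hWc.mul hJc)
  have hintg := intervalIntegral.integral_mono_on (μ := MeasureTheory.volume) hle (hWc.intervalIntegrable _ _)
    (((continuous_finsetSum M hWpc).add hWJc).intervalIntegrable _ _) hpt
  simp only [Pi.add_apply] at hintg
  rw [intervalIntegral.integral_add ((continuous_finsetSum M hWpc).intervalIntegrable _ _) (hWJc.intervalIntegrable _ _),
    intervalIntegral.integral_finsetSum (fun p hp => (hWpc p hp).intervalIntegrable _ _),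
    intervalIntegral.integral_const_mul] at hintg
  -- first part
  have q1 : (9/10) * (T * B) ≤ ∫ τ in (T:ℝ)..(2*T), ‖AA v M L τ‖^2 := by
    have h1 := (abs_le.1 (hC v hv T)).1
    have h2 : 10 * C ≤ T := by
      have h3 : 0 ≤ ∑ p ∈ M, 4 * Cp p * L := Finset.sum_nonneg fun p _ => by have := hCp0 p; positivity
      linarith [abs_nonneg T1]
    have h3 : (T:ℝ) ≤ T * B := le_mul_of_one_le_right (by linarith) hB1
    linarith
  have q2 : ∀ p ∈ M, ∫ τ in (T:ℝ)..(2*T), 1/η^2 * (‖AA v M L τ‖^2 * ‖bet v p τ - 1‖^2) ≤ 1/η^2 * (5 * (T * B) / L) := by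
    intro p hp
    rw [intervalIntegral.integral_const_mul]
    refine mul_le_mul_of_nonneg_left ?_ (by positivity)
    have hEc := AA_cont v (M.erase p) (fun q hq => hM q (Finset.mem_of_mem_erase hq)) L
    have h1 : ∫ τ in (T:ℝ)..(2*T), (‖AA v M L τ‖^2 * ‖bet v p τ - 1‖^2) ≤ ∫ τ in (T:ℝ)..(2*T), 4 * ‖AA v (M.erase p) L τ‖^2 := by
      refine intervalIntegral.integral_mono_on hle ?_ ?_ fun τ _ => AA_erase hv M hM L hp τ
      · exact (hWc.mul (((hbc p hp).sub continuous_const).norm.pow 2)).intervalIntegrable _ _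
      · exact (continuous_const.mul (hEc.norm.pow 2)).intervalIntegrable _ _
    rw [intervalIntegral.integral_const_mul] at h1
    have h2 := (abs_le.1 (hCp p hp T)).2
    have h3 : (L:ℝ)^(M.erase p).card * L = B := by
      rw [← pow_succ, Finset.card_erase_add_one hp]
    have h4 : (L:ℝ)^(M.erase p).card = B / L := by rw [← h3]; field_simp
    have h5 : 4 * Cp p * L ≤ T * B := by
      have g1 := Finset.single_le_sum (f := fun p => 4 * Cp p * L) (fun p _ => by have := hCp0 p; positivity) hp
      have g2 : (T:ℝ) ≤ T * B := le_mul_of_one_le_right (by linarith) hB1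
      linarith [abs_nonneg T1]
    rw [h4] at h2
    have h6 : 4 * Cp p ≤ T * B / L := by rw [le_div_iff₀ hLr0]; exact h5
    have h7 : 5 * (T * B) / L = 4 * (T * (B / L)) + T * B / L := by ring
    rw [h7]; linarith
  have q3 : ∫ τ in (T:ℝ)..(2*T), (‖AA v M L τ‖^2 * Jt τ) ≤ J0 / 4 * (T * B) := by
    have hFc : Continuous (Function.uncurry fun τ θ : ℝ => ‖AA v M L τ‖^2 * H τ θ) :=
      (hWc.comp continuous_fst).mul hHc
    have h1 : ∀ τ, ‖AA v M L τ‖^2 * Jt τ = ∫ θ in (0:ℝ)..(2*Real.pi), ‖AA v M L τ‖^2 * H τ θ := by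
      intro τ; rw [intervalIntegral.integral_const_mul]
    simp_rw [h1]
    rw [MeasureTheory.intervalIntegral_intervalIntegral_swap]
    · have h2 : ∀ θ ∈ uIoc (0:ℝ) (2*Real.pi), ‖∫ τ in (T:ℝ)..(2*T), ‖AA v M L τ‖^2 * H τ θ‖ ≤ 4 * (J0 / (32 * Real.pi)) * (T * B) := by
        intro θ _
        have h3 : ∫ τ in (T:ℝ)..(2*T), ‖AA v M L τ‖^2 * H τ θ = ∫ τ in (T:ℝ)..(2*T), ‖AA v M L τ‖^2 * ‖GG M (cp c R θ + τ * I) - 1‖^2 := by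
          refine intervalIntegral.integral_congr fun τ hτ => ?_
          rw [uIcc_of_le hle] at hτ
          rw [hHeq τ θ (hTr.trans hτ.1)]
        have c1 := Real.neg_one_le_cos θ
        have c2 := Real.cos_le_one θ
        rw [Real.norm_of_nonneg (intervalIntegral.integral_nonneg hle fun τ _ => by simp only [hH]; positivity), h3]
        refine hG T (by omega) _ ?_ ?_ ?_
        · rw [cp_re]; nlinarith
        · rw [cp_re]; nlinarith
        · rw [cp_im, abs_mul, abs_of_nonneg hR0]
          exact mul_le_one₀ hR1 (abs_nonneg _) (Real.abs_sin_le_one θ)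
      have h4 := intervalIntegral.norm_integral_le_of_norm_le_const h2
      refine (le_abs_self _).trans (h4.trans (le_of_eq ?_))
      rw [sub_zero, abs_of_pos (by positivity)]
      field_simp; ring
    · refine (hFc.continuousOn.integrableOn_compact ((isCompact_uIcc (a := (T:ℝ)) (b := 2*T)).prod (isCompact_uIcc (a := (0:ℝ)) (b := 2*Real.pi)))).mono_set ?_
      exact Set.prod_mono uIoc_subset_uIcc uIoc_subset_uIcc
  have q2' := Finset.sum_le_sum q2
  rw [Finset.sum_const, nsmul_eq_mul] at q2'
  have hTB : 0 < T * B := by positivity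
  have q4 : (M.card:ℝ) * (1/η^2 * (5 * (T * B) / L)) ≤ 1/4 * (T * B) := by
    rw [div_lt_iff₀ (by positivity)] at hL
    have : (M.card:ℝ) * (1/η^2 * (5 * (T * B) / L)) = (20 * M.card) / (L * η^2) * (1/4 * (T * B)) := by field_simp; ring
    rw [this]
    refine mul_le_of_le_one_left (by positivity) ?_
    rw [div_le_one (by positivity)]; exact hL.le
  have q5 : 1/J0 * ∫ τ in (T:ℝ)..(2*T), (‖AA v M L τ‖^2 * Jt τ) ≤ 1/4 * (T * B) := by
    calc _ ≤ 1/J0 * (J0 / 4 * (T * B)) := mul_le_mul_of_nonneg_left q3 (by positivity)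
      _ = _ := by field_simp
  linarith

end Vor

namespace Vor

lemma cauchy_sq {f : ℂ → ℂ} {c R l : ℝ} (hl : 0 ≤ l) (hlR : l < R) (hf : DiffContOnCl ℂ f (ball (c:ℂ) R)) {w : ℂ}
    (hw : ‖w - c‖ ≤ l) : ‖f w‖^2 ≤ R / (2 * Real.pi * (R - l)) * ∫ θ in (0:ℝ)..(2*Real.pi), ‖f (cp c R θ)‖^2 := by
  have hpi := Real.pi_pos
  have hR : 0 < R := hl.trans_lt hlR
  have hd : 0 < R - l := by linarith
  have hf2 : DiffContOnCl ℂ (fun z => f z * f z) (ball (c:ℂ) R) := by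
    simpa using hf.smul hf
  have hwb : w ∈ ball (c:ℂ) R := by rw [mem_ball, dist_eq_norm]; linarith
  have h1 := hf2.two_pi_i_inv_smul_circleIntegral_sub_inv_smul hwb
  have hcp : ∀ θ, circleMap (c:ℂ) R θ = cp c R θ := fun θ => by simp [circleMap, cp]
  have hc2 : Continuous fun θ => ‖f (cp c R θ)‖^2 := by
    refine Continuous.pow (Continuous.norm ?_) 2
    refine hf.continuousOn.comp_continuous (by unfold cp; fun_prop) fun θ => ?_
    rw [← hcp, closure_ball _ hR.ne']
    exact circleMap_mem_closedBall _ hR.le θ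
  have h2 : ‖∮ z in C((c:ℂ), R), (z - w)⁻¹ • (f z * f z)‖ ≤ R / (R - l) * ∫ θ in (0:ℝ)..(2*Real.pi), ‖f (cp c R θ)‖^2 := by
    rw [circleIntegral, ← intervalIntegral.integral_const_mul]
    refine intervalIntegral.norm_integral_le_of_norm_le (by positivity) ?_ ((continuous_const.mul hc2).intervalIntegrable _ _)
    refine Filter.Eventually.of_forall fun θ _ => ?_
    rw [hcp, norm_smul, norm_smul, norm_mul, deriv_circleMap, norm_inv]
    have e1 : ‖circleMap 0 R θ * I‖ = R := by simp [abs_of_pos hR]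
    rw [e1]
    have e2 : R - l ≤ ‖cp c R θ - w‖ := by
      have : ‖cp c R θ - c‖ = R := by
        rw [← hcp]; simp [circleMap, abs_of_pos hR]
      have h3 : cp c R θ - c = (cp c R θ - w) + (w - c) := by ring
      have h4 := norm_add_le (cp c R θ - w) (w - c)
      rw [← h3, this] at h4; linarith
    rw [div_eq_mul_inv, mul_assoc, pow_two]
    gcongr
  have h5 : ‖f w‖^2 = ‖(2 * Real.pi * I : ℂ)⁻¹ • ∮ z in C((c:ℂ), R), (z - w)⁻¹ • (f z * f z)‖ := by
    rw [h1, norm_mul, pow_two]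
  rw [h5, norm_smul]
  have e3 : ‖(2 * Real.pi * I : ℂ)⁻¹‖ = (2 * Real.pi)⁻¹ := by
    simp [abs_of_pos hpi]
  rw [e3]
  calc _ ≤ (2 * Real.pi)⁻¹ * (R / (R - l) * ∫ θ in (0:ℝ)..(2*Real.pi), ‖f (cp c R θ)‖^2) :=
        mul_le_mul_of_nonneg_left h2 (by positivity)
    _ = _ := by field_simp

lemma prod_diff (M : Finset ℕ) (a b : ℕ → ℂ) {K d : ℝ} (hK : 1 ≤ K) (hd : 0 ≤ d) (ha : ∀ p ∈ M, ‖a p‖ ≤ K) (hb : ∀ p ∈ M, ‖b p‖ ≤ K)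
    (hab : ∀ p ∈ M, ‖a p - b p‖ ≤ d) : ‖∏ p ∈ M, a p - ∏ p ∈ M, b p‖ ≤ K^M.card * (M.card * d) := by
  induction M using Finset.induction_on with
  | empty => simp
  | insert q S hq ih =>
    have ih' := ih (fun p hp => ha p (Finset.mem_insert_of_mem hp)) (fun p hp => hb p (Finset.mem_insert_of_mem hp))
      (fun p hp => hab p (Finset.mem_insert_of_mem hp))
    rw [Finset.prod_insert hq, Finset.prod_insert hq, Finset.card_insert_of_notMem hq]
    have e : a q * ∏ p ∈ S, a p - b q * ∏ p ∈ S, b p = a q * (∏ p ∈ S, a p - ∏ p ∈ S, b p) + (a q - b q) * ∏ p ∈ S, b p := by ring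
    have h1 : ‖∏ p ∈ S, b p‖ ≤ K^S.card := by
      rw [norm_prod]
      refine (Finset.prod_le_prod (fun p _ => norm_nonneg _) (fun p hp => hb p (Finset.mem_insert_of_mem hp))).trans (le_of_eq ?_)
      rw [Finset.prod_const]
    have hq1 := ha q (Finset.mem_insert_self _ _)
    have hq2 := hab q (Finset.mem_insert_self _ _)
    have hK0 : 0 ≤ K := by linarith
    have hKS : 0 ≤ K^S.card := by positivity
    calc _ ≤ ‖a q‖ * ‖∏ p ∈ S, a p - ∏ p ∈ S, b p‖ + ‖a q - b q‖ * ‖∏ p ∈ S, b p‖ := by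
          rw [e, ← norm_mul, ← norm_mul]; exact norm_add_le _ _
      _ ≤ K * (K^S.card * (S.card * d)) + d * K^S.card := by gcongr
      _ ≤ K * (K^S.card * (S.card * d)) + K * (d * K^S.card) := by
          have := le_mul_of_one_le_left (mul_nonneg hd hKS) hK
          linarith
      _ = _ := by push_cast; ring

lemma factor_bound {a : ℂ} (ha : ‖a‖ ≤ 3/4) : ‖(1 - a)⁻¹‖ ≤ 4 ∧ 1 - a ≠ 0 := by
  have h1 : 1/4 ≤ ‖1 - a‖ := by
    have := norm_sub_norm_le (1:ℂ) a
    rw [norm_one] at this; linarith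
  refine ⟨?_, fun h => by rw [h, norm_zero] at h1; linarith⟩
  rw [norm_inv]
  exact inv_le_of_inv_le₀ (by norm_num) (by norm_num; linarith)

lemma factor_diff {a b : ℂ} (ha : ‖a‖ ≤ 3/4) (hb : ‖b‖ ≤ 3/4) : ‖(1 - a)⁻¹ - (1 - b)⁻¹‖ ≤ 16 * ‖a - b‖ := by
  obtain ⟨h1, h1'⟩ := factor_bound ha
  obtain ⟨h2, h2'⟩ := factor_bound hb
  have e : (1 - a)⁻¹ - (1 - b)⁻¹ = (1 - a)⁻¹ * (1 - b)⁻¹ * (a - b) := by field_simp; ring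
  rw [e, norm_mul, norm_mul]
  have : ‖(1 - a)⁻¹‖ * ‖(1 - b)⁻¹‖ ≤ 4 * 4 := mul_le_mul h1 h2 (norm_nonneg _) (by norm_num)
  nlinarith [norm_nonneg (a - b)]

lemma pcpow_le {p : ℕ} (hp : p.Prime) {s : ℂ} (hs : 1/2 ≤ s.re) : ‖(p:ℂ)^(-s)‖ ≤ 3/4 := by
  rw [norm_prime_cpow hp.one_le]
  have h2 : (2:ℝ) ≤ p := by exact_mod_cast hp.two_le
  have h1 : (p:ℝ)^(-s.re) ≤ (2:ℝ)^(-(1/2):ℝ) :=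
    (Real.rpow_le_rpow_of_exponent_le (by linarith) (by linarith : -s.re ≤ -(1/2))).trans
      (Real.rpow_le_rpow_of_nonpos (by norm_num) h2 (by norm_num))
  refine h1.trans ?_
  have h3 : ((2:ℝ)^(-(1/2):ℝ))^2 = 1/2 := by
    rw [← Real.rpow_natCast, ← Real.rpow_mul (by norm_num)]; norm_num
  nlinarith [Real.rpow_nonneg (by norm_num : (0:ℝ) ≤ 2) (-(1/2))]

lemma GG_diff (M : Finset ℕ) (hM : ∀ p ∈ M, p.Prime) : DifferentiableOn ℂ (GG M) {w | w ≠ 1} := by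
  intro w hw
  refine DifferentiableAt.differentiableWithinAt ?_
  unfold GG
  refine (differentiableAt_riemannZeta hw).mul ?_
  refine DifferentiableAt.fun_finsetProd fun p hp => ?_
  have : (p:ℂ) ≠ 0 := by exact_mod_cast (hM p hp).ne_zero
  exact (differentiableAt_const _).sub (differentiableAt_id.neg.const_cpow (Or.inl this))

lemma voronin {ε l : ℝ} (hl : 0 < l) (hle : l < ε) (hε : ε < 1/4) {h : ℂ → ℂ} {ρ : ℝ} (hρ : 1 < ρ)
    (hh : DifferentiableOn ℂ h (ball 0 ρ)) {δ : ℝ} (hδ : 0 < δ) (T1 : ℝ) :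
    ∃ τ : ℝ, T1 ≤ τ ∧ ∀ z : ℂ, ‖z‖ ≤ 1 → ‖riemannZeta (1/2 + ε + l * z + τ * I) - exp (h z)‖ < δ := by
  have hpi := Real.pi_pos
  have hcont : ContinuousOn (fun z => exp (h z)) (closedBall 0 1) :=
    continuous_exp.comp_continuousOn (hh.continuousOn.mono (closedBall_subset_ball hρ))
  obtain ⟨B, hB⟩ := (isCompact_closedBall (0:ℂ) 1).exists_bound_of_continuousOn hcont
  have hB' : ∀ z : ℂ, ‖z‖ ≤ 1 → ‖exp (h z)‖ ≤ B := fun z hz => hB z (by simpa using hz)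
  have hB0 : 0 ≤ B := (norm_nonneg _).trans (hB' 0 (by simp))
  set R := (l + ε) / 2 with hR
  set c := 1/2 + ε with hc
  have hlR : l < R := by rw [hR]; linarith
  have hRε : R < ε := by rw [hR]; linarith
  have hR0 : 0 < R := hl.trans hlR
  set σ := c - R with hσdef
  have hσ : 1/2 < σ := by rw [hσdef, hc]; linarith
  have hσ1 : σ < 1 := by rw [hσdef, hc]; linarith
  set δ' := min δ 1 with hδ'
  have hδ'0 : 0 < δ' := lt_min hδ one_pos
  have hδ'1 : δ' ≤ 1 := min_le_right _ _
  have hδ'd : δ' ≤ δ := min_le_left _ _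
  set ξ := δ' / (4 * (B + 1)) with hξ
  have hξ0 : 0 < ξ := by positivity
  have hRl : 0 < R - l := by linarith
  set Kc := R / (2 * Real.pi * (R - l)) with hKc
  have hKc0 : 0 < Kc := by positivity
  set J0 := ξ^2 / Kc with hJ0
  have hJ00 : 0 < J0 := by positivity
  obtain ⟨y0, hy0⟩ := tail_small (a := 2 * σ) (δ := J0 / (32 * Real.pi)) (by linarith) (by positivity)
  obtain ⟨M, hM, hMy, w, hw, hP⟩ := euler_approx hl hle hε hρ hh (δ := δ'/3) (by positivity) y0
  set v : ℕ → ℂ := fun p => (starRingEnd ℂ) (w p) with hv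
  have hv1 : ∀ p, ‖v p‖ = 1 := fun p => by simp [hv, hw p]
  set η := δ' / (3 * (4^M.card * (M.card + 1) * 16)) with hη
  have hη0 : 0 < η := by positivity
  obtain ⟨τ, hτ1, hτ2, hbet, hintg⟩ := tau_exists hσ hσ1 M hM y0 hJ00 hy0 hMy hv1 hη0 hR0.le (c := c) (R := R) (by linarith)
    (by rw [hσdef]) (by rw [hc]; linarith) T1
  refine ⟨τ, hτ1, fun z hz => ?_⟩
  set s : ℂ := 1/2 + ε + l * z with hs
  have hlz : ‖(l:ℂ) * z‖ ≤ l := by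
    rw [norm_mul, norm_real, Real.norm_of_nonneg hl.le]
    exact mul_le_of_le_one_right hl.le hz
  have hsc : ‖s - (c:ℂ)‖ ≤ l := by
    have : s - (c:ℂ) = l * z := by rw [hs, hc]; push_cast; ring
    rw [this]; exact hlz
  have hsre : 1/2 ≤ s.re := by
    have h1 := (abs_re_le_norm (s - (c:ℂ))).trans hsc
    rw [sub_re, ofReal_re] at h1
    have := (abs_le.1 h1).1
    rw [hc] at this; linarith
  have hsre' : 1/2 ≤ (s + τ * I).re := by simpa using hsre
  -- GG close to 1
  have hDC : DiffContOnCl ℂ (fun u => GG M (u + τ * I) - 1) (ball (c:ℂ) R) := by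
    refine DifferentiableOn.diffContOnCl_ball (U := closedBall (c:ℂ) R) ?_ subset_rfl
    refine DifferentiableOn.sub_const ?_ _
    refine (GG_diff M hM).comp (by fun_prop) fun u hu => ?_
    simp only [Set.mem_ofPred_eq]
    intro h1
    have h2 : u.im + τ = 0 := by have := congrArg Complex.im h1; simpa using this
    rw [mem_closedBall, dist_eq_norm] at hu
    have h3 := (abs_im_le_norm (u - (c:ℂ))).trans hu
    rw [sub_im, ofReal_im, sub_zero] at h3
    have := (abs_le.1 h3).1
    linarith
  have hGG : ‖GG M (s + τ * I) - 1‖ < ξ := by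
    have h1 := cauchy_sq hl.le hlR hDC hsc
    have h2 : Kc * (∫ θ in (0:ℝ)..(2*Real.pi), ‖GG M (cp c R θ + τ * I) - 1‖^2) < ξ^2 := by
      calc _ < Kc * J0 := mul_lt_mul_of_pos_left hintg hKc0
        _ = ξ^2 := by rw [hJ0]; field_simp
    exact lt_of_pow_lt_pow_left₀ 2 hξ0.le (h1.trans_lt h2)
  set Pt : ℂ := ∏ p ∈ M, (1 - (p:ℂ)^(-(s + τ * I)))⁻¹ with hPt
  set Pw : ℂ := ∏ p ∈ M, (1 - w p * (p:ℂ)^(-s))⁻¹ with hPw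
  have hPw1 : ‖exp (h z) - Pw‖ < δ'/3 := hP z hz
  have hwb : ∀ p ∈ M, ‖w p * (p:ℂ)^(-s)‖ ≤ 3/4 := fun p hp => by
    rw [norm_mul, hw, one_mul]; exact pcpow_le (hM p hp) hsre
  have hdiff : ‖Pt - Pw‖ ≤ δ'/3 := by
    have h1 := prod_diff M (fun p => (1 - (p:ℂ)^(-(s + τ * I)))⁻¹) (fun p => (1 - w p * (p:ℂ)^(-s))⁻¹) (K := 4) (d := 16 * η)
      (by norm_num) (by positivity) (fun p hp => (factor_bound (pcpow_le (hM p hp) hsre')).1) (fun p hp => (factor_bound (hwb p hp)).1)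
      (fun p hp => by
        refine (factor_diff (pcpow_le (hM p hp) hsre') (hwb p hp)).trans (mul_le_mul_of_nonneg_left ?_ (by norm_num))
        have h2 := (hbet p hp).le
        have h3 : bet v p τ - 1 = v p * ((p:ℂ)^(-(τ * I)) - w p) := by
          rw [bet, chi_prime v (hM p hp), mul_sub]
          congr 1
          simp only [hv]
          rw [mul_comm, mul_conj, normSq_eq_norm_sq, hw]; simp
        rw [h3, norm_mul, hv1, one_mul] at h2
        rw [cpow_split (hM p hp).one_le, mul_comm (w p), ← mul_sub, norm_mul]
        have h4 := pcpow_le (hM p hp) hsre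
        nlinarith [norm_nonneg ((p:ℂ)^(-(τ * I)) - w p)])
    refine h1.trans ?_
    have h5 : δ'/3 = 4^M.card * ((M.card + 1) * (16 * η)) := by rw [hη]; field_simp
    rw [h5]
    gcongr
    linarith
  have hPtB : ‖Pt‖ ≤ B + 1 := by
    have e : Pt = (Pt - Pw) - (exp (h z) - Pw) + exp (h z) := by ring
    rw [e]
    have h1 := norm_add_le ((Pt - Pw) - (exp (h z) - Pw)) (exp (h z))
    have h2 := norm_sub_le (Pt - Pw) (exp (h z) - Pw)
    linarith [hB' z hz]
  have hz1 : riemannZeta (s + τ * I) = GG M (s + τ * I) * Pt := by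
    rw [GG, hPt, mul_assoc, ← Finset.prod_mul_distrib, Finset.prod_eq_one, mul_one]
    intro p hp
    exact mul_inv_cancel₀ (factor_bound (pcpow_le (hM p hp) hsre')).2
  rw [hz1]
  have e : GG M (s + τ * I) * Pt - exp (h z) = (GG M (s + τ * I) - 1) * Pt + ((Pt - Pw) - (exp (h z) - Pw)) := by ring
  rw [e]
  have h1 := norm_add_le ((GG M (s + τ * I) - 1) * Pt) ((Pt - Pw) - (exp (h z) - Pw))
  have h2 := norm_sub_le (Pt - Pw) (exp (h z) - Pw)
  have h3 : ‖(GG M (s + τ * I) - 1) * Pt‖ ≤ ξ * (B + 1) := by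
    rw [norm_mul]; exact mul_le_mul hGG.le hPtB (norm_nonneg _) hξ0.le
  have h4 : ξ * (B + 1) = δ'/4 := by rw [hξ]; field_simp
  linarith

end Vor

namespace Vor

lemma exists_log {f : ℂ → ℂ} {ρ : ℝ} (hρ : 0 < ρ) (hf : DifferentiableOn ℂ f (ball 0 ρ)) (hf0 : ∀ z ∈ ball (0:ℂ) ρ, f z ≠ 0) :
    ∃ h : ℂ → ℂ, DifferentiableOn ℂ h (ball 0 ρ) ∧ ∀ z ∈ ball (0:ℂ) ρ, f z = exp (h z) := by
  have hd : DifferentiableOn ℂ (fun z => deriv f z / f z) (ball 0 ρ) := (hf.deriv isOpen_ball).div hf hf0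
  obtain ⟨H, hH0, hH⟩ := hd.isExactOn_ball.with_val_at 0 (Complex.log (f 0))
  refine ⟨H, fun z hz => (hH z hz).differentiableAt.differentiableWithinAt, ?_⟩
  have hq : ∀ z ∈ ball (0:ℂ) ρ, HasDerivAt (fun z => f z * exp (-H z)) 0 z := by
    intro z hz
    have h1 := (hf.differentiableAt (isOpen_ball.mem_nhds hz)).hasDerivAt
    have h2 := h1.mul (hH z hz).neg.cexp
    refine h2.congr_deriv ?_
    have := hf0 z hz
    simp only [Pi.neg_apply]
    field_simp
    ring
  have h0 : (0:ℂ) ∈ ball (0:ℂ) ρ := mem_ball_self hρ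
  intro z hz
  have h3 : f z * exp (-H z) = f 0 * exp (-H 0) :=
    isOpen_ball.is_const_of_deriv_eq_zero (convex_ball (0:ℂ) ρ).isPreconnected
      (fun u hu => (hq u hu).differentiableAt.differentiableWithinAt) (fun u hu => (hq u hu).deriv) hz h0
  rw [hH0, exp_neg, exp_neg, exp_log (hf0 0 h0), mul_inv_cancel₀ (hf0 0 h0)] at h3
  have := exp_ne_zero (H z)
  field_simp at h3
  exact h3

lemma approx_exp {g : ℂ → ℂ} (hg : ContinuousOn g (closedBall (0 : ℂ) 1)) (hg0 : ∀ z ∈ closedBall (0 : ℂ) 1, g z ≠ 0)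
    (hga : AnalyticOnNhd ℂ g (ball (0 : ℂ) 1)) {δ : ℝ} (hδ : 0 < δ) :
    ∃ (ρ : ℝ) (h : ℂ → ℂ), 1 < ρ ∧ DifferentiableOn ℂ h (ball 0 ρ) ∧ ∀ z ∈ closedBall (0:ℂ) 1, ‖exp (h z) - g z‖ < δ := by
  have huc := (isCompact_closedBall (0:ℂ) 1).uniformContinuousOn_of_continuous hg
  rw [Metric.uniformContinuousOn_iff] at huc
  obtain ⟨d, hd, hdg⟩ := huc δ hδ
  set t := min d 1 / 2 with ht
  have ht0 : 0 < t := by have := lt_min hd one_pos; positivity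
  have ht1 : t ≤ 1/2 := by have := min_le_right d 1; rw [ht]; linarith
  have htd : t < d := by have := min_le_left d 1; rw [ht]; linarith
  set r := 1 - t with hr
  have hr0 : 0 < r := by linarith
  have hr1 : r < 1 := by linarith
  have hmaps : MapsTo (fun z : ℂ => (r:ℂ) * z) (ball 0 r⁻¹) (ball 0 1) := by
    intro z hz
    simp only [mem_ball, dist_zero_right] at hz ⊢
    rw [norm_mul, norm_real, Real.norm_of_nonneg hr0.le]
    calc r * ‖z‖ < r * r⁻¹ := mul_lt_mul_of_pos_left hz hr0
      _ = 1 := mul_inv_cancel₀ hr0.ne'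
  have hρ : 1 < r⁻¹ := (one_lt_inv₀ hr0).2 hr1
  obtain ⟨h, hh, hhe⟩ := exists_log (f := fun z => g (r * z)) (by linarith : 0 < r⁻¹)
    (hga.differentiableOn.comp (by fun_prop) hmaps) (fun z hz => hg0 _ (ball_subset_closedBall (hmaps hz)))
  refine ⟨r⁻¹, h, hρ, hh, fun z hz => ?_⟩
  have hzb := closedBall_subset_ball hρ hz
  rw [← hhe z hzb, ← dist_eq_norm]
  refine hdg _ (ball_subset_closedBall (hmaps hzb)) _ hz ?_
  rw [dist_eq_norm]
  have e : (r:ℂ) * z - z = -((t:ℂ) * z) := by rw [hr]; push_cast; ring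
  rw [e, norm_neg, norm_mul, norm_real, Real.norm_of_nonneg ht0.le]
  rw [mem_closedBall, dist_zero_right] at hz
  nlinarith

end Vor

theorem stmt12
    (η : ℝ) (hη : η ∈ Set.Icc (0 : ℝ) (1 / 4))
    (eps lamb : ℕ → ℝ)
    (hlt : ∀ k, 0 < lamb k ∧ lamb k < eps k ∧ eps k < 1 / 4)
    (heps : Tendsto eps atTop (𝓝 η)) (hlamb : Tendsto lamb atTop (𝓝 η)) :
    ∃ τ : ℕ → ℝ, (∀ k, 1 ≤ τ k) ∧ Tendsto τ atTop atTop ∧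
      ∀ g : ℂ → ℂ, ContinuousOn g (Metric.closedBall (0 : ℂ) 1) →
        (∀ z ∈ Metric.closedBall (0 : ℂ) 1, g z ≠ 0) →
        AnalyticOnNhd ℂ g (Metric.ball (0 : ℂ) 1) →
        ∃ k : ℕ → ℕ, StrictMono k ∧
          TendstoUniformlyOn
            (fun (j : ℕ) (z : ℂ) => riemannZeta ((1 / 2 : ℂ) + (eps (k j) : ℝ) +
              (lamb (k j) : ℝ) * z + (τ (k j) : ℝ) * Complex.I))
            g atTop (Metric.closedBall (0 : ℂ) 1) := by
  let Gs : Set C(closedBall (0:ℂ) 1, ℂ) := {f | ∃ (ρ : ℝ) (h : ℂ → ℂ), 1 < ρ ∧ DifferentiableOn ℂ h (ball 0 ρ) ∧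
    ∀ z : closedBall (0:ℂ) 1, f z = exp (h z)}
  have : Nonempty Gs := ⟨⟨ContinuousMap.const _ 1, 2, fun _ => 0, by norm_num, by fun_prop, fun z => by simp⟩⟩
  obtain ⟨d, hd⟩ := TopologicalSpace.exists_dense_seq Gs
  have hex : ∀ k : ℕ, ∃ τ : ℝ, (k:ℝ) + 1 ≤ τ ∧ ∀ z : closedBall (0:ℂ) 1,
      ‖riemannZeta (1/2 + eps k + lamb k * (z:ℂ) + τ * I) - (d (Nat.unpair k).1 : C(closedBall (0:ℂ) 1, ℂ)) z‖ < 1 / ((k:ℝ) + 1) := by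
    intro k
    obtain ⟨ρ, h, hρ, hh, hf⟩ := (d (Nat.unpair k).1).2
    obtain ⟨h1, h2, h3⟩ := hlt k
    obtain ⟨τ, hτ, hz⟩ := Vor.voronin h1 h2 h3 hρ hh (δ := 1 / ((k:ℝ) + 1)) (by positivity) ((k:ℝ) + 1)
    refine ⟨τ, hτ, fun z => ?_⟩
    rw [hf z]
    exact hz z (mem_closedBall_zero_iff.1 z.2)
  choose τ hτ hτz using hex
  refine ⟨τ, fun k => le_trans (by have : (0:ℝ) ≤ k := k.cast_nonneg; linarith) (hτ k), ?_, ?_⟩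
  · exact tendsto_atTop_mono (fun k => le_trans (by linarith) (hτ k)) tendsto_natCast_atTop_atTop
  intro g hg hg0 hga
  have hfreq : ∀ j : ℕ, ∃ᶠ k in atTop, ∀ z ∈ closedBall (0:ℂ) 1,
      ‖riemannZeta ((1 / 2 : ℂ) + (eps k : ℝ) + (lamb k : ℝ) * z + (τ k : ℝ) * Complex.I) - g z‖ < 3 / ((j:ℝ) + 1) := by
    intro j
    have hj0 : (0:ℝ) < (j:ℝ) + 1 := by positivity
    obtain ⟨ρ, h, hρ, hh, hap⟩ := Vor.approx_exp hg hg0 hga (δ := 1 / ((j:ℝ) + 1)) (by positivity)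
    have hcont : ContinuousOn (fun z => exp (h z)) (closedBall 0 1) :=
      continuous_exp.comp_continuousOn (hh.continuousOn.mono (closedBall_subset_ball hρ))
    let f : Gs := ⟨⟨(closedBall (0:ℂ) 1).domRestrict (fun z => exp (h z)), hcont.domRestrict⟩, ρ, h, hρ, hh, fun z => rfl⟩
    obtain ⟨n, hn⟩ := hd.exists_dist_lt f (ε := 1 / ((j:ℝ) + 1)) (by positivity)
    have hn' : ∀ z : closedBall (0:ℂ) 1, ‖exp (h z) - (d n : C(closedBall (0:ℂ) 1, ℂ)) z‖ < 1 / ((j:ℝ) + 1) := by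
      intro z
      rw [← dist_eq_norm]
      exact (ContinuousMap.dist_apply_le_dist (f := f.1) (g := (d n).1) z).trans_lt hn
    rw [frequently_atTop]
    intro N
    refine ⟨Nat.pair n (N + j), ?_, fun z hz => ?_⟩
    · exact (Nat.le_add_right N j).trans (Nat.right_le_pair _ _)
    · have h1 := hτz (Nat.pair n (N + j)) ⟨z, hz⟩
      rw [Nat.unpair_pair] at h1
      simp only at h1
      have h2 : 1 / (((Nat.pair n (N + j) : ℕ):ℝ) + 1) ≤ 1 / ((j:ℝ) + 1) := by
        have : (j:ℝ) ≤ (Nat.pair n (N + j) : ℕ) := by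
          exact_mod_cast (Nat.le_add_left j N).trans (Nat.right_le_pair _ _)
        gcongr
      have h3 := hn' ⟨z, hz⟩
      simp only at h3
      have h4 := hap z hz
      have e1 := norm_sub_le_norm_sub_add_norm_sub
        (riemannZeta (1/2 + eps (Nat.pair n (N + j)) + lamb (Nat.pair n (N + j)) * z + τ (Nat.pair n (N + j)) * I))
        ((d n : C(closedBall (0:ℂ) 1, ℂ)) ⟨z, hz⟩) (g z)
      have e2 := norm_sub_le_norm_sub_add_norm_sub ((d n : C(closedBall (0:ℂ) 1, ℂ)) ⟨z, hz⟩) (exp (h z)) (g z)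
      rw [norm_sub_rev _ (exp (h z))] at e2
      have e3 : 3 / ((j:ℝ) + 1) = 1 / ((j:ℝ) + 1) + 1 / ((j:ℝ) + 1) + 1 / ((j:ℝ) + 1) := by ring
      rw [e3]
      linarith
  obtain ⟨k, hk, hkz⟩ := extraction_forall_of_frequently hfreq
  refine ⟨k, hk, ?_⟩
  rw [Metric.tendstoUniformlyOn_iff]
  intro δ hδ
  have hlim : Tendsto (fun j : ℕ => 3 * (1 / ((j:ℝ) + 1))) atTop (𝓝 (3 * 0)) :=
    tendsto_one_div_add_atTop_nhds_zero_nat.const_mul 3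
  rw [mul_zero] at hlim
  filter_upwards [hlim.eventually (gt_mem_nhds hδ)] with j hj z hz
  rw [dist_comm, dist_eq_norm]
  have := hkz j z hz
  rw [mul_one_div] at hj
  linarith
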